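/- Let F be a finite simple graph with m = |F| vertices. The following are equivalent: (i) for some p ∈ (0,1], the property P̃(F;1/m,…,1/m) of graph sequences is not p-quasi-random; (ii) for some p ∈ (0,1], there exists a graphon W, not a.e. equal to p, satisfying P̃^W(F;1/m,…,1/m); (iii) there exist real numbers u, v, s ≥ 0, not all equal, and reals a, b, not both 0, such that Σ_{A ⊆ V(F), |A| = k} u^{e_F(A)} v^{e_F(A^c)} s^{e_F(A,A^c)} = C(m,k)·(a + bk) for every k = 0,…,m; (iv) there exist u, v, s ≥ 0, not all equal, such that the polynomial Λ(q) := Σ_{A ⊆ V(F)} u^{e_F(A)} v^{e_F(A^c)} s^{e_F(A,A^c)} q^{|A|}(1−q)^{m−|A|} has degree at most 1 in q but does not vanish identically; (v) there exist u, v, s ≥ 0, not all equal, such that the polynomial Λ̂(x) := Σ_{A ⊆ V(F)} u^{e_F(A)} v^{e_F(A^c)} s^{e_F(A,A^c)} (x−1)^{|A|} is divisible by x^{m−1} but does not vanish identically. -/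

import Mathlib

open Filter Finset Asymptotics MeasureTheory

/-- `labCount F G U` is the number of injective graph homomorphisms `φ : F → G`
with `φ i ∈ U i` for every vertex `i` of `F` (the quantity `N(F,G;U₁,…,U_m)`). -/
noncomputable def labCount {m : ℕ} {β : Type} [Fintype β]
    (F : SimpleGraph (Fin m)) (G : SimpleGraph β) (U : Fin m → Finset β) : ℕ :=
  Nat.card {φ : Fin m → β //
    Function.Injective φ ∧ (∀ i j, F.Adj i j → G.Adj (φ i) (φ j)) ∧ ∀ i, φ i ∈ U i}

/-- `totalCount F G` is the total number of injective graph homomorphisms `F → G`,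
the quantity `N(F,G)`. -/
noncomputable def totalCount {m : ℕ} {β : Type} [Fintype β]
    (F : SimpleGraph (Fin m)) (G : SimpleGraph β) : ℕ :=
  Nat.card {φ : Fin m → β //
    Function.Injective φ ∧ ∀ i j, F.Adj i j → G.Adj (φ i) (φ j)}

/-- `symCount F G U` is `Ñ(F,G;U₁,…,U_m) = (1/m!) ∑_σ N(F,G;U_{σ(1)},…,U_{σ(m)})`. -/
noncomputable def symCount {m : ℕ} {β : Type} [Fintype β]
    (F : SimpleGraph (Fin m)) (G : SimpleGraph β) (U : Fin m → Finset β) : ℝ :=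
  ((m.factorial : ℝ))⁻¹ * ∑ σ : Equiv.Perm (Fin m), (labCount F G (fun i => U (σ i)) : ℝ)

/-- `numEdges F` is `e(F)`, the number of edges of `F`. -/
noncomputable def numEdges {m : ℕ} (F : SimpleGraph (Fin m)) : ℕ := Nat.card F.edgeSet

/-- A sequence of graphs `G n` on vertex sets `Fin (V n)` is `p`-quasi-random if, for every
finite simple graph `F`, `N(F,G_n) = p^(e F) |G_n|^(|F|) + o(|G_n|^(|F|))`. -/
def IsQuasirandom (p : ℝ) (V : ℕ → ℕ) (G : ∀ n, SimpleGraph (Fin (V n))) : Prop :=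
  ∀ (m : ℕ) (F : SimpleGraph (Fin m)),
    (fun n => (totalCount F (G n) : ℝ) - p ^ numEdges F * (V n : ℝ) ^ m)
      =o[atTop] (fun n => (V n : ℝ) ^ m)

/-- The property `P(F;α₁,…,α_m)`: `N(F,G_n;U₁,…,U_m) = p^(e F) ∏ |U_i| + o(|G_n|^m)`,
uniformly over all pairwise disjoint `U₁,…,U_m ⊆ V(G_n)` with `|U_i| = ⌊α_i |G_n|⌋`. -/
def SatisfiesP {m : ℕ} (F : SimpleGraph (Fin m)) (p : ℝ) (α : Fin m → ℝ)
    (V : ℕ → ℕ) (G : ∀ n, SimpleGraph (Fin (V n))) : Prop :=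
  ∃ ε : ℕ → ℝ, Tendsto ε atTop (nhds 0) ∧
    ∀ (n : ℕ) (U : Fin m → Finset (Fin (V n))),
      Pairwise (fun i j => Disjoint (U i) (U j)) →
      (∀ i, (U i).card = ⌊α i * (V n : ℝ)⌋₊) →
      |(labCount F (G n) U : ℝ) - p ^ numEdges F * ∏ i, ((U i).card : ℝ)|
        ≤ ε n * (V n : ℝ) ^ m

/-- The property `P̃(F;α₁,…,α_m)`: as `SatisfiesP` but with the symmetrized count `Ñ`. -/
def SatisfiesPt {m : ℕ} (F : SimpleGraph (Fin m)) (p : ℝ) (α : Fin m → ℝ)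
    (V : ℕ → ℕ) (G : ∀ n, SimpleGraph (Fin (V n))) : Prop :=
  ∃ ε : ℕ → ℝ, Tendsto ε atTop (nhds 0) ∧
    ∀ (n : ℕ) (U : Fin m → Finset (Fin (V n))),
      Pairwise (fun i j => Disjoint (U i) (U j)) →
      (∀ i, (U i).card = ⌊α i * (V n : ℝ)⌋₊) →
      |symCount F (G n) U - p ^ numEdges F * ∏ i, ((U i).card : ℝ)|
        ≤ ε n * (V n : ℝ) ^ m

/-- The property `Pᵘ(F;α₁,…,α_m)`: `P` holds for every labelling of `F`. -/
def SatisfiesPu {m : ℕ} (F : SimpleGraph (Fin m)) (p : ℝ) (α : Fin m → ℝ)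
    (V : ℕ → ℕ) (G : ∀ n, SimpleGraph (Fin (V n))) : Prop :=
  ∀ σ : Equiv.Perm (Fin m), SatisfiesP (SimpleGraph.map σ.toEmbedding F) p α V G

/-- A graphon: a symmetric measurable function `[0,1]² → [0,1]`
(encoded as a function on all of `ℝ × ℝ`). -/
def IsGraphon (W : ℝ → ℝ → ℝ) : Prop :=
  Measurable (Function.uncurry W) ∧ (∀ x y, W x y = W y x) ∧
    ∀ x y, W x y ∈ Set.Icc (0 : ℝ) 1

open Classical in
/-- `Ψ_{F,W}(x₁,…,x_m) = ∏_{ij ∈ E(F)} W(x_i,x_j)`. -/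
noncomputable def psi {m : ℕ} (F : SimpleGraph (Fin m)) (W : ℝ → ℝ → ℝ)
    (x : Fin m → ℝ) : ℝ :=
  ∏ i : Fin m, ∏ j : Fin m, if i < j ∧ F.Adj i j then W (x i) (x j) else 1

/-- `Ψ̃_{F,W}`, the symmetrization of `Ψ_{F,W}` over the `m` coordinates. -/
noncomputable def psiSym {m : ℕ} (F : SimpleGraph (Fin m)) (W : ℝ → ℝ → ℝ)
    (x : Fin m → ℝ) : ℝ :=
  ((m.factorial : ℝ))⁻¹ * ∑ σ : Equiv.Perm (Fin m), psi F W (fun i => x (σ i))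

/-- The unit cube `[0,1]^m`. -/
def unitBox (m : ℕ) : Set (Fin m → ℝ) := Set.univ.pi fun _ => Set.Icc (0 : ℝ) 1

/-- The unit square `[0,1]²`. -/
def unitSquare : Set (ℝ × ℝ) := Set.Icc (0 : ℝ) 1 ×ˢ Set.Icc (0 : ℝ) 1

/-- The graphon property `P^W(F;α₁,…,α_m)`:
`∫_{A₁×⋯×A_m} Ψ_{F,W} = p^(e F) ∏ λ(A_i)` for all pairwise disjoint measurable
`A₁,…,A_m ⊆ [0,1]` with `λ(A_i) = α_i`. -/
def GraphonP {m : ℕ} (F : SimpleGraph (Fin m)) (W : ℝ → ℝ → ℝ) (p : ℝ)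
    (α : Fin m → ℝ) : Prop :=
  ∀ A : Fin m → Set ℝ, (∀ i, MeasurableSet (A i)) → (∀ i, A i ⊆ Set.Icc 0 1) →
    Pairwise (fun i j => Disjoint (A i) (A j)) →
    (∀ i, volume (A i) = ENNReal.ofReal (α i)) →
    ∫ x in Set.univ.pi A, psi F W x = p ^ numEdges F * ∏ i, α i

/-- The graphon property `P̃^W(F;α₁,…,α_m)`: as `GraphonP` but with `Ψ̃_{F,W}`. -/
def GraphonPt {m : ℕ} (F : SimpleGraph (Fin m)) (W : ℝ → ℝ → ℝ) (p : ℝ)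
    (α : Fin m → ℝ) : Prop :=
  ∀ A : Fin m → Set ℝ, (∀ i, MeasurableSet (A i)) → (∀ i, A i ⊆ Set.Icc 0 1) →
    Pairwise (fun i j => Disjoint (A i) (A j)) →
    (∀ i, volume (A i) = ENNReal.ofReal (α i)) →
    ∫ x in Set.univ.pi A, psiSym F W x = p ^ numEdges F * ∏ i, α i

/-- `edgesIn F A` is `e_F(A)`, the number of edges of `F` with both endpoints in `A`. -/
noncomputable def edgesIn {m : ℕ} (F : SimpleGraph (Fin m)) (A : Finset (Fin m)) : ℕ :=
  Nat.card {q : Fin m × Fin m // q.1 < q.2 ∧ F.Adj q.1 q.2 ∧ q.1 ∈ A ∧ q.2 ∈ A}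

/-- `edgesBetween F A B` is `e_F(A,B)`, the number of edges of `F` with one endpoint
in `A` and the other in `B` (for disjoint `A`, `B`). -/
noncomputable def edgesBetween {m : ℕ} (F : SimpleGraph (Fin m)) (A B : Finset (Fin m)) : ℕ :=
  Nat.card {q : Fin m × Fin m // F.Adj q.1 q.2 ∧ q.1 ∈ A ∧ q.2 ∈ B}

section PolynomialForms
open Polynomial

theorem sum_bernstein_affine (m : ℕ) (a b : ℝ) :
    ∑ k ∈ range (m + 1), C ((m.choose k : ℝ) * (a + b * k)) * X ^ k * (1 - X) ^ (m - k)
      = (C a + C (b * m) * X : ℝ[X]) := by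
  have h0 := bernsteinPolynomial.sum ℝ m
  have h1 := bernsteinPolynomial.sum_smul ℝ m
  have : ∀ k ∈ range (m + 1), C ((m.choose k : ℝ) * (a + b * k)) * X ^ k * (1 - X) ^ (m - k)
      = C a * bernsteinPolynomial ℝ m k + C b * (k • bernsteinPolynomial ℝ m k) := by
    intro k _
    simp only [bernsteinPolynomial, nsmul_eq_mul, map_mul, map_add, map_natCast]
    ring
  rw [sum_congr rfl this, sum_add_distrib, ← mul_sum, ← mul_sum, h0, h1]
  simp [mul_assoc]

theorem sum_shifted_affine {m : ℕ} (hm : m ≠ 0) (a b : ℝ) :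
    ∑ k ∈ range (m + 1), C ((m.choose k : ℝ) * (a + b * k)) * (X - 1) ^ k
      = (X ^ (m - 1) * (C (a + b * m) * X - C (b * m)) : ℝ[X]) := by
  obtain ⟨l, rfl⟩ := Nat.exists_eq_succ_of_ne_zero hm
  have key : ∀ k ∈ range (l + 1 + 1), C (((l + 1).choose k : ℝ) * (a + b * k)) * (X - 1) ^ k
      = C a * ((X - 1) ^ k * 1 ^ (l + 1 - k) * ((l + 1).choose k : ℝ[X]))
        + C b * ((((l + 1).choose k * k : ℕ) : ℝ[X]) * (X - 1) ^ k) := by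
    intro k _
    simp only [map_mul, map_add, map_natCast, Nat.cast_mul, one_pow]
    ring
  have h2 : ∑ k ∈ range (l + 1 + 1), (((l + 1).choose k * k : ℕ) : ℝ[X]) * (X - 1) ^ k
      = (l + 1 : ℝ[X]) * (X - 1) * X ^ l := by
    rw [sum_range_succ']
    have h3 : ∀ k ∈ range (l + 1), (((l + 1).choose (k + 1) * (k + 1) : ℕ) : ℝ[X]) * (X - 1) ^ (k + 1)
        = (l + 1 : ℝ[X]) * (X - 1) * ((X - 1) ^ k * 1 ^ (l - k) * (l.choose k : ℝ[X])) := by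
      intro k _
      rw [← Nat.add_one_mul_choose_eq]
      push_cast
      ring
    rw [sum_congr rfl h3, ← mul_sum, ← add_pow]
    simp
  rw [show l.succ = l + 1 from rfl, sum_congr rfl key, sum_add_distrib, ← mul_sum, ← mul_sum, h2,
    ← add_pow]
  simp only [sub_add_cancel, Nat.cast_add, Nat.cast_one, map_add, map_mul, map_natCast, map_one,
    Nat.add_sub_cancel]
  ring

theorem eq_of_sum_bernstein_eq {m : ℕ} {w w' : ℕ → ℝ}
    (h : ∑ k ∈ range (m + 1), C (w k) * X ^ k * (1 - X) ^ (m - k)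
      = (∑ k ∈ range (m + 1), C (w' k) * X ^ k * (1 - X) ^ (m - k) : ℝ[X])) :
    ∀ k ≤ m, w k = w' k := by
  have hroot : ∀ y ∈ Set.Ioi (0 : ℝ),
      y ∈ {z | (∑ k ∈ range (m + 1), C (w k - w' k) * X ^ k : ℝ[X]).IsRoot z} := by
    intro y hy
    have hy' : 1 + y ≠ 0 := by have : 0 < y := hy; positivity
    have h1 := congrArg (Polynomial.eval (y / (1 + y))) h
    simp only [eval_finsetSum, eval_mul, eval_C, eval_pow, eval_X, eval_sub, eval_one] at h1
    have h2 : (1 - y / (1 + y)) = 1 / (1 + y) := by field_simp; ring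
    have h3 : ∀ v : ℕ → ℝ, ∑ k ∈ range (m + 1), v k * (y / (1 + y)) ^ k * (1 / (1 + y)) ^ (m - k)
        = (∑ k ∈ range (m + 1), v k * y ^ k) / (1 + y) ^ m := by
      intro v
      rw [sum_div]
      refine sum_congr rfl fun k hk => ?_
      have hk' : k ≤ m := by simpa [Nat.lt_succ_iff] using hk
      rw [div_pow, div_pow, one_pow, ← pow_mul_pow_sub (1 + y) hk']
      field_simp
    rw [h2, h3, h3, div_left_inj' (pow_ne_zero _ hy')] at h1
    simp only [Set.mem_ofPred_eq, IsRoot.def, eval_finsetSum, eval_mul, eval_C, eval_pow, eval_X,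
      sub_mul, sum_sub_distrib, h1, sub_self]
  have hz := eq_zero_of_infinite_isRoot _ ((Set.Ioi_infinite (0 : ℝ)).mono hroot)
  intro k hk
  have := congrArg (fun q : ℝ[X] => q.coeff k) hz
  simp only [finsetSum_coeff, coeff_C_mul, coeff_X_pow, mul_ite, mul_one, mul_zero, sum_ite_eq,
    mem_range, coeff_zero] at this
  rw [if_pos (by omega)] at this
  linarith

theorem eq_of_sum_shifted_eq {m : ℕ} {w w' : ℕ → ℝ}
    (h : ∑ k ∈ range (m + 1), C (w k) * (X - 1) ^ k
      = (∑ k ∈ range (m + 1), C (w' k) * (X - 1) ^ k : ℝ[X])) :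
    ∀ k ≤ m, w k = w' k := by
  intro k hk
  have h2 := congrArg (fun q : ℝ[X] => (q.comp (X + 1)).coeff k) h
  have hcomp : ∀ w : ℕ → ℝ, ((∑ k ∈ range (m + 1), C (w k) * (X - 1) ^ k : ℝ[X]).comp
      (X + 1)).coeff k = w k := by
    intro w
    simp only [Polynomial.sum_comp, mul_comp, C_comp, pow_comp, sub_comp, X_comp, one_comp,
      add_sub_cancel_right, finsetSum_coeff, coeff_C_mul, coeff_X_pow]
    simp only [mul_ite, mul_one, mul_zero, sum_ite_eq, mem_range]
    rw [if_pos (by omega)]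
  simpa only [hcomp] using h2

theorem affine_iff_bernstein_degree {m : ℕ} (w : ℕ → ℝ) (hw : m = 0 → w 0 ≠ 0) :
    (∃ a b : ℝ, ¬ (a = 0 ∧ b = 0) ∧ ∀ k ≤ m, w k = (m.choose k : ℝ) * (a + b * k)) ↔
      ((∑ k ∈ range (m + 1), C (w k) * X ^ k * (1 - X) ^ (m - k) : ℝ[X]).degree ≤ 1 ∧
        (∑ k ∈ range (m + 1), C (w k) * X ^ k * (1 - X) ^ (m - k) : ℝ[X]) ≠ 0) := by
  rcases Nat.eq_zero_or_pos m with rfl | hm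
  · have h0 := hw rfl
    constructor
    · intro _
      simp only [zero_add, range_one, sum_singleton, pow_zero, Nat.sub_zero, mul_one]
      exact ⟨(degree_C_le).trans (by norm_num), by simpa using h0⟩
    · intro _
      refine ⟨w 0, 0, by simp [h0], fun k hk => ?_⟩
      obtain rfl : k = 0 := by omega
      simp
  have hm' : (m : ℝ) ≠ 0 := by exact_mod_cast hm.ne'
  constructor
  · rintro ⟨a, b, hab, h⟩
    have : ∑ k ∈ range (m + 1), C (w k) * X ^ k * (1 - X) ^ (m - k)
        = (C (b * m) * X + C a : ℝ[X]) := by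
      rw [add_comm (C (b * m) * X), ← sum_bernstein_affine]
      exact sum_congr rfl fun k hk => by rw [h k (by simpa [Nat.lt_succ_iff] using hk)]
    rw [this]
    refine ⟨degree_linear_le, fun h0 => hab ?_⟩
    have e0 := congrArg (fun q : ℝ[X] => q.coeff 0) h0
    have e1 := congrArg (fun q : ℝ[X] => q.coeff 1) h0
    simp only [coeff_add, coeff_C_mul, coeff_X_zero, coeff_C_zero, coeff_X_one, coeff_zero,
      coeff_C_succ, mul_zero, mul_one, zero_add, add_zero] at e0 e1
    exact ⟨e0, by simpa [hm'] using e1⟩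
  · rintro ⟨hd, hne⟩
    have hform := eq_X_add_C_of_degree_le_one hd
    set q : ℝ[X] := ∑ k ∈ range (m + 1), C (w k) * X ^ k * (1 - X) ^ (m - k) with hq
    refine ⟨q.coeff 0, q.coeff 1 / m, fun hab => hne ?_, ?_⟩
    · have h1 : q.coeff 1 = 0 := by simpa [hm'] using hab.2
      rw [hform, h1, hab.1]; simp
    · refine eq_of_sum_bernstein_eq ?_
      rw [sum_bernstein_affine, ← hq, div_mul_cancel₀ _ hm', add_comm (C _)]
      exact hform

theorem affine_iff_shifted_dvd {m : ℕ} (w : ℕ → ℝ) (hw : m = 0 → w 0 ≠ 0) :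
    (∃ a b : ℝ, ¬ (a = 0 ∧ b = 0) ∧ ∀ k ≤ m, w k = (m.choose k : ℝ) * (a + b * k)) ↔
      ((X ^ (m - 1) : ℝ[X]) ∣ (∑ k ∈ range (m + 1), C (w k) * (X - 1) ^ k : ℝ[X]) ∧
        (∑ k ∈ range (m + 1), C (w k) * (X - 1) ^ k : ℝ[X]) ≠ 0) := by
  rcases Nat.eq_zero_or_pos m with rfl | hm
  · have h0 := hw rfl
    constructor
    · intro _
      simpa using h0
    · intro _
      refine ⟨w 0, 0, by simp [h0], fun k hk => ?_⟩
      obtain rfl : k = 0 := by omega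
      simp
  have hm' : (m : ℝ) ≠ 0 := by exact_mod_cast hm.ne'
  constructor
  · rintro ⟨a, b, hab, h⟩
    have : ∑ k ∈ range (m + 1), C (w k) * (X - 1) ^ k
        = (X ^ (m - 1) * (C (a + b * m) * X - C (b * m)) : ℝ[X]) := by
      rw [← sum_shifted_affine hm.ne']
      exact sum_congr rfl fun k hk => by rw [h k (by simpa [Nat.lt_succ_iff] using hk)]
    rw [this]
    refine ⟨dvd_mul_right _ _, mul_ne_zero (pow_ne_zero _ X_ne_zero) fun h0 => hab ?_⟩
    have e0 := congrArg (fun q : ℝ[X] => q.coeff 0) h0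
    have e1 := congrArg (fun q : ℝ[X] => q.coeff 1) h0
    simp only [coeff_sub, coeff_C_mul, coeff_X_zero, coeff_C_zero, coeff_X_one, coeff_zero,
      coeff_C_succ, mul_zero, mul_one, zero_sub, sub_zero, neg_eq_zero] at e0 e1
    have hb : b = 0 := by simpa [hm'] using e0
    subst hb
    exact ⟨by simpa using e1, rfl⟩
  · rintro ⟨⟨r, hr⟩, hne⟩
    set q : ℝ[X] := ∑ k ∈ range (m + 1), C (w k) * (X - 1) ^ k with hq
    have hqd : q.natDegree ≤ m := by
      refine natDegree_sum_le_of_forall_le _ _ fun k hk => ?_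
      have h1 : ((X - 1 : ℝ[X]) ^ k).natDegree ≤ k := by
        refine natDegree_pow_le.trans ?_
        have : (X - 1 : ℝ[X]).natDegree = 1 := by simpa using natDegree_X_sub_C (1 : ℝ)
        simp [this]
      refine (natDegree_C_mul_le _ _).trans (h1.trans ?_)
      simpa [Nat.lt_succ_iff] using hk
    have hr0 : r ≠ 0 := by rintro rfl; exact hne (by rw [hr, mul_zero])
    have hrd : r.natDegree ≤ 1 := by
      rw [hr, natDegree_mul (pow_ne_zero _ X_ne_zero) hr0, natDegree_X_pow] at hqd
      omega
    have hform := eq_X_add_C_of_natDegree_le_one hrd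
    refine ⟨r.coeff 1 + r.coeff 0, - r.coeff 0 / m, fun hab => hr0 ?_, ?_⟩
    · have h0 : r.coeff 0 = 0 := by simpa [hm'] using hab.2
      have h1 : r.coeff 1 = 0 := by simpa [h0] using hab.1
      rw [hform, h1, h0]; simp
    · refine eq_of_sum_shifted_eq ?_
      rw [sum_shifted_affine hm.ne', ← hq, hr, div_mul_cancel₀ _ hm']
      congr 1
      conv_lhs => rw [hform]
      simp only [map_add, map_neg]
      simp

theorem sum_finset_bernstein {m : ℕ} (W : Finset (Fin m) → ℝ) :
    (∑ A : Finset (Fin m), C (W A) * X ^ A.card * (1 - X) ^ (m - A.card) : ℝ[X])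
      = ∑ k ∈ range (m + 1), C (∑ A ∈ powersetCard k (univ : Finset (Fin m)), W A)
          * X ^ k * (1 - X) ^ (m - k) := by
  rw [← powerset_univ, sum_powerset, card_univ, Fintype.card_fin]
  refine sum_congr rfl fun k _ => ?_
  rw [map_sum, sum_mul, sum_mul]
  exact sum_congr rfl fun A hA => by rw [(mem_powersetCard.1 hA).2]

theorem sum_finset_shifted {m : ℕ} (W : Finset (Fin m) → ℝ) :
    (∑ A : Finset (Fin m), C (W A) * (X - 1) ^ A.card : ℝ[X])
      = ∑ k ∈ range (m + 1), C (∑ A ∈ powersetCard k (univ : Finset (Fin m)), W A)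
          * (X - 1) ^ k := by
  rw [← powerset_univ, sum_powerset, card_univ, Fintype.card_fin]
  refine sum_congr rfl fun k _ => ?_
  rw [map_sum, sum_mul]
  exact sum_congr rfl fun A hA => by rw [(mem_powersetCard.1 hA).2]

end PolynomialForms

section EdgeProducts

open Classical in
/-- The edges of `F`, as increasing pairs. -/
noncomputable def edgePairs {m : ℕ} (F : SimpleGraph (Fin m)) : Finset (Fin m × Fin m) :=
  univ.filter fun e => e.1 < e.2 ∧ F.Adj e.1 e.2

/-- The product of a kernel over the edges of `F`. -/
noncomputable def edgeProd {m : ℕ} {α : Type*} (F : SimpleGraph (Fin m)) (w : α → α → ℝ)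
    (x : Fin m → α) : ℝ :=
  ∏ e ∈ edgePairs F, w (x e.1) (x e.2)

/-- The symmetrization of `edgeProd`. -/
noncomputable def symEdgeProd {m : ℕ} {α : Type*} (F : SimpleGraph (Fin m)) (w : α → α → ℝ)
    (x : Fin m → α) : ℝ :=
  ((m.factorial : ℝ))⁻¹ * ∑ σ : Equiv.Perm (Fin m), edgeProd F w (fun i => x (σ i))

variable {m : ℕ} {α : Type*}

theorem mem_edgePairs {F : SimpleGraph (Fin m)} {e : Fin m × Fin m} :
    e ∈ edgePairs F ↔ e.1 < e.2 ∧ F.Adj e.1 e.2 := by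
  simp [edgePairs]

theorem psi_eq_edgeProd (F : SimpleGraph (Fin m)) (W : ℝ → ℝ → ℝ) (x : Fin m → ℝ) :
    psi F W x = edgeProd F W x := by
  classical
  rw [psi, edgeProd, edgePairs, prod_filter, ← Finset.univ_product_univ, prod_product]

theorem psiSym_eq_symEdgeProd (F : SimpleGraph (Fin m)) (W : ℝ → ℝ → ℝ) (x : Fin m → ℝ) :
    psiSym F W x = symEdgeProd F W x := by
  simp only [psiSym, symEdgeProd, psi_eq_edgeProd]

theorem numEdges_eq_card (F : SimpleGraph (Fin m)) : numEdges F = (edgePairs F).card := by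
  classical
  have hcard : (edgePairs F).card = Nat.card {e // e ∈ edgePairs F} := by simp
  rw [numEdges, hcard]
  symm
  refine Nat.card_congr (Equiv.ofBijective (fun e => ⟨s(e.1.1, e.1.2), ?_⟩) ⟨?_, ?_⟩)
  · exact (mem_edgePairs.1 e.2).2
  · rintro ⟨⟨a, b⟩, h⟩ ⟨⟨c, d⟩, h'⟩ heq
    have h1 := (mem_edgePairs.1 h).1
    have h2 := (mem_edgePairs.1 h').1
    have heq' : s(a, b) = s(c, d) := congrArg Subtype.val heq
    rcases Sym2.eq_iff.1 heq' with ⟨rfl, rfl⟩ | ⟨rfl, rfl⟩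
    · rfl
    · exact absurd (h1.trans h2) (lt_irrefl _)
  · rintro ⟨e, he⟩
    induction e using Sym2.ind with
    | _ a b =>
      have hab : F.Adj a b := he
      rcases lt_or_gt_of_ne hab.ne with h | h
      · exact ⟨⟨(a, b), mem_edgePairs.2 ⟨h, hab⟩⟩, rfl⟩
      · exact ⟨⟨(b, a), mem_edgePairs.2 ⟨h, hab.symm⟩⟩, Subtype.ext Sym2.eq_swap⟩

theorem edgeProd_const (F : SimpleGraph (Fin m)) (p : ℝ) (x : Fin m → α) :
    edgeProd F (fun _ _ => p) x = p ^ numEdges F := by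
  rw [edgeProd, prod_const, numEdges_eq_card]

theorem symEdgeProd_of_edgeProd_const {F : SimpleGraph (Fin m)} {w : α → α → ℝ} {K : ℝ}
    {x : Fin m → α} (h : ∀ σ : Equiv.Perm (Fin m), edgeProd F w (fun i => x (σ i)) = K) :
    symEdgeProd F w x = K := by
  rw [symEdgeProd, sum_congr rfl fun σ _ => h σ, sum_const, card_univ, Fintype.card_perm,
    Fintype.card_fin, nsmul_eq_mul, ← mul_assoc, inv_mul_cancel₀ (by positivity), one_mul]

theorem symEdgeProd_perm (F : SimpleGraph (Fin m)) (w : α → α → ℝ) (x : Fin m → α)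
    (τ : Equiv.Perm (Fin m)) :
    symEdgeProd F w (fun i => x (τ i)) = symEdgeProd F w x := by
  rw [symEdgeProd, symEdgeProd]
  congr 1
  exact Fintype.sum_equiv (Equiv.mulLeft τ) _ _ fun σ => rfl

theorem edgeProd_mem_Icc (F : SimpleGraph (Fin m)) {w : α → α → ℝ}
    (hw : ∀ a b, w a b ∈ Set.Icc (0 : ℝ) 1) (x : Fin m → α) :
    edgeProd F w x ∈ Set.Icc (0 : ℝ) 1 :=
  ⟨prod_nonneg fun _ _ => (hw _ _).1, prod_le_one (fun _ _ => (hw _ _).1) fun _ _ => (hw _ _).2⟩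

theorem symEdgeProd_bounds (F : SimpleGraph (Fin m)) {w : α → α → ℝ} {x : Fin m → α} {l b : ℝ}
    (h : ∀ σ : Equiv.Perm (Fin m), edgeProd F w (fun i => x (σ i)) ∈ Set.Icc l b) :
    symEdgeProd F w x ∈ Set.Icc l b := by
  have hf : (0 : ℝ) < (m.factorial : ℝ) := by positivity
  have hc : ((univ : Finset (Equiv.Perm (Fin m))).card : ℝ) = m.factorial := by
    rw [card_univ, Fintype.card_perm, Fintype.card_fin]
  rw [symEdgeProd]
  constructor
  · rw [le_inv_mul_iff₀ hf, ← hc, ← nsmul_eq_mul]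
    exact card_nsmul_le_sum _ _ _ fun σ _ => (h σ).1
  · rw [inv_mul_le_iff₀ hf, ← hc, ← nsmul_eq_mul]
    exact sum_le_card_nsmul _ _ _ fun σ _ => (h σ).2

theorem symEdgeProd_mem_Icc (F : SimpleGraph (Fin m)) {w : α → α → ℝ}
    (hw : ∀ a b, w a b ∈ Set.Icc (0 : ℝ) 1) (x : Fin m → α) :
    symEdgeProd F w x ∈ Set.Icc (0 : ℝ) 1 :=
  symEdgeProd_bounds F fun _ => edgeProd_mem_Icc F hw _

theorem abs_prod_sub_prod_le {ι : Type*} (s : Finset ι) (f g : ι → ℝ)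
    (hf : ∀ i ∈ s, f i ∈ Set.Icc (0 : ℝ) 1) (hg : ∀ i ∈ s, g i ∈ Set.Icc (0 : ℝ) 1) :
    |∏ i ∈ s, f i - ∏ i ∈ s, g i| ≤ ∑ i ∈ s, |f i - g i| := by
  classical
  induction s using Finset.induction_on with
  | empty => simp
  | insert a s ha ih =>
    rw [prod_insert ha, prod_insert ha, sum_insert ha]
    have ih' := ih (fun i hi => hf i (mem_insert_of_mem hi)) fun i hi => hg i (mem_insert_of_mem hi)
    have h1 : f a * ∏ i ∈ s, f i - g a * ∏ i ∈ s, g i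
        = (f a - g a) * ∏ i ∈ s, f i + g a * (∏ i ∈ s, f i - ∏ i ∈ s, g i) := by ring
    have h2 : |∏ i ∈ s, f i| ≤ 1 := by
      rw [abs_of_nonneg (prod_nonneg fun i hi => (hf i (mem_insert_of_mem hi)).1)]
      exact prod_le_one (fun i hi => (hf i (mem_insert_of_mem hi)).1)
        fun i hi => (hf i (mem_insert_of_mem hi)).2
    have h3 : |g a| ≤ 1 := by
      rw [abs_of_nonneg (hg a (mem_insert_self a s)).1]
      exact (hg a (mem_insert_self a s)).2
    rw [h1]
    refine (abs_add_le _ _).trans (add_le_add ?_ ?_)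
    · rw [abs_mul]; exact mul_le_of_le_one_right (abs_nonneg _) h2
    · rw [abs_mul]; exact (mul_le_of_le_one_left (abs_nonneg _) h3).trans ih'

theorem abs_edgeProd_sub_le (F : SimpleGraph (Fin m)) {β : Type*} {w : α → α → ℝ} {w' : β → β → ℝ}
    (hw : ∀ a b, w a b ∈ Set.Icc (0 : ℝ) 1) (hw' : ∀ a b, w' a b ∈ Set.Icc (0 : ℝ) 1)
    (x : Fin m → α) (y : Fin m → β) :
    |edgeProd F w x - edgeProd F w' y|
      ≤ ∑ e ∈ edgePairs F, |w (x e.1) (x e.2) - w' (y e.1) (y e.2)| :=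
  abs_prod_sub_prod_le _ _ _ (fun _ _ => hw _ _) fun _ _ => hw' _ _

end EdgeProducts

section Counting

/-- The (unnormalized) cut norm of the kernel `M` is at most `c` times the number of pairs. -/
def CutLe {α : Type*} [Fintype α] (M : α → α → ℝ) (c : ℝ) : Prop :=
  ∀ g h : α → ℝ, (∀ x, g x ∈ Set.Icc (0 : ℝ) 1) → (∀ x, h x ∈ Set.Icc (0 : ℝ) 1) →
    |∑ x, ∑ y, M x y * g x * h y| ≤ c * (Fintype.card α : ℝ) ^ 2

variable {m : ℕ} {α : Type*} [Fintype α]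

theorem sum_update_sum {ι : Type*} [Fintype ι] [DecidableEq ι] (i : ι) (f : (ι → α) → ℝ) :
    ∑ x : ι → α, ∑ a : α, f (Function.update x i a) = (Fintype.card α : ℝ) * ∑ x, f x := by
  classical
  rw [← Fintype.sum_prod_type' (f := fun (x : ι → α) a => f (Function.update x i a))]
  have : ∑ q : (ι → α) × α, f (Function.update q.1 i q.2) = ∑ q : (ι → α) × α, f q.1 := by
    refine Fintype.sum_equiv
      ⟨fun q => (Function.update q.1 i q.2, q.1 i), fun q => (Function.update q.1 i q.2, q.1 i),
        fun q => ?_, fun q => ?_⟩ _ _ fun q => rfl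
    · simp
    · simp
  rw [this, Fintype.sum_prod_type]
  simp [mul_sum]

/-- `R` splits as a product of two `[0,1]`-valued functions of the coordinates `i` and `j`,
all other coordinates being fixed. -/
def SplitsAt (i j : Fin m) (R : (Fin m → α) → ℝ) : Prop :=
  ∀ x, ∃ A B : α → ℝ, (∀ a, A a ∈ Set.Icc (0 : ℝ) 1) ∧ (∀ a, B a ∈ Set.Icc (0 : ℝ) 1) ∧
    ∀ a b, R (Function.update (Function.update x i a) j b) = A a * B b

omit [Fintype α] in
theorem SplitsAt.mul {i j : Fin m} {R R' : (Fin m → α) → ℝ} (h : SplitsAt i j R)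
    (h' : SplitsAt i j R') : SplitsAt i j (fun x => R x * R' x) := by
  intro x
  obtain ⟨A, B, hA, hB, hR⟩ := h x
  obtain ⟨A', B', hA', hB', hR'⟩ := h' x
  refine ⟨fun a => A a * A' a, fun b => B b * B' b, fun a => ?_, fun a => ?_, fun a b => ?_⟩
  · exact ⟨mul_nonneg (hA a).1 (hA' a).1, mul_le_one₀ (hA a).2 (hA' a).1 (hA' a).2⟩
  · exact ⟨mul_nonneg (hB a).1 (hB' a).1, mul_le_one₀ (hB a).2 (hB' a).1 (hB' a).2⟩
  · simp only [hR, hR']; ring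

omit [Fintype α] in
theorem SplitsAt.prod {ι : Type*} {i j : Fin m} (s : Finset ι) {R : ι → (Fin m → α) → ℝ}
    (h : ∀ l ∈ s, SplitsAt i j (R l)) : SplitsAt i j (fun x => ∏ l ∈ s, R l x) := by
  classical
  induction s using Finset.induction_on with
  | empty => exact fun x => ⟨1, 1, by simp, by simp, by simp⟩
  | insert a s ha ih =>
    simp only [prod_insert ha]
    exact (h a (mem_insert_self a s)).mul (ih fun l hl => h l (mem_insert_of_mem hl))

omit [Fintype α] in
theorem splitsAt_kernel {i j k l : Fin m} {K : α → α → ℝ}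
    (hK : ∀ a b, K a b ∈ Set.Icc (0 : ℝ) 1) (h : (k ≠ j ∧ l ≠ j) ∨ (k ≠ i ∧ l ≠ i)) :
    SplitsAt i j (fun x : Fin m → α => K (x k) (x l)) := by
  intro x
  by_cases hij : i = j
  · subst hij
    refine ⟨1, fun b => K (Function.update x i b k) (Function.update x i b l), by simp,
      fun a => hK _ _, fun a b => by simp⟩
  rcases h with ⟨hk, hl⟩ | ⟨hk, hl⟩
  · refine ⟨fun a => K (Function.update x i a k) (Function.update x i a l), 1, fun a => hK _ _,
      by simp, fun a b => ?_⟩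
    simp [Function.update_of_ne hk, Function.update_of_ne hl]
  · refine ⟨1, fun b => K (Function.update x j b k) (Function.update x j b l), by simp,
      fun a => hK _ _, fun a b => ?_⟩
    rw [Function.update_comm hij]
    simp [Function.update_of_ne hk, Function.update_of_ne hl]

theorem abs_sum_splitsAt_le {i j : Fin m} (hij : i ≠ j) {M : α → α → ℝ} {c : ℝ} (hM : CutLe M c)
    {R : (Fin m → α) → ℝ} (hR : SplitsAt i j R) :
    |∑ x : Fin m → α, M (x i) (x j) * R x| ≤ c * (Fintype.card α : ℝ) ^ m := by
  classical
  rcases Nat.eq_zero_or_pos (Fintype.card α) with h0 | hpos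
  · have : IsEmpty (Fin m → α) := by
      have := Fintype.card_eq_zero_iff.1 h0
      exact ⟨fun x => IsEmpty.false (x i)⟩
    have hm : m ≠ 0 := by rintro rfl; exact i.elim0
    simp [h0, hm]
  have hV : (0 : ℝ) < Fintype.card α := by exact_mod_cast hpos
  have key : (Fintype.card α : ℝ) ^ 2 * ∑ x : Fin m → α, M (x i) (x j) * R x
      = ∑ x : Fin m → α, ∑ a, ∑ b, M a b * R (Function.update (Function.update x i a) j b) := by
    rw [pow_two, mul_assoc, ← sum_update_sum j, ← sum_update_sum i]
    refine sum_congr rfl fun x _ => sum_congr rfl fun a _ => sum_congr rfl fun b _ => ?_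
    simp [Function.update_of_ne hij]
  have bound : |∑ x : Fin m → α, ∑ a, ∑ b,
      M a b * R (Function.update (Function.update x i a) j b)|
      ≤ (Fintype.card α : ℝ) ^ m * (c * (Fintype.card α : ℝ) ^ 2) := by
    refine (abs_sum_le_sum_abs _ _).trans ?_
    have hcard : ((univ : Finset (Fin m → α)).card : ℝ) = (Fintype.card α : ℝ) ^ m := by
      rw [card_univ]; simp
    rw [← hcard, ← nsmul_eq_mul]
    refine sum_le_card_nsmul _ _ _ fun x _ => ?_
    obtain ⟨A, B, hA, hB, hAB⟩ := hR x
    have := hM A B hA hB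
    simpa only [hAB, mul_assoc] using this
  rw [← key, abs_mul, abs_of_pos (by positivity)] at bound
  have h2 : (0 : ℝ) < (Fintype.card α : ℝ) ^ 2 := by positivity
  nlinarith [bound, h2]

theorem abs_sum_edgeProd_sub_le (F : SimpleGraph (Fin m)) {w w' : α → α → ℝ}
    (hw : ∀ a b, w a b ∈ Set.Icc (0 : ℝ) 1) (hw' : ∀ a b, w' a b ∈ Set.Icc (0 : ℝ) 1) {c : ℝ}
    (hc : CutLe (fun a b => w a b - w' a b) c) (h : Fin m → α → ℝ)
    (hh : ∀ i a, h i a ∈ Set.Icc (0 : ℝ) 1) :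
    |∑ x : Fin m → α, edgeProd F w x * ∏ i, h i (x i)
        - ∑ x : Fin m → α, edgeProd F w' x * ∏ i, h i (x i)|
      ≤ numEdges F * c * (Fintype.card α : ℝ) ^ m := by
  classical
  set E := edgePairs F with hE
  have main : ∀ S ⊆ E, |∑ x : Fin m → α, (∏ e ∈ E, w (x e.1) (x e.2)) * ∏ i, h i (x i)
      - ∑ x : Fin m → α, (∏ e ∈ E, (if e ∈ S then w' else w) (x e.1) (x e.2)) * ∏ i, h i (x i)|
      ≤ S.card * c * (Fintype.card α : ℝ) ^ m := by
    intro S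
    induction S using Finset.induction_on with
    | empty => intro _; simp
    | insert e S he ih =>
      intro hS
      have heE : e ∈ E := hS (mem_insert_self e S)
      have ih' := ih fun a ha => hS (mem_insert_of_mem ha)
      have hlt : e.1 < e.2 := (mem_edgePairs.1 heE).1
      have hsplit : SplitsAt e.1 e.2 (fun x : Fin m → α =>
          (∏ e' ∈ E.erase e, (if e' ∈ S then w' else w) (x e'.1) (x e'.2)) * ∏ i, h i (x i)) := by
        refine SplitsAt.mul (SplitsAt.prod _ fun e' he' => ?_) (SplitsAt.prod _ fun l _ => ?_)
        · have h1 := (mem_edgePairs.1 (mem_of_mem_erase he')).1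
          have h2 := ne_of_mem_erase he'
          refine splitsAt_kernel (K := if e' ∈ S then w' else w) ?_ ?_
          · split_ifs <;> assumption
          · by_contra hcon
            push Not at hcon
            obtain ⟨ha, hb⟩ := hcon
            have : e' = e := by
              rcases eq_or_ne e'.1 e.2 with q | q
              · have q2 : e'.2 = e.1 := by
                  by_contra q3
                  exact q3 (hb (by rw [q]; exact hlt.ne'))
                rw [q, q2] at h1
                exact absurd (h1.trans hlt) (lt_irrefl _)
              · have q2 := ha q
                have q3 : e'.1 = e.1 := by
                  by_contra q4
                  have := hb q4
                  rw [q2] at this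
                  exact hlt.ne' this
                exact Prod.ext q3 q2
            exact h2 this
        · exact splitsAt_kernel (K := fun a _ => h l a) (k := l) (l := l) (fun a _ => hh l a)
            (by rcases eq_or_ne l e.2 with q | q
                · right; rw [q]; exact ⟨hlt.ne', hlt.ne'⟩
                · left; exact ⟨q, q⟩)
      have step := abs_sum_splitsAt_le hlt.ne hc hsplit
      have hdiff : ∑ x : Fin m → α,
            (∏ e' ∈ E, (if e' ∈ S then w' else w) (x e'.1) (x e'.2)) * ∏ i, h i (x i)
          - ∑ x : Fin m → α,
            (∏ e' ∈ E, (if e' ∈ insert e S then w' else w) (x e'.1) (x e'.2)) * ∏ i, h i (x i)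
          = ∑ x : Fin m → α, (w (x e.1) (x e.2) - w' (x e.1) (x e.2)) *
            ((∏ e' ∈ E.erase e, (if e' ∈ S then w' else w) (x e'.1) (x e'.2))
              * ∏ i, h i (x i)) := by
        rw [← sum_sub_distrib]
        refine sum_congr rfl fun x _ => ?_
        rw [← mul_prod_erase E _ heE, ← mul_prod_erase E _ heE, if_neg he,
          if_pos (mem_insert_self e S)]
        have : ∏ e' ∈ E.erase e, (if e' ∈ insert e S then w' else w) (x e'.1) (x e'.2)
            = ∏ e' ∈ E.erase e, (if e' ∈ S then w' else w) (x e'.1) (x e'.2) :=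
          prod_congr rfl fun e' he' => by
            simp only [mem_insert, ne_of_mem_erase he', false_or]
        rw [this]
        ring
      rw [card_insert_of_notMem he]
      rw [← hdiff] at step
      have := abs_sub_le (∑ x : Fin m → α, (∏ e ∈ E, w (x e.1) (x e.2)) * ∏ i, h i (x i))
        (∑ x : Fin m → α,
            (∏ e' ∈ E, (if e' ∈ S then w' else w) (x e'.1) (x e'.2)) * ∏ i, h i (x i))
        (∑ x : Fin m → α,
            (∏ e' ∈ E, (if e' ∈ insert e S then w' else w) (x e'.1) (x e'.2)) * ∏ i, h i (x i))
      push_cast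
      linarith
  have hfin := main E subset_rfl
  have hrw : ∑ x : Fin m → α, edgeProd F w' x * ∏ i, h i (x i)
      = ∑ x : Fin m → α, (∏ e ∈ E, (if e ∈ E then w' else w) (x e.1) (x e.2)) * ∏ i, h i (x i) := by
    refine sum_congr rfl fun x _ => ?_
    have : edgeProd F w' x = ∏ e ∈ E, (if e ∈ E then w' else w) (x e.1) (x e.2) :=
      prod_congr rfl fun e he => by rw [if_pos (hE ▸ he)]
    rw [this]
  rw [numEdges_eq_card, hrw]
  exact hfin

end Counting

section CutNorm

variable {α : Type*} [Fintype α]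

theorem abs_sum_mul_le_of_finset {L : α → ℝ} {C : ℝ} (h : ∀ S : Finset α, |∑ x ∈ S, L x| ≤ C)
    {g : α → ℝ} (hg : ∀ x, g x ∈ Set.Icc (0 : ℝ) 1) : |∑ x, L x * g x| ≤ C := by
  classical
  rw [abs_le]
  constructor
  · have h1 := (abs_le.1 (h (univ.filter fun x => L x < 0))).1
    refine h1.trans ?_
    rw [sum_filter]
    refine sum_le_sum fun x _ => ?_
    have := hg x
    split_ifs with hx
    · nlinarith [this.2]
    · exact mul_nonneg (not_lt.1 hx) this.1
  · have h1 := (abs_le.1 (h (univ.filter fun x => 0 < L x))).2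
    refine le_trans ?_ h1
    rw [sum_filter]
    refine sum_le_sum fun x _ => ?_
    have := hg x
    split_ifs with hx
    · nlinarith [this.2]
    · exact mul_nonpos_of_nonpos_of_nonneg (not_lt.1 hx) this.1

theorem cutLe_of_finset {M : α → α → ℝ} {c : ℝ}
    (h : ∀ S T : Finset α, |∑ x ∈ S, ∑ y ∈ T, M x y| ≤ c * (Fintype.card α : ℝ) ^ 2) :
    CutLe M c := by
  intro g k hg hk
  have h1 : ∀ S : Finset α, |∑ x ∈ S, ∑ y, M x y * k y| ≤ c * (Fintype.card α : ℝ) ^ 2 := by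
    intro S
    rw [sum_comm]
    simp only [← sum_mul]
    refine abs_sum_mul_le_of_finset (fun T => ?_) hk
    rw [sum_comm]
    exact h S T
  have h2 := abs_sum_mul_le_of_finset h1 hg
  refine le_of_eq_of_le ?_ h2
  congr 1
  refine sum_congr rfl fun x _ => ?_
  rw [sum_mul]
  exact sum_congr rfl fun y _ => by ring

/-- The weighted number of homomorphic images of the four-cycle. -/
def fourCycleSum (M : α → α → ℝ) : ℝ :=
  ∑ x, ∑ x', ∑ y, ∑ y', M x y * M x y' * (M x' y * M x' y')

theorem sum_mul_pow_four_le (M : α → α → ℝ) {g h : α → ℝ} (hg : ∀ x, |g x| ≤ 1)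
    (hh : ∀ x, |h x| ≤ 1) :
    (∑ x, ∑ y, M x y * g x * h y) ^ 4 ≤ (Fintype.card α : ℝ) ^ 4 * fourCycleSum M := by
  set V := (Fintype.card α : ℝ) with hV
  have hV0 : 0 ≤ V := by positivity
  have sq1 : ∀ t : ℝ, |t| ≤ 1 → t ^ 2 ≤ 1 := fun t ht => by
    rw [← sq_abs]; exact pow_le_one₀ (abs_nonneg _) ht
  have hgs : ∑ x, g x ^ 2 ≤ V := by
    have : ∑ x, g x ^ 2 ≤ ∑ _x : α, (1 : ℝ) := sum_le_sum fun x _ => sq1 _ (hg x)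
    simpa [hV] using this
  have e1 : ∑ x, ∑ y, M x y * g x * h y = ∑ x, g x * ∑ y, M x y * h y := by
    refine sum_congr rfl fun x _ => ?_
    rw [mul_sum]; exact sum_congr rfl fun y _ => by ring
  have s1 : (∑ x, ∑ y, M x y * g x * h y) ^ 2 ≤ V * ∑ x, (∑ y, M x y * h y) ^ 2 := by
    rw [e1]
    exact (sum_mul_sq_le_sq_mul_sq _ _ _).trans
      (mul_le_mul_of_nonneg_right hgs (sum_nonneg fun _ _ => sq_nonneg _))
  have e2 : ∑ x, (∑ y, M x y * h y) ^ 2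
      = ∑ q : α × α, (h q.1 * h q.2) * ∑ x, M x q.1 * M x q.2 := by
    have hx : ∀ x, (∑ y, M x y * h y) ^ 2
        = ∑ y, ∑ y', (h y * h y') * (M x y * M x y') := fun x => by
      rw [sq, sum_mul_sum]
      exact sum_congr rfl fun y _ => sum_congr rfl fun y' _ => by ring
    rw [Fintype.sum_prod_type, sum_congr rfl fun x _ => hx x, sum_comm]
    refine sum_congr rfl fun y _ => ?_
    rw [sum_comm]
    exact sum_congr rfl fun y' _ => by rw [mul_sum]
  have hhs : ∑ q : α × α, (h q.1 * h q.2) ^ 2 ≤ V ^ 2 := by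
    have : ∑ q : α × α, (h q.1 * h q.2) ^ 2 ≤ ∑ _q : α × α, (1 : ℝ) := by
      refine sum_le_sum fun q _ => sq1 _ ?_
      rw [abs_mul]
      exact mul_le_one₀ (hh _) (abs_nonneg _) (hh _)
    simpa [hV, sq] using this
  have e3 : ∑ q : α × α, (∑ x, M x q.1 * M x q.2) ^ 2 = fourCycleSum M := by
    rw [Fintype.sum_prod_type, fourCycleSum]
    simp only [sq, sum_mul_sum]
    calc ∑ y, ∑ y', ∑ x, ∑ x', M x y * M x y' * (M x' y * M x' y')
        = ∑ y, ∑ x, ∑ y', ∑ x', M x y * M x y' * (M x' y * M x' y') :=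
          sum_congr rfl fun y _ => sum_comm
      _ = ∑ x, ∑ y, ∑ x', ∑ y', M x y * M x y' * (M x' y * M x' y') := by
          rw [sum_comm]
          exact sum_congr rfl fun x _ => sum_congr rfl fun y _ => sum_comm
      _ = _ := sum_congr rfl fun x _ => sum_comm
  have s2 : (∑ x, (∑ y, M x y * h y) ^ 2) ^ 2 ≤ V ^ 2 * fourCycleSum M := by
    rw [e2, ← e3]
    exact (sum_mul_sq_le_sq_mul_sq _ _ _).trans
      (mul_le_mul_of_nonneg_right hhs (sum_nonneg fun _ _ => sq_nonneg _))
  calc (∑ x, ∑ y, M x y * g x * h y) ^ 4 = ((∑ x, ∑ y, M x y * g x * h y) ^ 2) ^ 2 := by ring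
    _ ≤ (V * ∑ x, (∑ y, M x y * h y) ^ 2) ^ 2 := pow_le_pow_left₀ (sq_nonneg _) s1 2
    _ = V ^ 2 * (∑ x, (∑ y, M x y * h y) ^ 2) ^ 2 := by ring
    _ ≤ V ^ 2 * (V ^ 2 * fourCycleSum M) := mul_le_mul_of_nonneg_left s2 (sq_nonneg _)
    _ = V ^ 4 * fourCycleSum M := by ring

theorem cutLe_of_fourCycleSum_le {M : α → α → ℝ} {c : ℝ} (hc : 0 ≤ c)
    (h : fourCycleSum M ≤ c ^ 4 * (Fintype.card α : ℝ) ^ 4) : CutLe M c := by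
  intro g k hg hk
  have habs : ∀ t : ℝ, t ∈ Set.Icc (0 : ℝ) 1 → |t| ≤ 1 := fun t ht => by
    rw [abs_of_nonneg ht.1]; exact ht.2
  have h1 := sum_mul_pow_four_le M (fun x => habs _ (hg x)) fun x => habs _ (hk x)
  have hV : (0 : ℝ) ≤ (Fintype.card α : ℝ) ^ 4 := by positivity
  refine le_of_pow_le_pow_left₀ (n := 4) (by norm_num) (by positivity) ?_
  rw [pow_abs, abs_of_nonneg (by positivity)]
  refine h1.trans ((mul_le_mul_of_nonneg_left h hV).trans (le_of_eq ?_))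
  ring

theorem CutLe.mono {M : α → α → ℝ} {c c' : ℝ} (h : CutLe M c) (hc : c ≤ c') : CutLe M c' :=
  fun g k hg hk => (h g k hg hk).trans (mul_le_mul_of_nonneg_right hc (by positivity))

end CutNorm

section GraphCounts

open Classical in
/-- The adjacency indicator of a graph. -/
noncomputable def adjKernel {α : Type*} (G : SimpleGraph α) (x y : α) : ℝ :=
  if G.Adj x y then 1 else 0

theorem adjKernel_mem_Icc {α : Type*} (G : SimpleGraph α) (x y : α) :
    adjKernel G x y ∈ Set.Icc (0 : ℝ) 1 := by
  unfold adjKernel; split_ifs <;> simp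

theorem adjKernel_comm {α : Type*} (G : SimpleGraph α) (x y : α) :
    adjKernel G x y = adjKernel G y x := by
  classical
  unfold adjKernel
  exact if_congr (G.adj_comm x y) rfl rfl

variable {m : ℕ}

open Classical in
theorem edgeProd_adjKernel {α : Type*} (F : SimpleGraph (Fin m)) (G : SimpleGraph α)
    (x : Fin m → α) :
    edgeProd F (adjKernel G) x = if ∀ i j, F.Adj i j → G.Adj (x i) (x j) then 1 else 0 := by
  unfold edgeProd adjKernel
  split_ifs with h
  · exact prod_eq_one fun e he => if_pos (h _ _ (mem_edgePairs.1 he).2)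
  · push Not at h
    obtain ⟨i, j, hij, hG⟩ := h
    rcases lt_or_gt_of_ne hij.ne with hl | hl
    · exact prod_eq_zero (mem_edgePairs.2 ⟨hl, hij⟩ : ((i, j) : Fin m × Fin m) ∈ _) (if_neg hG)
    · exact prod_eq_zero (mem_edgePairs.2 ⟨hl, hij.symm⟩ : ((j, i) : Fin m × Fin m) ∈ _)
        (if_neg fun h => hG h.symm)

variable {β : Type} [Fintype β]

open Classical in
theorem labCount_eq_sum (F : SimpleGraph (Fin m)) (G : SimpleGraph β) (U : Fin m → Finset β)
    (hU : Pairwise fun i j => Disjoint (U i) (U j)) :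
    (labCount F G U : ℝ)
      = ∑ x : Fin m → β, edgeProd F (adjKernel G) x * ∏ i, if x i ∈ U i then 1 else 0 := by
  unfold labCount
  rw [Nat.card_eq_fintype_card, Fintype.card_subtype, card_filter]
  push_cast
  refine sum_congr rfl fun x _ => ?_
  have h1 : (∏ i, if x i ∈ U i then (1 : ℝ) else 0) = if ∀ i, x i ∈ U i then 1 else 0 := by
    rw [prod_ite_zero]; simp
  have h2 : (Function.Injective x ∧ (∀ i j, F.Adj i j → G.Adj (x i) (x j)) ∧ ∀ i, x i ∈ U i)
      ↔ (∀ i j, F.Adj i j → G.Adj (x i) (x j)) ∧ ∀ i, x i ∈ U i := by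
    refine ⟨fun h => h.2, fun h => ⟨fun i j hij => ?_, h⟩⟩
    by_contra hne
    exact disjoint_left.1 (hU hne) (h.2 i) (hij ▸ h.2 j)
  rw [edgeProd_adjKernel, h1, if_congr h2 rfl rfl, ite_and]
  split_ifs <;> simp

open Classical in
theorem symCount_eq_sum (F : SimpleGraph (Fin m)) (G : SimpleGraph β) (U : Fin m → Finset β)
    (hU : Pairwise fun i j => Disjoint (U i) (U j)) :
    symCount F G U
      = ∑ x : Fin m → β, symEdgeProd F (adjKernel G) x * ∏ i, if x i ∈ U i then 1 else 0 := by
  unfold symCount symEdgeProd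
  simp only [mul_assoc, ← mul_sum, sum_mul]
  rw [sum_comm]
  congr 1
  refine sum_congr rfl fun σ _ => ?_
  rw [labCount_eq_sum F G _ fun i j hij => hU (σ.injective.ne hij)]
  refine Fintype.sum_equiv (Equiv.arrowCongr σ (Equiv.refl β)) _ _ fun x => ?_
  have h1 : (fun i => (Equiv.arrowCongr σ (Equiv.refl β) x) (σ i)) = x := by
    funext i; simp
  rw [h1]
  congr 1
  rw [← Equiv.prod_comp σ
    fun i => if (Equiv.arrowCongr σ (Equiv.refl β) x) i ∈ U i then (1 : ℝ) else 0]
  refine prod_congr rfl fun i _ => ?_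
  have : (Equiv.arrowCongr σ (Equiv.refl β) x) (σ i) = x i := congrFun h1 i
  rw [this]

theorem card_not_injective_le (m : ℕ) (β : Type) [Fintype β] [DecidableEq β]
    [DecidablePred fun x : Fin m → β => ¬ Function.Injective x] :
    (((univ.filter fun x : Fin m → β => ¬ Function.Injective x).card : ℕ) : ℝ) * Fintype.card β
      ≤ (m : ℝ) ^ 2 * (Fintype.card β : ℝ) ^ m := by
  have hsub : (univ.filter fun x : Fin m → β => ¬ Function.Injective x)
      ⊆ (univ.filter fun e : Fin m × Fin m => e.1 ≠ e.2).biUnion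
        fun e => univ.filter fun x : Fin m → β => x e.1 = x e.2 := by
    intro x hx
    have := (mem_filter.1 hx).2
    simp only [Function.Injective, not_forall] at this
    obtain ⟨i, j, hij, hne⟩ := this
    exact mem_biUnion.2 ⟨(i, j), by simpa using hne, by simpa using hij⟩
  have hone : ∀ e : Fin m × Fin m, e.1 ≠ e.2 →
      (((univ.filter fun x : Fin m → β => x e.1 = x e.2).card : ℕ) : ℝ) * Fintype.card β
        = (Fintype.card β : ℝ) ^ m := by
    intro e he
    have h1 := sum_update_sum (α := β) e.1 fun x : Fin m → β => if x e.1 = x e.2 then (1 : ℝ) else 0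
    have h2 : ∀ x : Fin m → β, ∑ a : β, (if Function.update x e.1 a e.1 = Function.update x e.1 a e.2
        then (1 : ℝ) else 0) = 1 := by
      intro x
      simp [Function.update_of_ne he.symm]
    rw [sum_congr rfl fun x _ => h2 x] at h1
    rw [card_filter]
    push_cast
    rw [mul_comm, ← h1]
    simp
  calc _ ≤ (∑ e ∈ univ.filter fun e : Fin m × Fin m => e.1 ≠ e.2,
        (((univ.filter fun x : Fin m → β => x e.1 = x e.2).card : ℕ) : ℝ)) * Fintype.card β := by
        refine mul_le_mul_of_nonneg_right ?_ (by positivity)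
        exact_mod_cast (card_le_card hsub).trans card_biUnion_le
    _ = ∑ e ∈ univ.filter fun e : Fin m × Fin m => e.1 ≠ e.2, (Fintype.card β : ℝ) ^ m := by
        rw [sum_mul]
        exact sum_congr rfl fun e he => hone e (mem_filter.1 he).2
    _ ≤ _ := by
        rw [sum_const, nsmul_eq_mul]
        refine mul_le_mul_of_nonneg_right ?_ (by positivity)
        have := card_filter_le (univ : Finset (Fin m × Fin m)) fun e => e.1 ≠ e.2
        simp only [card_univ, Fintype.card_prod, Fintype.card_fin] at this
        rw [sq]; exact_mod_cast this

theorem abs_totalCount_sub_sum_le (F : SimpleGraph (Fin m)) (G : SimpleGraph β) :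
    |(totalCount F G : ℝ) - ∑ x : Fin m → β, edgeProd F (adjKernel G) x| * Fintype.card β
      ≤ (m : ℝ) ^ 2 * (Fintype.card β : ℝ) ^ m := by
  classical
  refine le_trans (mul_le_mul_of_nonneg_right ?_ (by positivity)) (card_not_injective_le m β)
  unfold totalCount
  rw [Nat.card_eq_fintype_card, Fintype.card_subtype, card_filter, card_filter]
  push_cast
  rw [← sum_sub_distrib]
  refine (abs_sum_le_sum_abs _ _).trans (sum_le_sum fun x _ => ?_)
  rw [edgeProd_adjKernel]
  by_cases h1 : Function.Injective x
  · simp [h1]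
  · rw [if_neg fun h => h1 h.1, if_pos h1]
    split_ifs <;> simp

end GraphCounts

section SymmetrizedCounting

variable {m : ℕ} {α : Type*} [Fintype α]

theorem sum_symEdgeProd_mul_prod (F : SimpleGraph (Fin m)) (w : α → α → ℝ) (h : Fin m → α → ℝ) :
    ∑ x : Fin m → α, symEdgeProd F w x * ∏ i, h i (x i)
      = (m.factorial : ℝ)⁻¹ * ∑ σ : Equiv.Perm (Fin m),
          ∑ x : Fin m → α, edgeProd F w x * ∏ i, h (σ i) (x i) := by
  unfold symEdgeProd
  simp only [mul_assoc, ← mul_sum, sum_mul]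
  rw [sum_comm]
  congr 1
  refine sum_congr rfl fun σ _ => ?_
  refine (Fintype.sum_equiv (Equiv.arrowCongr σ (Equiv.refl α)) _ _ fun x => ?_).symm
  have h1 : (fun i => (Equiv.arrowCongr σ (Equiv.refl α) x) (σ i)) = x := by
    funext i; simp
  rw [h1]
  congr 1
  rw [← Equiv.prod_comp σ fun i => h i ((Equiv.arrowCongr σ (Equiv.refl α) x) i)]
  refine prod_congr rfl fun i _ => ?_
  have : (Equiv.arrowCongr σ (Equiv.refl α) x) (σ i) = x i := congrFun h1 i
  rw [this]

theorem abs_sum_symEdgeProd_sub_le (F : SimpleGraph (Fin m)) {w w' : α → α → ℝ}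
    (hw : ∀ a b, w a b ∈ Set.Icc (0 : ℝ) 1) (hw' : ∀ a b, w' a b ∈ Set.Icc (0 : ℝ) 1) {c : ℝ}
    (hc : CutLe (fun a b => w a b - w' a b) c) (h : Fin m → α → ℝ)
    (hh : ∀ i a, h i a ∈ Set.Icc (0 : ℝ) 1) :
    |∑ x : Fin m → α, symEdgeProd F w x * ∏ i, h i (x i)
        - ∑ x : Fin m → α, symEdgeProd F w' x * ∏ i, h i (x i)|
      ≤ numEdges F * c * (Fintype.card α : ℝ) ^ m := by
  have hf : (0 : ℝ) < (m.factorial : ℝ) := by positivity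
  have hcard : ((univ : Finset (Equiv.Perm (Fin m))).card : ℝ) = m.factorial := by
    rw [card_univ, Fintype.card_perm, Fintype.card_fin]
  rw [sum_symEdgeProd_mul_prod, sum_symEdgeProd_mul_prod, ← mul_sub, abs_mul,
    abs_of_pos (inv_pos.2 hf), inv_mul_le_iff₀ hf, ← sum_sub_distrib, ← hcard, ← nsmul_eq_mul]
  refine (abs_sum_le_sum_abs _ _).trans (sum_le_card_nsmul _ _ _ fun σ _ => ?_)
  exact abs_sum_edgeProd_sub_le F hw hw' hc (fun i => h (σ i)) fun i a => hh _ _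

omit [Fintype α] in
theorem symEdgeProd_const (F : SimpleGraph (Fin m)) (p : ℝ) (x : Fin m → α) :
    symEdgeProd F (fun _ _ => p) x = p ^ numEdges F :=
  symEdgeProd_of_edgeProd_const fun _ => edgeProd_const F p _

theorem sum_const_mul_prod (K : ℝ) (h : Fin m → α → ℝ) :
    ∑ x : Fin m → α, K * ∏ i, h i (x i) = K * ∏ i, ∑ a, h i a := by
  classical
  rw [← mul_sum, prod_univ_sum]
  simp

end SymmetrizedCounting

section QuasirandomCut

variable {p : ℝ} {V : ℕ → ℕ} {G : ∀ n, SimpleGraph (Fin (V n))}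

theorem isQuasirandom_of_cutLe (hp : p ∈ Set.Icc (0 : ℝ) 1) (hV : Tendsto V atTop atTop)
    (h : ∀ c > 0, ∀ᶠ n in atTop, CutLe (fun x y => adjKernel (G n) x y - p) c) :
    IsQuasirandom p V G := by
  intro m F
  rw [isLittleO_iff]
  intro ε hε
  have hVr : Tendsto (fun n => (V n : ℝ)) atTop atTop := tendsto_natCast_atTop_atTop.comp hV
  have hc : 0 < ε / (2 * (numEdges F + 1)) := by positivity
  filter_upwards [h _ hc, hVr.eventually_ge_atTop (2 * (m : ℝ) ^ 2 / ε),
    hVr.eventually_gt_atTop 0] with n hcut hn hpos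
  have hVm : (0 : ℝ) < (V n : ℝ) ^ m := by positivity
  have h1 := abs_sum_edgeProd_sub_le F (adjKernel_mem_Icc (G n)) (fun _ _ => hp) hcut
    (fun _ _ => 1) (fun _ _ => by simp)
  simp only [prod_const_one, mul_one, edgeProd_const, sum_const, card_univ, Fintype.card_fin,
    Fintype.card_pi, prod_const, nsmul_eq_mul, Nat.cast_pow] at h1
  have h2 := abs_totalCount_sub_sum_le F (G n)
  rw [Fintype.card_fin] at h2
  have h3 : |(totalCount F (G n) : ℝ) - ∑ x : Fin m → Fin (V n), edgeProd F (adjKernel (G n)) x|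
      ≤ ε / 2 * (V n : ℝ) ^ m := by
    have h4 : (m : ℝ) ^ 2 ≤ ε / 2 * V n := by
      rw [div_le_iff₀ hε] at hn
      linarith
    refine le_of_mul_le_mul_right (h2.trans ?_) hpos
    nlinarith
  have h5 : (numEdges F : ℝ) * (ε / (2 * (numEdges F + 1))) ≤ ε / 2 := by
    rw [mul_div_assoc', div_le_div_iff₀ (by positivity) (by norm_num)]
    nlinarith
  rw [Real.norm_eq_abs, Real.norm_eq_abs, abs_of_pos hVm]
  have h6 := abs_sub_le (totalCount F (G n) : ℝ)
    (∑ x : Fin m → Fin (V n), edgeProd F (adjKernel (G n)) x) (p ^ numEdges F * (V n : ℝ) ^ m)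
  rw [mul_comm (p ^ numEdges F)] at *
  nlinarith [mul_le_mul_of_nonneg_right h5 hVm.le]

theorem tendsto_sum_edgeProd_of_isQuasirandom (hV : Tendsto V atTop atTop)
    (h : IsQuasirandom p V G) {m : ℕ} (F : SimpleGraph (Fin m)) :
    Tendsto (fun n => (∑ x : Fin m → Fin (V n), edgeProd F (adjKernel (G n)) x) / (V n : ℝ) ^ m)
      atTop (nhds (p ^ numEdges F)) := by
  have hVr : Tendsto (fun n => (V n : ℝ)) atTop atTop := tendsto_natCast_atTop_atTop.comp hV
  have h1 := (h m F).tendsto_div_nhds_zero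
  have h2 : Tendsto (fun n => (m : ℝ) ^ 2 / (V n : ℝ)) atTop (nhds 0) := hVr.const_div_atTop _
  rw [tendsto_iff_norm_sub_tendsto_zero]
  have h12 : Tendsto (fun n => ‖((totalCount F (G n) : ℝ) - p ^ numEdges F * (V n : ℝ) ^ m)
      / (V n : ℝ) ^ m‖ + (m : ℝ) ^ 2 / (V n : ℝ)) atTop (nhds 0) := by
    simpa only [norm_zero, add_zero] using h1.norm.add h2
  refine squeeze_zero' (Eventually.of_forall fun _ => norm_nonneg _) ?_ h12
  filter_upwards [hVr.eventually_gt_atTop 0] with n hpos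
  have hVm : (0 : ℝ) < (V n : ℝ) ^ m := by positivity
  have h3 := abs_totalCount_sub_sum_le F (G n)
  rw [Fintype.card_fin] at h3
  have e1 : (∑ x : Fin m → Fin (V n), edgeProd F (adjKernel (G n)) x) / (V n : ℝ) ^ m
      - p ^ numEdges F
      = ((totalCount F (G n) : ℝ) - p ^ numEdges F * (V n : ℝ) ^ m) / (V n : ℝ) ^ m
        - ((totalCount F (G n) : ℝ) - ∑ x : Fin m → Fin (V n), edgeProd F (adjKernel (G n)) x)
          / (V n : ℝ) ^ m := by
    field_simp
    ring
  rw [e1]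
  refine (norm_sub_le _ _).trans (add_le_add le_rfl ?_)
  rw [Real.norm_eq_abs, abs_div, abs_of_pos hVm, div_le_div_iff₀ hVm hpos]
  exact h3

theorem exists_edgePairs_eq {m : ℕ} (S : Finset (Fin m × Fin m)) (hS : ∀ e ∈ S, e.1 < e.2) :
    ∃ F : SimpleGraph (Fin m), edgePairs F = S := by
  refine ⟨SimpleGraph.fromRel fun i j => (i, j) ∈ S, ?_⟩
  ext ⟨i, j⟩
  rw [mem_edgePairs, SimpleGraph.fromRel_adj]
  constructor
  · rintro ⟨h1, h2, h3 | h3⟩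
    · exact h3
    · exact absurd (h1.trans (hS _ h3)) (lt_irrefl _)
  · intro h
    exact ⟨hS _ h, (hS _ h).ne, Or.inl h⟩

/-- The edges of the four-cycle. -/
def fourCyclePairs : Finset (Fin 4 × Fin 4) := {(0, 2), (0, 3), (1, 2), (1, 3)}

theorem fourCycleSum_eq {α : Type*} [Fintype α] (M : α → α → ℝ) :
    fourCycleSum M = ∑ x : Fin 4 → α, ∏ e ∈ fourCyclePairs, M (x e.1) (x e.2) := by
  have h1 : ∀ x : Fin 4 → α, ∏ e ∈ fourCyclePairs, M (x e.1) (x e.2)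
      = M (x 0) (x 2) * M (x 0) (x 3) * (M (x 1) (x 2) * M (x 1) (x 3)) := by
    intro x
    rw [fourCyclePairs, prod_insert (by decide), prod_insert (by decide), prod_insert (by decide),
      prod_singleton]
    ring
  rw [sum_congr rfl fun x _ => h1 x, fourCycleSum]
  have h2 : ∑ x : Fin 4 → α, M (x 0) (x 2) * M (x 0) (x 3) * (M (x 1) (x 2) * M (x 1) (x 3))
      = ∑ q : α × α × α × α, M q.1 q.2.2.1 * M q.1 q.2.2.2
        * (M q.2.1 q.2.2.1 * M q.2.1 q.2.2.2) := by
    refine Fintype.sum_equiv ⟨fun x => (x 0, x 1, x 2, x 3), fun q => ![q.1, q.2.1, q.2.2.1, q.2.2.2],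
      fun x => ?_, fun q => ?_⟩ _ _ fun x => ?_
    · funext i; fin_cases i <;> rfl
    · rfl
    · rfl
  rw [h2]
  simp only [Fintype.sum_prod_type]

theorem tendsto_fourCycleSum_of_isQuasirandom (hV : Tendsto V atTop atTop)
    (h : IsQuasirandom p V G) :
    Tendsto (fun n => fourCycleSum (fun x y => adjKernel (G n) x y - p) / (V n : ℝ) ^ 4)
      atTop (nhds 0) := by
  classical
  have hlt : ∀ e ∈ fourCyclePairs, e.1 < e.2 := by decide
  have hsub : ∀ S ∈ fourCyclePairs.powerset, ∃ F : SimpleGraph (Fin 4), edgePairs F = S :=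
    fun S hS => exists_edgePairs_eq S fun e he => hlt e (mem_powerset.1 hS he)
  have h1 : ∀ S ∈ fourCyclePairs.powerset, Tendsto (fun n => (-p) ^ (fourCyclePairs \ S).card *
      ((∑ x : Fin 4 → Fin (V n), ∏ e ∈ S, adjKernel (G n) (x e.1) (x e.2)) / (V n : ℝ) ^ 4))
      atTop (nhds ((-p) ^ (fourCyclePairs \ S).card * p ^ S.card)) := by
    intro S hS
    obtain ⟨F, hF⟩ := hsub S hS
    have := tendsto_sum_edgeProd_of_isQuasirandom hV h F
    rw [numEdges_eq_card, hF] at this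
    simp only [edgeProd, hF] at this
    exact this.const_mul _
  have h2 := tendsto_finsetSum _ h1
  have h3 : ∑ S ∈ fourCyclePairs.powerset, (-p) ^ (fourCyclePairs \ S).card * p ^ S.card = 0 := by
    have := prod_add (fun _ : Fin 4 × Fin 4 => p) (fun _ => -p) fourCyclePairs
    simp only [add_neg_cancel, prod_const] at this
    rw [show fourCyclePairs.card = 4 by decide] at this
    rw [zero_pow (by norm_num)] at this
    rw [this]
    exact sum_congr rfl fun S _ => mul_comm _ _
  rw [h3] at h2
  refine h2.congr fun n => ?_
  rw [fourCycleSum_eq, ← sum_congr rfl fun S _ => mul_div_assoc _ _ _, ← sum_div]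
  congr 1
  simp only [sub_eq_add_neg, prod_add, prod_const]
  rw [sum_comm]
  refine sum_congr rfl fun S _ => ?_
  rw [mul_sum]
  exact sum_congr rfl fun x _ => mul_comm _ _

theorem exists_cutLe_of_isQuasirandom (hV : Tendsto V atTop atTop) (h : IsQuasirandom p V G) :
    ∃ δ : ℕ → ℝ, Tendsto δ atTop (nhds 0) ∧
      ∀ n, CutLe (fun x y => adjKernel (G n) x y - p) (δ n) := by
  have h1 := tendsto_fourCycleSum_of_isQuasirandom hV h
  refine ⟨fun n => √ √(fourCycleSum (fun x y => adjKernel (G n) x y - p) / (V n : ℝ) ^ 4), ?_, ?_⟩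
  · simpa using h1.sqrt.sqrt
  · intro n
    rcases Nat.eq_zero_or_pos (V n) with h0 | hpos
    · intro g k _ _
      have : IsEmpty (Fin (V n)) := by rw [h0]; infer_instance
      simp [h0]
    · refine cutLe_of_fourCycleSum_le (by positivity) ?_
      have hV4 : (0 : ℝ) < (V n : ℝ) ^ 4 := by positivity
      rw [Fintype.card_fin, ← div_le_iff₀ hV4]
      set t := fourCycleSum (fun x y => adjKernel (G n) x y - p) / (V n : ℝ) ^ 4
      have h4 : √ √ t ^ 4 = √ t ^ 2 := by
        rw [show (4 : ℕ) = 2 * 2 by norm_num, pow_mul, Real.sq_sqrt (Real.sqrt_nonneg _)]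
      rw [h4]
      rcases le_total 0 t with ht | ht
      · rw [Real.sq_sqrt ht]
      · exact ht.trans (sq_nonneg _)

theorem satisfiesPt_of_cutLe {m : ℕ} (F : SimpleGraph (Fin m)) (α : Fin m → ℝ)
    {d : ∀ n, Fin (V n) → Fin (V n) → ℝ} (hd : ∀ n x y, d n x y ∈ Set.Icc (0 : ℝ) 1)
    {δ : ℕ → ℝ} (hδ : Tendsto δ atTop (nhds 0))
    (h : ∀ n, CutLe (fun x y => adjKernel (G n) x y - d n x y) (δ n))
    (hsum : ∀ n, ∀ U : Fin m → Finset (Fin (V n)), (Pairwise fun i j => Disjoint (U i) (U j)) →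
      (∀ i, (U i).card = ⌊α i * (V n : ℝ)⌋₊) →
      ∑ x : Fin m → Fin (V n), symEdgeProd F (d n) x * ∏ i, (if x i ∈ U i then (1 : ℝ) else 0)
        = p ^ numEdges F * ∏ i, ((U i).card : ℝ)) :
    SatisfiesPt F p α V G := by
  classical
  refine ⟨fun n => numEdges F * δ n, by simpa using hδ.const_mul (numEdges F : ℝ),
    fun n U hU hcard => ?_⟩
  rw [symCount_eq_sum F (G n) U hU, ← hsum n U hU hcard]
  have := abs_sum_symEdgeProd_sub_le F (adjKernel_mem_Icc (G n)) (hd n) (h n)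
    (fun i a => if a ∈ U i then 1 else 0) (fun i a => by split_ifs <;> simp)
  rw [Fintype.card_fin] at this
  convert this

theorem satisfiesPt_of_isQuasirandom (hp : p ∈ Set.Icc (0 : ℝ) 1) (hV : Tendsto V atTop atTop)
    (h : IsQuasirandom p V G) {m : ℕ} (F : SimpleGraph (Fin m)) (α : Fin m → ℝ) :
    SatisfiesPt F p α V G := by
  obtain ⟨δ, hδ, hcut⟩ := exists_cutLe_of_isQuasirandom hV h
  refine satisfiesPt_of_cutLe F α (d := fun _ _ _ => p) (fun _ _ _ => hp) hδ hcut
    fun n U _ _ => ?_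
  simp only [symEdgeProd_const]
  rw [sum_const_mul_prod (p ^ numEdges F) fun i a => if a ∈ U i then (1 : ℝ) else 0]
  simp

end QuasirandomCut

section RandomGraph

variable {α : Type*} [Fintype α] [DecidableEq α]

/-- The probability of an outcome of independent coin tosses with success probabilities `D`. -/
noncomputable def coinWeight {ι : Type*} [Fintype ι] (D : ι → ℝ) (ω : ι → Bool) : ℝ :=
  ∏ e, if ω e then D e else 1 - D e

theorem sum_coinWeight {ι : Type*} [Fintype ι] [DecidableEq ι] (D : ι → ℝ) :
    ∑ ω : ι → Bool, coinWeight D ω = 1 := by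
  unfold coinWeight
  rw [← Fintype.prod_sum fun e (b : Bool) => if b then D e else 1 - D e]
  simp

theorem sum_coinWeight_mul_eq_zero {ι : Type*} [Fintype ι] [DecidableEq ι] (D : ι → ℝ) (e₀ : ι)
    (H : (ι → Bool) → ℝ) (hH : ∀ ω b, H (Function.update ω e₀ b) = H ω) :
    ∑ ω : ι → Bool, coinWeight D ω * (((if ω e₀ then 1 else 0) - D e₀) * H ω) = 0 := by
  have h1 := sum_update_sum (α := Bool) e₀
    fun ω : ι → Bool => coinWeight D ω * (((if ω e₀ then 1 else 0) - D e₀) * H ω)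
  have h2 : ∀ ω : ι → Bool, ∑ b : Bool, coinWeight D (Function.update ω e₀ b) *
      (((if Function.update ω e₀ b e₀ then 1 else 0) - D e₀) * H (Function.update ω e₀ b)) = 0 := by
    intro ω
    have h3 : ∀ b, coinWeight D (Function.update ω e₀ b)
        = (if b then D e₀ else 1 - D e₀) * ∏ e ∈ univ.erase e₀, if ω e then D e else 1 - D e := by
      intro b
      unfold coinWeight
      rw [← mul_prod_erase univ _ (mem_univ e₀), Function.update_self]
      congr 1
      refine prod_congr rfl fun e he => ?_
      rw [Function.update_of_ne (ne_of_mem_erase he)]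
    simp only [h3, hH, Function.update_self, Fintype.sum_bool, if_true, Bool.false_eq_true, if_false]
    ring
  rw [sum_congr rfl fun ω _ => h2 ω, sum_const_zero] at h1
  simpa using h1.symm

/-- The graph whose edges are the non-loops `e` with `ω e`. -/
def coinGraph (ω : Sym2 α → Bool) : SimpleGraph α :=
  SimpleGraph.fromEdgeSet {e | ω e = true}

omit [Fintype α] [DecidableEq α] in
theorem adjKernel_coinGraph {ω : Sym2 α → Bool} {x y : α} (h : x ≠ y) :
    adjKernel (coinGraph ω) x y = if ω s(x, y) then 1 else 0 := by
  unfold adjKernel coinGraph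
  simp [h]

omit [Fintype α] in
theorem adjKernel_coinGraph_update {ω : Sym2 α → Bool} {e : Sym2 α} {b : Bool} {x y : α}
    (h : s(x, y) ≠ e) :
    adjKernel (coinGraph (Function.update ω e b)) x y = adjKernel (coinGraph ω) x y := by
  rcases eq_or_ne x y with rfl | hxy
  · simp [adjKernel]
  · rw [adjKernel_coinGraph hxy, adjKernel_coinGraph hxy, Function.update_of_ne h]

theorem exists_fourCycleSum_sub_le {d : α → α → ℝ} (hsym : ∀ x y, d x y = d y x)
    (hd : ∀ x y, d x y ∈ Set.Icc (0 : ℝ) 1) :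
    ∃ G : SimpleGraph α,
      fourCycleSum (fun x y => adjKernel G x y - d x y) ≤ 4 * (Fintype.card α : ℝ) ^ 3 := by
  set D : Sym2 α → ℝ := Sym2.lift ⟨d, hsym⟩ with hD
  have hDs : ∀ x y, D s(x, y) = d x y := fun x y => rfl
  have hDI : ∀ e, D e ∈ Set.Icc (0 : ℝ) 1 := fun e => by
    induction e using Sym2.ind with
    | _ x y => exact hd x y
  have hP : ∀ ω, 0 ≤ coinWeight D ω := fun ω => prod_nonneg fun e _ => by
    have := hDI e
    split_ifs
    · exact this.1
    · linarith [this.2]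
  set M : (Sym2 α → Bool) → α → α → ℝ := fun ω x y => adjKernel (coinGraph ω) x y - d x y with hM
  have hM1 : ∀ ω x y, |M ω x y| ≤ 1 := fun ω x y => by
    have h1 := adjKernel_mem_Icc (coinGraph ω) x y
    have h2 := hd x y
    rw [abs_le]
    constructor <;> simp only [hM] <;> linarith [h1.1, h1.2, h2.1, h2.2]
  have quad : ∀ x x' y y' : α,
      ∑ ω, coinWeight D ω * (M ω x y * M ω x y' * (M ω x' y * M ω x' y'))
        ≤ (if x = y then 1 else 0) + (if y = y' then 1 else 0) + (if x = x' then 1 else 0)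
          + (if x = y' then 1 else 0) := by
    intro x x' y y'
    by_cases hex : x = y ∨ y = y' ∨ x = x' ∨ x = y'
    · have h1 : ∑ ω, coinWeight D ω * (M ω x y * M ω x y' * (M ω x' y * M ω x' y')) ≤ 1 := by
        rw [← sum_coinWeight D]
        refine sum_le_sum fun ω _ => mul_le_of_le_one_right (hP ω) ?_
        refine (le_abs_self _).trans ?_
        rw [abs_mul, abs_mul, abs_mul]
        exact mul_le_one₀ (mul_le_one₀ (hM1 _ _ _) (abs_nonneg _) (hM1 _ _ _)) (by positivity)
          (mul_le_one₀ (hM1 _ _ _) (abs_nonneg _) (hM1 _ _ _))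
      refine h1.trans ?_
      have h0 : ∀ P : Prop, [Decidable P] → (0 : ℝ) ≤ if P then 1 else 0 := fun P _ => by
        split_ifs <;> norm_num
      rcases hex with h | h | h | h
      · rw [if_pos h]; linarith [h0 (y = y'), h0 (x = x'), h0 (x = y')]
      · rw [if_pos h]; linarith [h0 (x = y), h0 (x = x'), h0 (x = y')]
      · rw [if_pos h]; linarith [h0 (x = y), h0 (y = y'), h0 (x = y')]
      · rw [if_pos h]; linarith [h0 (x = y), h0 (y = y'), h0 (x = x')]
    · push Not at hex
      obtain ⟨h1, h2, h3, h4⟩ := hex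
      rw [if_neg h1, if_neg h2, if_neg h3, if_neg h4]
      have e1 : s(x, y') ≠ s(x, y) := by
        simp only [ne_eq, Sym2.eq_iff]; rintro (h | h)
        · exact h2 h.2.symm
        · exact h1 h.1
      have e2 : s(x', y) ≠ s(x, y) := by
        simp only [ne_eq, Sym2.eq_iff]; rintro (h | h)
        · exact h3 h.1.symm
        · exact h1 h.2.symm
      have e3 : s(x', y') ≠ s(x, y) := by
        simp only [ne_eq, Sym2.eq_iff]; rintro (h | h)
        · exact h3 h.1.symm
        · exact h4 h.2.symm
      have := sum_coinWeight_mul_eq_zero D s(x, y)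
        (fun ω => M ω x y' * (M ω x' y * M ω x' y')) fun ω b => by
          simp only [hM, adjKernel_coinGraph_update e1, adjKernel_coinGraph_update e2,
            adjKernel_coinGraph_update e3]
      refine le_of_eq ?_
      rw [add_zero, add_zero, add_zero, ← this]
      refine sum_congr rfl fun ω _ => ?_
      rw [hDs, mul_assoc (M ω x y)]
      simp only [hM, adjKernel_coinGraph h1]
  have total : ∑ ω, coinWeight D ω * fourCycleSum (M ω) ≤ 4 * (Fintype.card α : ℝ) ^ 3 := by
    calc ∑ ω, coinWeight D ω * fourCycleSum (M ω)
        = ∑ x, ∑ x', ∑ y, ∑ y',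
            ∑ ω, coinWeight D ω * (M ω x y * M ω x y' * (M ω x' y * M ω x' y')) := by
          simp only [fourCycleSum, mul_sum]
          rw [sum_comm]
          refine sum_congr rfl fun x _ => ?_
          rw [sum_comm]
          refine sum_congr rfl fun x' _ => ?_
          rw [sum_comm]
          refine sum_congr rfl fun y _ => ?_
          rw [sum_comm]
      _ ≤ ∑ x : α, ∑ x' : α, ∑ y : α, ∑ y' : α, ((if x = y then (1 : ℝ) else 0)
            + (if y = y' then 1 else 0) + (if x = x' then 1 else 0) + (if x = y' then 1 else 0)) :=
          sum_le_sum fun x _ => sum_le_sum fun x' _ => sum_le_sum fun y _ => sum_le_sum fun y' _ =>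
            quad x x' y y'
      _ = 4 * (Fintype.card α : ℝ) ^ 3 := by
          simp only [sum_add_distrib, sum_ite_eq, sum_const, card_univ, nsmul_eq_mul, mem_univ,
            if_true, mul_one, mul_ite, mul_zero]
          ring
  by_contra hcon
  push Not at hcon
  have hz : ∑ ω, coinWeight D ω * (fourCycleSum (M ω) - 4 * (Fintype.card α : ℝ) ^ 3) ≤ 0 := by
    simp only [mul_sub, sum_sub_distrib, ← sum_mul, sum_coinWeight, one_mul]
    linarith
  have hpos : ∀ ω, 0 < fourCycleSum (M ω) - 4 * (Fintype.card α : ℝ) ^ 3 := fun ω => by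
    linarith [hcon (coinGraph ω)]
  have hzero : ∑ ω, coinWeight D ω = 0 := by
    refine sum_eq_zero fun ω _ => ?_
    have h1 := (sum_eq_zero_iff_of_nonneg fun ω _ => mul_nonneg (hP ω) (hpos ω).le).1
      (le_antisymm hz (sum_nonneg fun ω _ => mul_nonneg (hP ω) (hpos ω).le)) ω (mem_univ ω)
    exact (mul_eq_zero.1 h1).resolve_right (hpos ω).ne'
  rw [sum_coinWeight] at hzero
  exact one_ne_zero hzero

theorem exists_cutLe_sub {d : α → α → ℝ} (hsym : ∀ x y, d x y = d y x)
    (hd : ∀ x y, d x y ∈ Set.Icc (0 : ℝ) 1) (hα : 0 < Fintype.card α) :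
    ∃ G : SimpleGraph α,
      CutLe (fun x y => adjKernel G x y - d x y) √ √(4 / (Fintype.card α : ℝ)) := by
  obtain ⟨G, hG⟩ := exists_fourCycleSum_sub_le hsym hd
  refine ⟨G, cutLe_of_fourCycleSum_le (by positivity) (hG.trans (le_of_eq ?_))⟩
  have hV : (0 : ℝ) < Fintype.card α := by exact_mod_cast hα
  rw [show (4 : ℕ) = 2 * 2 by norm_num, pow_mul, Real.sq_sqrt (Real.sqrt_nonneg _),
    Real.sq_sqrt (by positivity)]
  field_simp

end RandomGraph

section TwoTypes

variable {m : ℕ}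

/-- The symmetric two-type kernel with values `u`, `v` inside the types and `s` across. -/
def typeKernel (u v s : ℝ) : Bool → Bool → ℝ
  | true, true => u
  | false, false => v
  | _, _ => s

/-- The type assignment determined by a vertex set. -/
def typeOf (A : Finset (Fin m)) (i : Fin m) : Bool := decide (i ∈ A)

theorem edgesIn_eq_card (F : SimpleGraph (Fin m)) (A : Finset (Fin m)) :
    edgesIn F A = ((edgePairs F).filter fun e => e.1 ∈ A ∧ e.2 ∈ A).card := by
  classical
  rw [edgesIn, Nat.card_eq_fintype_card, Fintype.card_subtype]
  congr 1
  ext e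
  simp [mem_edgePairs, and_assoc]

theorem edgesBetween_eq_card (F : SimpleGraph (Fin m)) (A : Finset (Fin m)) :
    edgesBetween F A Aᶜ = ((edgePairs F).filter fun e => ¬(e.1 ∈ A ↔ e.2 ∈ A)).card := by
  classical
  rw [edgesBetween, Nat.card_eq_fintype_card, Fintype.card_subtype]
  refine card_bij' (fun q _ => if q.1 < q.2 then q else q.swap)
    (fun e _ => if e.1 ∈ A then e else e.swap) ?_ ?_ ?_ ?_
  · rintro ⟨i, j⟩ h
    simp only [mem_filter, mem_univ, true_and, mem_compl] at h
    obtain ⟨h1, h2, h3⟩ := h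
    split_ifs with hl
    · simp [mem_edgePairs, h1, h2, h3, hl]
    · have : j < i := lt_of_le_of_ne (not_lt.1 hl) h1.ne'
      simp [mem_edgePairs, h1.symm, h2, h3, this]
  · rintro ⟨i, j⟩ h
    simp only [mem_filter, mem_edgePairs] at h
    obtain ⟨⟨h1, h2⟩, h3⟩ := h
    split_ifs with hA
    · have : j ∉ A := fun hj => h3 ⟨fun _ => hj, fun _ => hA⟩
      simp [h2, hA, this]
    · have : j ∈ A := by
        by_contra hj
        exact h3 ⟨fun h => absurd h hA, fun h => absurd h hj⟩
      simp [h2.symm, this]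
      exact hA
  · rintro ⟨i, j⟩ h
    simp only [mem_filter, mem_univ, true_and, mem_compl] at h
    obtain ⟨h1, h2, h3⟩ := h
    by_cases hl : i < j
    · simp [hl, h2]
    · simp [hl, h3]
  · rintro ⟨i, j⟩ h
    simp only [mem_filter, mem_edgePairs] at h
    obtain ⟨⟨h1, h2⟩, h3⟩ := h
    by_cases hA : i ∈ A
    · simp [hA, h1]
    · simp [hA, h1.not_gt]

theorem weight_eq_edgeProd (F : SimpleGraph (Fin m)) (u v s : ℝ) (A : Finset (Fin m)) :
    u ^ edgesIn F A * v ^ edgesIn F Aᶜ * s ^ edgesBetween F A Aᶜ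
      = edgeProd F (typeKernel u v s) (typeOf A) := by
  classical
  rw [edgesIn_eq_card, edgesIn_eq_card, edgesBetween_eq_card, edgeProd, ← prod_const, ← prod_const,
    ← prod_const, prod_filter, prod_filter, prod_filter, ← prod_mul_distrib, ← prod_mul_distrib]
  refine prod_congr rfl fun e _ => ?_
  by_cases h1 : e.1 ∈ A <;> by_cases h2 : e.2 ∈ A <;> simp [typeOf, typeKernel, h1, h2]

theorem typeOf_filter (t : Fin m → Bool) : typeOf (univ.filter fun i => t i = true) = t := by
  funext i; simp [typeOf]

theorem typeOf_comp_perm (A : Finset (Fin m)) (σ : Equiv.Perm (Fin m)) :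
    (fun i => typeOf A (σ i)) = typeOf (A.map σ.symm.toEmbedding) := by
  funext i
  simp [typeOf]

theorem sum_symEdgeProd_typeOf (F : SimpleGraph (Fin m)) (K : Bool → Bool → ℝ) (k : ℕ) :
    ∑ A ∈ powersetCard k univ, symEdgeProd F K (typeOf A)
      = ∑ A ∈ powersetCard k univ, edgeProd F K (typeOf A) := by
  have hf : (0 : ℝ) < (m.factorial : ℝ) := by positivity
  have hcard : ((univ : Finset (Equiv.Perm (Fin m))).card : ℝ) = m.factorial := by
    rw [card_univ, Fintype.card_perm, Fintype.card_fin]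
  unfold symEdgeProd
  rw [← mul_sum, sum_comm]
  have h1 : ∀ σ : Equiv.Perm (Fin m), ∑ A ∈ powersetCard k univ, edgeProd F K
      (fun i => typeOf A (σ i)) = ∑ A ∈ powersetCard k univ, edgeProd F K (typeOf A) := by
    intro σ
    simp only [typeOf_comp_perm]
    refine sum_bij' (fun A _ => A.map σ.symm.toEmbedding) (fun A _ => A.map σ.toEmbedding)
      ?_ ?_ ?_ ?_ ?_
    · intro A hA; simpa [mem_powersetCard] using hA
    · intro A hA; simpa [mem_powersetCard] using hA
    · intro A hA; ext i; simp
    · intro A hA; ext i; simp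
    · intro A hA; rfl
  rw [sum_congr rfl fun σ _ => h1 σ, sum_const, nsmul_eq_mul, hcard, ← mul_assoc,
    inv_mul_cancel₀ hf.ne', one_mul]

theorem symEdgeProd_typeOf_eq (F : SimpleGraph (Fin m)) (K : Bool → Bool → ℝ)
    {A B : Finset (Fin m)} (h : A.card = B.card) :
    symEdgeProd F K (typeOf A) = symEdgeProd F K (typeOf B) := by
  classical
  have e : {x // x ∈ A} ≃ {x // x ∈ B} := Fintype.equivOfCardEq (by simpa using h)
  have h1 : (fun i => typeOf B (e.extendSubtype i)) = typeOf A := by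
    funext i
    by_cases hi : i ∈ A
    · simp [typeOf, hi, e.extendSubtype_mem i hi]
    · simp [typeOf, hi, e.extendSubtype_not_mem i hi]
  rw [← h1, symEdgeProd_perm]

theorem choose_mul_symEdgeProd (F : SimpleGraph (Fin m)) (K : Bool → Bool → ℝ)
    (A : Finset (Fin m)) :
    (m.choose A.card : ℝ) * symEdgeProd F K (typeOf A)
      = ∑ B ∈ powersetCard A.card univ, edgeProd F K (typeOf B) := by
  rw [← sum_symEdgeProd_typeOf, sum_congr rfl fun B hB =>
    symEdgeProd_typeOf_eq F K ((mem_powersetCard.1 hB).2), sum_const, card_powersetCard, card_univ,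
    Fintype.card_fin, nsmul_eq_mul]

theorem sum_apply_mul_prod {ι : Type*} [Fintype ι] (f : ι → ℝ) (h : Fin m → ι → ℝ) (i : Fin m) :
    ∑ x : Fin m → ι, f (x i) * ∏ j, h j (x j)
      = (∑ y, f y * h i y) * ∏ j ∈ univ.erase i, ∑ y, h j y := by
  classical
  have h1 : ∀ x : Fin m → ι, f (x i) * ∏ j, h j (x j)
      = ∏ j, (if j = i then f (x j) * h j (x j) else h j (x j)) := by
    intro x
    rw [← mul_prod_erase univ _ (mem_univ i), ← mul_prod_erase univ
      (fun j => if j = i then f (x j) * h j (x j) else h j (x j)) (mem_univ i), if_pos rfl,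
      mul_assoc]
    congr 2
    exact prod_congr rfl fun j hj => by rw [if_neg (ne_of_mem_erase hj)]
  rw [sum_congr rfl fun x _ => h1 x,
    ← Fintype.prod_sum fun j y => if j = i then f y * h j y else h j y,
    ← mul_prod_erase univ _ (mem_univ i)]
  simp only [if_true]
  congr 1
  exact prod_congr rfl fun j hj => by simp only [if_neg (ne_of_mem_erase hj)]

theorem sum_affine_mul_prod {ψ : (Fin m → Bool) → ℝ} {a b q : ℝ}
    (hψ : ∀ t, ψ t = a + b * ((univ.filter fun i => t i = true).card : ℝ))
    (h : Fin m → Bool → ℝ) (hq : ∀ i, ∑ y, h i y = q) (hhalf : ∑ i, h i true = m * q / 2) :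
    ∑ t : Fin m → Bool, ψ t * ∏ i, h i (t i) = (a + b * m / 2) * q ^ m := by
  have h1 : ∀ t : Fin m → Bool, ψ t * ∏ i, h i (t i) = a * ∏ i, h i (t i)
      + b * ∑ i, (if t i = true then (1 : ℝ) else 0) * ∏ i, h i (t i) := by
    intro t
    rw [hψ, card_filter, ← sum_mul]
    push_cast
    ring
  rw [sum_congr rfl fun t _ => h1 t, sum_add_distrib, sum_const_mul_prod, ← mul_sum, sum_comm]
  have h2 : ∀ i : Fin m, ∑ t : Fin m → Bool, (if t i = true then (1 : ℝ) else 0) * ∏ j, h j (t j)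
      = h i true * q ^ (m - 1) := by
    intro i
    rw [sum_apply_mul_prod (fun y : Bool => if y = true then (1 : ℝ) else 0) h i]
    simp only [hq, prod_const, card_erase_of_mem (mem_univ i), card_univ, Fintype.card_fin]
    simp
  rw [sum_congr rfl fun i _ => h2 i, ← sum_mul, hhalf, prod_congr rfl fun i _ => hq i]
  rcases m with _ | m
  · simp
  · simp only [prod_const, card_univ, Fintype.card_fin, Nat.add_sub_cancel, pow_succ]
    ring

/-- A nonconstant symmetric two-type kernel with values in `[0,1]` whose symmetrized edge product
is affine in the number of vertices of the first type. -/
theorem exists_affine_kernel (F : SimpleGraph (Fin m)) {u v s : ℝ} (hu : 0 ≤ u) (hv : 0 ≤ v)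
    (hs : 0 ≤ s) (hne : ¬ (u = v ∧ v = s)) {a b : ℝ} (hab : ¬ (a = 0 ∧ b = 0))
    (h : ∀ k ≤ m, ∑ A ∈ Finset.powersetCard k (Finset.univ : Finset (Fin m)),
      u ^ edgesIn F A * v ^ edgesIn F Aᶜ * s ^ edgesBetween F A Aᶜ
        = (m.choose k : ℝ) * (a + b * k)) :
    ∃ (K : Bool → Bool → ℝ) (a b p : ℝ), (∀ x y, K x y = K y x) ∧
      (∀ x y, K x y ∈ Set.Icc (0 : ℝ) 1) ∧ (∀ c, ∃ x y, K x y ≠ c) ∧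
      (∀ t : Fin m → Bool, symEdgeProd F K t
        = a + b * ((univ.filter fun i => t i = true).card : ℝ)) ∧
      0 < p ∧ p ≤ 1 ∧ p ^ numEdges F = a + b * m / 2 := by
  set M := max u (max v s) with hM
  have hMpos : 0 < M := by
    by_contra hcon
    have h1 : u ≤ 0 := (le_max_left _ _).trans (not_lt.1 hcon)
    have h2 : v ≤ 0 := (le_max_left v s |>.trans (le_max_right _ _)).trans (not_lt.1 hcon)
    have h3 : s ≤ 0 := (le_max_right v s |>.trans (le_max_right _ _)).trans (not_lt.1 hcon)
    exact hne ⟨by linarith, by linarith⟩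
  have hle : ∀ x y, 0 ≤ typeKernel u v s x y ∧ typeKernel u v s x y ≤ M := by
    rintro (_ | _) (_ | _) <;> simp [typeKernel, hu, hv, hs, hM]
  set K : Bool → Bool → ℝ := fun x y => typeKernel u v s x y / M with hK
  have hKI : ∀ x y, K x y ∈ Set.Icc (0 : ℝ) 1 := fun x y =>
    ⟨div_nonneg (hle x y).1 hMpos.le, (div_le_one hMpos).2 (hle x y).2⟩
  have hscale : ∀ x : Fin m → Bool,
      edgeProd F K x = edgeProd F (typeKernel u v s) x / M ^ numEdges F := by
    intro x
    rw [edgeProd, edgeProd, numEdges_eq_card, prod_div_distrib, prod_const]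
  have hsymK : ∀ t : Fin m → Bool, symEdgeProd F K t = a / M ^ numEdges F
      + b / M ^ numEdges F * ((univ.filter fun i => t i = true).card : ℝ) := by
    intro t
    set A := univ.filter fun i => t i = true with hA
    have h1 := choose_mul_symEdgeProd F K A
    simp only [hscale] at h1
    rw [← sum_div] at h1
    simp only [← weight_eq_edgeProd] at h1
    have hAm : A.card ≤ m := by simpa using card_le_univ A
    rw [h _ hAm, hA, typeOf_filter, ← hA] at h1
    have hc : (m.choose A.card : ℝ) ≠ 0 := by
      exact_mod_cast (Nat.choose_pos hAm).ne'
    refine mul_left_cancel₀ hc (h1.trans ?_)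
    ring
  have hsumK := sum_affine_mul_prod hsymK (fun _ _ => (1 : ℝ)) (q := 2) (fun i => by simp)
    (by simp)
  simp only [prod_const_one, mul_one] at hsumK
  set P := a / M ^ numEdges F + b / M ^ numEdges F * m / 2 with hP
  have hI : ∀ t : Fin m → Bool, symEdgeProd F K t ∈ Set.Icc (0 : ℝ) 1 := symEdgeProd_mem_Icc F hKI
  have h2m : (0 : ℝ) < 2 ^ m := by positivity
  have hP1 : P ≤ 1 := by
    have : ∑ t : Fin m → Bool, symEdgeProd F K t ≤ ∑ _t : Fin m → Bool, (1 : ℝ) :=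
      sum_le_sum fun t _ => (hI t).2
    rw [hsumK] at this
    simp only [sum_const, card_univ, Fintype.card_pi, Fintype.card_bool, prod_const,
      Fintype.card_fin, nsmul_eq_mul, mul_one, Nat.cast_pow, Nat.cast_ofNat] at this
    exact le_of_mul_le_mul_right (by linarith) h2m
  have hPpos : 0 < P := by
    have h0 : 0 ≤ P * 2 ^ m := hsumK ▸ sum_nonneg fun t _ => (hI t).1
    have h0' : 0 ≤ P := nonneg_of_mul_nonneg_left h0 h2m
    refine lt_of_le_of_ne h0' fun hzero => hab ?_
    rw [← hzero, zero_mul] at hsumK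
    have hall := (sum_eq_zero_iff_of_nonneg fun t _ => (hI t).1).1 hsumK
    have hMe : M ^ numEdges F ≠ 0 := by positivity
    have hf := hall (fun _ => false) (mem_univ _)
    have ht := hall (fun _ => true) (mem_univ _)
    rw [hsymK] at hf ht
    simp only [Bool.false_eq_true, filter_false, card_empty, Nat.cast_zero, mul_zero, add_zero,
      div_eq_zero_iff, hMe, or_false] at hf
    rcases Nat.eq_zero_or_pos m with rfl | hm
    · exfalso
      have h1 : numEdges F = 0 := by
        rw [numEdges_eq_card, card_eq_zero, eq_empty_iff_forall_notMem]
        exact fun e => e.1.elim0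
      have h2 := h 0 le_rfl
      rw [hf] at h2
      simp [weight_eq_edgeProd, edgeProd, card_eq_zero.1 (numEdges_eq_card F ▸ h1)] at h2
    · refine ⟨hf, ?_⟩
      simp only [filter_true, card_univ, Fintype.card_fin, hf, zero_div, zero_add, mul_eq_zero,
        div_eq_zero_iff, hMe, or_false, Nat.cast_eq_zero, hm.ne'] at ht
      exact ht
  refine ⟨K, a / M ^ numEdges F, b / M ^ numEdges F, if numEdges F = 0 then 1 else
    P ^ ((numEdges F : ℝ)⁻¹), ?_, hKI, ?_, hsymK, ?_, ?_, ?_⟩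
  · rintro (_ | _) (_ | _) <;> simp [hK, typeKernel]
  · intro c
    by_contra hcon
    push Not at hcon
    have h1 := hcon true true
    have h2 := hcon false false
    have h3 := hcon true false
    simp only [hK, typeKernel, div_eq_iff hMpos.ne'] at h1 h2 h3
    exact hne ⟨h1.trans h2.symm, h2.trans h3.symm⟩
  · split_ifs
    · exact one_pos
    · positivity
  · split_ifs
    · exact le_rfl
    · exact Real.rpow_le_one hPpos.le hP1 (by positivity)
  · split_ifs with he
    · rw [one_pow]
      have hE : edgePairs F = ∅ := card_eq_zero.1 (by rw [← numEdges_eq_card]; exact he)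
      have h1 : ∀ t : Fin m → Bool, symEdgeProd F K t = 1 := fun t =>
        symEdgeProd_of_edgeProd_const fun σ => by
          rw [edgeProd, hE, prod_empty]
      simp only [h1, sum_const, card_univ, Fintype.card_pi, Fintype.card_bool, prod_const,
        Fintype.card_fin, nsmul_eq_mul, mul_one, Nat.cast_pow, Nat.cast_ofNat] at hsumK
      have : (1 : ℝ) = P := mul_right_cancel₀ h2m.ne' (by linarith)
      exact this
    · rw [← Real.rpow_natCast, ← Real.rpow_mul hPpos.le, inv_mul_cancel₀ (by exact_mod_cast he),
        Real.rpow_one]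

end TwoTypes

section TwoTypeSequence

variable {m : ℕ}

theorem sum_comp_mul_prod {α ι : Type*} [Fintype α] [Fintype ι] [DecidableEq ι] (τ : α → ι)
    (f : (Fin m → ι) → ℝ) (h : Fin m → α → ℝ) :
    ∑ x : Fin m → α, f (fun i => τ (x i)) * ∏ i, h i (x i)
      = ∑ t : Fin m → ι, f t * ∏ i, ∑ a with τ a = t i, h i a := by
  classical
  rw [← sum_fiberwise univ (fun (x : Fin m → α) i => τ (x i))]
  refine sum_congr rfl fun t _ => ?_
  rw [prod_univ_sum, mul_sum]
  refine sum_congr ?_ fun x hx => ?_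
  · ext x
    simp [Fintype.mem_piFinset, funext_iff]
  · rw [Fintype.mem_piFinset] at hx
    have : (fun i => τ (x i)) = t := funext fun i => (mem_filter.1 (hx i)).2
    rw [this]

theorem exists_seq_of_affine_kernel (F : SimpleGraph (Fin m)) {K : Bool → Bool → ℝ} {a b p : ℝ}
    (hsym : ∀ x y, K x y = K y x) (hK : ∀ x y, K x y ∈ Set.Icc (0 : ℝ) 1)
    (hne : ∀ c, ∃ x y, K x y ≠ c)
    (hψ : ∀ t : Fin m → Bool, symEdgeProd F K t
      = a + b * ((univ.filter fun i => t i = true).card : ℝ))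
    (hp : p ^ numEdges F = a + b * m / 2) :
    ∃ (V : ℕ → ℕ) (G : ∀ n, SimpleGraph (Fin (V n))), Tendsto V atTop atTop ∧
      SatisfiesPt F p (fun _ => 1 / (m : ℝ)) V G ∧ ¬ IsQuasirandom p V G := by
  classical
  set H : ℕ → ℕ := fun n => max m 1 * (n + 1) with hH
  have hHn : ∀ n, n + 1 ≤ H n := fun n => Nat.le_mul_of_pos_left _ (by simp)
  set V : ℕ → ℕ := fun n => 2 * H n with hVdef
  have hVpos : ∀ n, 0 < Fintype.card (Fin (V n)) := fun n => by
    have := hHn n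
    simp only [Fintype.card_fin, hVdef]
    lia
  have hV : Tendsto V atTop atTop := tendsto_atTop_mono (fun n => by
    have := hHn n
    simp only [hVdef, id_eq]
    lia) tendsto_id
  set τ : ∀ n, Fin (V n) → Bool := fun n x => decide (x.val < H n) with hτ
  have hcut := fun n => exists_cutLe_sub (α := Fin (V n)) (d := fun x y => K (τ n x) (τ n y))
    (fun x y => hsym _ _) (fun x y => hK _ _) (hVpos n)
  choose G hG using hcut
  have hVr : Tendsto (fun n => (V n : ℝ)) atTop atTop := tendsto_natCast_atTop_atTop.comp hV
  have hδ : Tendsto (fun n => √ √(4 / (Fintype.card (Fin (V n)) : ℝ))) atTop (nhds 0) := by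
    simp only [Fintype.card_fin]
    simpa using (hVr.const_div_atTop 4).sqrt.sqrt
  have hcard : ∀ n y, ((univ.filter fun x => τ n x = y).card) = H n := by
    have h1 : ∀ n, (univ.filter fun x => τ n x = true).card = H n := fun n => by
      have : (univ.filter fun x => τ n x = true) = univ.filter fun x : Fin (V n) => x.val < H n := by
        ext x; simp [hτ]
      rw [this, Fin.card_filter_val_lt]
      simp [hVdef]
      lia
    intro n y
    cases y
    · have h2 := card_filter_add_card_filter_not (s := (univ : Finset (Fin (V n))))
        (fun x => τ n x = true)
      rw [h1, card_univ, Fintype.card_fin] at h2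
      simp only [Bool.not_eq_true] at h2
      simp only [hVdef] at h2 ⊢
      lia
    · exact h1 n
  refine ⟨V, G, hV, ?_, ?_⟩
  · refine satisfiesPt_of_cutLe F _ (d := fun n x y => K (τ n x) (τ n y)) (fun n x y => hK _ _) hδ
      hG fun n U hdisj hU => ?_
    have h1 := sum_comp_mul_prod (τ n) (fun t => symEdgeProd F K t)
      (fun i x => if x ∈ U i then (1 : ℝ) else 0)
    refine h1.trans ?_
    rcases Nat.eq_zero_or_pos m with rfl | hm
    · simp [hψ, hp]
    have hmax : max m 1 = m := max_eq_left hm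
    have hUc : ∀ i, (U i).card = 2 * (n + 1) := fun i => by
      rw [hU i]
      have : 1 / (m : ℝ) * (V n : ℝ) = ((2 * (n + 1) : ℕ) : ℝ) := by
        simp only [hVdef, hH, hmax]
        push_cast
        field_simp
      rw [this, Nat.floor_natCast]
    have hcover : univ.biUnion U = univ := by
      refine eq_univ_of_card _ ?_
      rw [card_biUnion fun i _ j _ hij => hdisj hij, sum_congr rfl fun i _ => hUc i]
      simp only [sum_const, card_univ, Fintype.card_fin, smul_eq_mul, hVdef, hH, hmax]
      ring
    have hin : ∀ i y, ∑ x with τ n x = y, (if x ∈ U i then (1 : ℝ) else 0)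
        = ((U i).filter fun x => τ n x = y).card := fun i y => by
      rw [← sum_filter, sum_const, nsmul_eq_mul, mul_one, filter_filter]
      congr 2
      ext x
      simp [and_comm]
    have h2 := sum_affine_mul_prod hψ
      (fun i y => ∑ x with τ n x = y, (if x ∈ U i then (1 : ℝ) else 0))
      (q := ((2 * (n + 1) : ℕ) : ℝ)) (fun i => by
        rw [sum_fiberwise, sum_ite_mem, univ_inter, sum_const, hUc, nsmul_eq_mul, mul_one]) (by
        simp only [hin]
        rw [← Nat.cast_sum, ← card_biUnion fun i _ j _ hij =>
          (hdisj hij).mono (filter_subset _ _) (filter_subset _ _), ← filter_biUnion, hcover, hcard]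
        simp only [hH, hmax]
        push_cast
        ring)
    rw [h2, hp]
    simp [hUc]
  · intro hqr
    obtain ⟨δ, hδ', hcut'⟩ := exists_cutLe_of_isQuasirandom hV hqr
    obtain ⟨y, z, hyz⟩ := hne p
    have h1 : ∀ n, |K y z - p| ≤ 4 * (δ n + √ √(4 / (Fintype.card (Fin (V n)) : ℝ))) := by
      intro n
      set g : Bool → Fin (V n) → ℝ := fun y x => if τ n x = y then 1 else 0 with hg
      have hgI : ∀ y x, g y x ∈ Set.Icc (0 : ℝ) 1 := fun y x => by
        simp only [hg]
        split_ifs <;> simp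
      have e1 := hG n (g y) (g z) (hgI y) (hgI z)
      have e2 := hcut' n (g y) (g z) (hgI y) (hgI z)
      have e3 : ∑ x, ∑ x', (K (τ n x) (τ n x') - p) * g y x * g z x'
          = (K y z - p) * (H n : ℝ) ^ 2 := by
        have e4 : ∀ x x', (K (τ n x) (τ n x') - p) * g y x * g z x'
            = (K y z - p) * (g y x * g z x') := by
          intro x x'
          simp only [hg]
          by_cases h1 : τ n x = y
          · by_cases h2 : τ n x' = z
            · simp [h1, h2]
            · simp [h2]
          · simp [h1]
        simp only [e4, ← mul_sum, ← sum_mul]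
        simp only [hg, sum_boole, hcard]
        ring
      have e5 : ∑ x, ∑ x', (K (τ n x) (τ n x') - p) * g y x * g z x'
          = ∑ x, ∑ x', (adjKernel (G n) x x' - p) * g y x * g z x'
            - ∑ x, ∑ x', (adjKernel (G n) x x' - K (τ n x) (τ n x')) * g y x * g z x' := by
        simp only [← sum_sub_distrib]
        refine sum_congr rfl fun x _ => sum_congr rfl fun x' _ => ?_
        ring
      have e6 : |(K y z - p) * (H n : ℝ) ^ 2| ≤ (δ n + √ √(4 / (Fintype.card (Fin (V n)) : ℝ)))
          * (Fintype.card (Fin (V n)) : ℝ) ^ 2 := by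
        rw [← e3, e5, add_mul]
        exact (abs_sub _ _).trans (add_le_add e2 e1)
      have hHpos : (0 : ℝ) < (H n : ℝ) ^ 2 := by
        have : 0 < H n := by have := hHn n; lia
        positivity
      rw [abs_mul, abs_of_pos hHpos] at e6
      refine le_of_mul_le_mul_right (e6.trans (le_of_eq ?_)) hHpos
      rw [Fintype.card_fin]
      simp only [hVdef]
      push_cast
      ring
    have h2 := ge_of_tendsto' ((hδ'.add hδ).const_mul 4) h1
    rw [add_zero, mul_zero] at h2
    exact hyz (sub_eq_zero.1 (abs_nonpos_iff.1 h2))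

end TwoTypeSequence

section StepGraphon

variable {m : ℕ}

theorem integral_pi_comp {Ω ι : Type*} [MeasurableSpace Ω] [Fintype ι]
    (μ : Fin m → Measure Ω) [∀ i, IsFiniteMeasure (μ i)] {τ : Ω → ι}
    (hτ : ∀ y, MeasurableSet (τ ⁻¹' {y})) (f : (Fin m → ι) → ℝ) :
    ∫ x, f (fun i => τ (x i)) ∂(Measure.pi μ)
      = ∑ t : Fin m → ι, f t * ∏ i, (μ i).real (τ ⁻¹' {t i}) := by
  classical
  have h1 : ∀ x : Fin m → Ω, f (fun i => τ (x i))
      = ∑ t : Fin m → ι, f t * ∏ i, (τ ⁻¹' {t i}).indicator (fun _ => (1 : ℝ)) (x i) := by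
    intro x
    rw [sum_eq_single (fun i => τ (x i))]
    · simp
    · intro t _ ht
      obtain ⟨i, hi⟩ := Function.ne_iff.1 ht
      rw [prod_eq_zero (mem_univ i), mul_zero]
      exact Set.indicator_of_notMem (fun h => hi (by simpa using h.symm)) _
    · simp
  simp only [h1]
  rw [integral_finsetSum]
  · refine sum_congr rfl fun t _ => ?_
    rw [integral_const_mul,
      integral_fintype_prod_eq_prod fun i => (τ ⁻¹' {t i}).indicator fun _ => (1 : ℝ)]
    congr 1
    refine prod_congr rfl fun i _ => ?_
    rw [integral_indicator_const _ (hτ _)]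
    simp
  · intro t _
    refine Integrable.const_mul ?_ _
    exact Integrable.fintype_prod fun i => (integrable_const (1 : ℝ)).indicator (hτ _)

theorem setIntegral_pi_comp {ι : Type*} [Fintype ι] {A : Fin m → Set ℝ}
    (hA : ∀ i, volume (A i) ≠ ⊤) {τ : ℝ → ι}
    (hτ : ∀ y, MeasurableSet (τ ⁻¹' {y})) (f : (Fin m → ι) → ℝ) :
    ∫ x in Set.univ.pi A, f (fun i => τ (x i))
      = ∑ t : Fin m → ι, f t * ∏ i, volume.real (τ ⁻¹' {t i} ∩ A i) := by
  have : ∀ i, IsFiniteMeasure (volume.restrict (A i)) := fun i =>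
    ⟨by rw [Measure.restrict_apply_univ]; exact (hA i).lt_top⟩
  rw [volume_pi, Measure.restrict_pi_pi, integral_pi_comp _ hτ]
  simp only [measureReal_def, Measure.restrict_apply (hτ _)]

theorem exists_graphon_of_affine_kernel (F : SimpleGraph (Fin m)) {K : Bool → Bool → ℝ}
    {a b p : ℝ} (hsym : ∀ x y, K x y = K y x) (hK : ∀ x y, K x y ∈ Set.Icc (0 : ℝ) 1)
    (hne : ∀ c, ∃ x y, K x y ≠ c)
    (hψ : ∀ t : Fin m → Bool, symEdgeProd F K t
      = a + b * ((univ.filter fun i => t i = true).card : ℝ))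
    (hp : p ^ numEdges F = a + b * m / 2) :
    ∃ W : ℝ → ℝ → ℝ, IsGraphon W ∧
      ¬ ((fun z : ℝ × ℝ => W z.1 z.2) =ᵐ[volume.restrict unitSquare] fun _ => p) ∧
      GraphonPt F W p (fun _ => 1 / (m : ℝ)) := by
  classical
  set τ : ℝ → Bool := fun x => decide (x < 1 / 2) with hτ
  have hτt : τ ⁻¹' {true} = Set.Iio (1 / 2) := by ext; simp [hτ]
  have hτf : τ ⁻¹' {false} = Set.Ici (1 / 2) := by ext; simp [hτ]
  have hτs : ∀ y, MeasurableSet (τ ⁻¹' {y}) := by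
    rintro (_ | _)
    · rw [hτf]; exact measurableSet_Ici
    · rw [hτt]; exact measurableSet_Iio
  have hτm : Measurable τ := measurable_to_countable' hτs
  refine ⟨fun x y => K (τ x) (τ y), ⟨?_, fun _ _ => hsym _ _, fun _ _ => hK _ _⟩, ?_, ?_⟩
  · exact (measurable_of_countable (Function.uncurry K)).comp
      ((hτm.comp measurable_fst).prodMk (hτm.comp measurable_snd))
  · intro hae
    obtain ⟨y, z, hyz⟩ := hne p
    have hpos : ∀ y, 0 < volume (τ ⁻¹' {y} ∩ Set.Icc 0 1) := by
      rintro (_ | _)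
      · rw [hτf]
        refine lt_of_lt_of_le ?_ (measure_mono (s := Set.Icc (1 / 2 : ℝ) 1) fun x hx =>
          ⟨hx.1, by linarith [hx.1], hx.2⟩)
        rw [Real.volume_Icc]
        norm_num
      · rw [hτt]
        refine lt_of_lt_of_le ?_ (measure_mono (s := Set.Ico (0 : ℝ) (1 / 2)) fun x hx =>
          ⟨hx.2, hx.1, by linarith [hx.2]⟩)
        rw [Real.volume_Ico]
        norm_num
    have h0 : (volume.restrict unitSquare) {z | ¬ K (τ z.1) (τ z.2) = p} = 0 := ae_iff.1 hae
    have h1 : volume ((τ ⁻¹' {y} ∩ Set.Icc 0 1) ×ˢ (τ ⁻¹' {z} ∩ Set.Icc 0 1)) = 0 := by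
      refine measure_mono_null (fun w hw => ?_)
        (nonpos_iff_eq_zero.1 ((Measure.le_restrict_apply _ _).trans h0.le))
      obtain ⟨⟨hw1, hw2⟩, hw3, hw4⟩ := hw
      simp only [Set.mem_preimage, Set.mem_singleton_iff] at hw1 hw3
      refine ⟨?_, hw2, hw4⟩
      simpa [hw1, hw3] using hyz
    rw [Measure.volume_eq_prod, Measure.prod_prod, mul_eq_zero] at h1
    exact h1.elim (hpos y).ne' (hpos z).ne'
  · intro A hAm hA01 hdisj hvol
    have hfin : ∀ i, volume (A i) ≠ ⊤ := fun i => by rw [hvol]; exact ENNReal.ofReal_ne_top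
    simp only [psiSym_eq_symEdgeProd]
    have h1 := setIntegral_pi_comp hfin hτs fun t => symEdgeProd F K t
    refine h1.trans ?_
    rcases Nat.eq_zero_or_pos m with rfl | hm
    · simp [hψ, hp]
    have hmr : (0 : ℝ) < m := by exact_mod_cast hm
    have hreal : ∀ i, volume.real (A i) = 1 / m := fun i => by
      rw [measureReal_def, hvol, ENNReal.toReal_ofReal (by positivity)]
    have hU : volume.real (⋃ i, A i) = 1 := by
      rw [measureReal_iUnion_fintype hdisj hAm]
      simp only [hreal, sum_const, card_univ, Fintype.card_fin, nsmul_eq_mul]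
      field_simp
    have hUae : (⋃ i, A i) =ᵐ[volume] Set.Icc (0 : ℝ) 1 := by
      refine ae_eq_of_subset_of_measure_ge (Set.iUnion_subset hA01) ?_
        (MeasurableSet.iUnion hAm).nullMeasurableSet (by simp)
      rw [Real.volume_Icc, sub_zero, ← hU, measureReal_def, ENNReal.ofReal_toReal]
      refine ((measure_mono (Set.iUnion_subset hA01)).trans_lt ?_).ne
      simp
    have h2 := sum_affine_mul_prod hψ (fun i y => volume.real (τ ⁻¹' {y} ∩ A i)) (q := 1 / m)
      (fun i => by
        rw [Fintype.sum_bool, hτt, hτf, ← hreal i]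
        have h3 := measureReal_inter_add_sdiff (μ := volume) (s := A i)
          (measurableSet_Iio (a := (1 / 2 : ℝ))) (hfin i)
        rw [← h3, Set.inter_comm]
        congr 2
        ext x
        simp [and_comm])
      (by
        rw [← measureReal_iUnion_fintype (fun i j hij =>
          (hdisj hij).mono Set.inter_subset_right Set.inter_subset_right)
          (fun i => (hτs _).inter (hAm i)) (fun i =>
            ((measure_mono Set.inter_subset_right).trans_lt (hfin i).lt_top).ne),
          ← Set.inter_iUnion, measureReal_congr ((ae_eq_refl _).inter hUae), hτt]
        have : Set.Iio (1 / 2 : ℝ) ∩ Set.Icc 0 1 = Set.Ico 0 (1 / 2) := by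
          ext x
          simp only [Set.mem_inter_iff, Set.mem_Iio, Set.mem_Icc, Set.mem_Ico]
          constructor
          · rintro ⟨h1, h2, h3⟩; exact ⟨h2, h1⟩
          · rintro ⟨h1, h2⟩; exact ⟨h2, h1, by linarith⟩
        rw [this, Real.volume_real_Ico_of_le (by norm_num)]
        field_simp
        norm_num)
    rw [h2, hp]
    simp

end StepGraphon

section Partitions

variable {α ι κ : Type*} [Fintype α] [DecidableEq ι] [DecidableEq κ]

/-- The density of a kernel between two cells of the partition given by `τ`. -/
noncomputable def cellDens (w : α → α → ℝ) (τ : α → ι) (c c' : ι) : ℝ :=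
  (∑ x with τ x = c, ∑ y with τ y = c', w x y)
    / (((univ.filter fun x => τ x = c).card : ℝ) * ((univ.filter fun x => τ x = c').card : ℝ))

/-- The mean square density of a partition. -/
noncomputable def cellEnergy (w : α → α → ℝ) (τ : α → ι) : ℝ :=
  (∑ x, ∑ y, cellDens w τ (τ x) (τ y) ^ 2) / (Fintype.card α : ℝ) ^ 2

theorem cellDens_mem_Icc {w : α → α → ℝ} (hw : ∀ x y, w x y ∈ Set.Icc (0 : ℝ) 1) (τ : α → ι)
    (c c' : ι) : cellDens w τ c c' ∈ Set.Icc (0 : ℝ) 1 := by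
  refine ⟨div_nonneg (sum_nonneg fun x _ => sum_nonneg fun y _ => (hw x y).1) (by positivity),
    div_le_one_of_le₀ ?_ (by positivity)⟩
  refine (sum_le_sum fun x _ => sum_le_sum fun y _ => (hw x y).2).trans (le_of_eq ?_)
  simp

theorem cellDens_comm {w : α → α → ℝ} (hw : ∀ x y, w x y = w y x) (τ : α → ι) (c c' : ι) :
    cellDens w τ c c' = cellDens w τ c' c := by
  rw [cellDens, cellDens, sum_comm, mul_comm]
  simp only [hw]

theorem cellEnergy_mem_Icc {w : α → α → ℝ} (hw : ∀ x y, w x y ∈ Set.Icc (0 : ℝ) 1) (τ : α → ι) :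
    cellEnergy w τ ∈ Set.Icc (0 : ℝ) 1 := by
  refine ⟨div_nonneg (sum_nonneg fun x _ => sum_nonneg fun y _ => sq_nonneg _) (by positivity),
    div_le_one_of_le₀ ?_ (by positivity)⟩
  refine (sum_le_sum fun x _ => sum_le_sum fun y _ =>
    pow_le_one₀ (cellDens_mem_Icc hw τ _ _).1 (cellDens_mem_Icc hw τ _ _).2).trans (le_of_eq ?_)
  simp [sq]

theorem abs_sum_mul_le_sqrt (M g : α → α → ℝ) (hg : ∀ x y, |g x y| ≤ 1) {e : ℝ}
    (hM : ∑ x, ∑ y, M x y ^ 2 ≤ e * (Fintype.card α : ℝ) ^ 2) :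
    |∑ x, ∑ y, M x y * g x y| ≤ √e * (Fintype.card α : ℝ) ^ 2 := by
  rcases isEmpty_or_nonempty α with hα | hα
  · simp
  have hpos : (0 : ℝ) < Fintype.card α := by exact_mod_cast Fintype.card_pos
  have he : 0 ≤ e := nonneg_of_mul_nonneg_left
    ((sum_nonneg fun x _ => sum_nonneg fun y _ => sq_nonneg _).trans hM) (by positivity)
  have h1 : (∑ z : α × α, M z.1 z.2 * g z.1 z.2) ^ 2
      ≤ (∑ z : α × α, M z.1 z.2 ^ 2) * ∑ z : α × α, g z.1 z.2 ^ 2 :=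
    sum_mul_sq_le_sq_mul_sq _ _ _
  rw [Fintype.sum_prod_type, Fintype.sum_prod_type, Fintype.sum_prod_type] at h1
  have h2 : ∑ x, ∑ y, g x y ^ 2 ≤ (Fintype.card α : ℝ) ^ 2 := by
    refine (sum_le_sum fun x _ => sum_le_sum fun y _ =>
      (sq_le_one_iff_abs_le_one _).2 (hg x y)).trans (le_of_eq ?_)
    simp [sq]
  refine abs_le_of_sq_le_sq ?_ (by positivity)
  refine h1.trans ((mul_le_mul hM h2 (sum_nonneg fun x _ => sum_nonneg fun y _ => sq_nonneg _)
    (by positivity)).trans (le_of_eq ?_))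
  rw [mul_pow, Real.sq_sqrt he]
  ring

variable [Fintype ι] [Fintype κ]

theorem sum_sum_fiberwise (τ : α → ι) (g : α → α → ℝ) :
    ∑ x, ∑ y, g x y = ∑ c, ∑ c', ∑ x with τ x = c, ∑ y with τ y = c', g x y := by
  rw [← sum_fiberwise univ τ]
  refine sum_congr rfl fun c _ => ?_
  refine Eq.trans ?_ sum_comm
  exact sum_congr rfl fun x _ => (sum_fiberwise univ τ fun y => g x y).symm

theorem sum_sum_comp (τ : α → ι) (g : ι → ι → ℝ) :
    ∑ x, ∑ y, g (τ x) (τ y) = ∑ c, ∑ c', ((univ.filter fun x => τ x = c).card : ℝ)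
      * ((univ.filter fun x => τ x = c').card : ℝ) * g c c' := by
  rw [sum_sum_fiberwise τ]
  refine sum_congr rfl fun c _ => sum_congr rfl fun c' _ => ?_
  have h1 : ∀ x ∈ univ.filter fun x => τ x = c, ∑ y with τ y = c', g (τ x) (τ y)
      = ∑ y with τ y = c', g c c' := fun x hx => sum_congr rfl fun y hy => by
    rw [(mem_filter.1 hx).2, (mem_filter.1 hy).2]
  rw [sum_congr rfl h1]
  simp only [sum_const, nsmul_eq_mul]
  ring

theorem sum_cellDens_mul (w : α → α → ℝ) (τ : α → ι) (f : ι → ι → ℝ) :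
    ∑ x, ∑ y, cellDens w τ (τ x) (τ y) * f (τ x) (τ y) = ∑ x, ∑ y, w x y * f (τ x) (τ y) := by
  rw [sum_sum_comp τ fun c c' => cellDens w τ c c' * f c c', sum_sum_fiberwise τ]
  refine sum_congr rfl fun c _ => sum_congr rfl fun c' _ => ?_
  have h1 : ∀ x ∈ univ.filter fun x => τ x = c, ∑ y with τ y = c', w x y * f (τ x) (τ y)
      = ∑ y with τ y = c', w x y * f c c' := fun x hx => sum_congr rfl fun y hy => by
    rw [(mem_filter.1 hx).2, (mem_filter.1 hy).2]
  rw [sum_congr rfl h1]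
  simp only [← sum_mul]
  rw [← mul_assoc, cellDens]
  congr 1
  refine mul_div_cancel_of_imp' fun h => ?_
  rcases mul_eq_zero.1 h with h | h
  · rw [Nat.cast_eq_zero, card_eq_zero] at h
    rw [h, sum_empty]
  · rw [Nat.cast_eq_zero, card_eq_zero] at h
    simp [h]

theorem sum_cellDens_sub_sq (w : α → α → ℝ) (τ : α → ι) (π : ι → κ) :
    ∑ x, ∑ y, (cellDens w τ (τ x) (τ y)
        - cellDens w (fun x => π (τ x)) (π (τ x)) (π (τ y))) ^ 2
      = (cellEnergy w τ - cellEnergy w fun x => π (τ x)) * (Fintype.card α : ℝ) ^ 2 := by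
  have h1 := sum_cellDens_mul w τ fun a b => cellDens w (fun x => π (τ x)) (π a) (π b)
  have h2 := sum_cellDens_mul w (fun x => π (τ x)) (cellDens w fun x => π (τ x))
  rcases isEmpty_or_nonempty α with hα | hα
  · simp
  have hpos : (0 : ℝ) < Fintype.card α := by exact_mod_cast Fintype.card_pos
  rw [cellEnergy, cellEnergy, ← sub_div, div_mul_cancel₀ _ (by positivity)]
  simp only [sub_sq, sum_add_distrib, sum_sub_distrib, mul_assoc, ← mul_sum]
  rw [h1, ← h2]
  simp only [← sq]
  ring

theorem cellEnergy_comp_le (w : α → α → ℝ) (τ : α → ι) (π : ι → κ) :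
    (cellEnergy w fun x => π (τ x)) ≤ cellEnergy w τ := by
  rcases isEmpty_or_nonempty α with hα | hα
  · simp [cellEnergy]
  have hpos : (0 : ℝ) < Fintype.card α := by exact_mod_cast Fintype.card_pos
  have h1 : 0 ≤ (cellEnergy w τ - cellEnergy w fun x => π (τ x)) * (Fintype.card α : ℝ) ^ 2 := by
    rw [← sum_cellDens_sub_sq]
    exact sum_nonneg fun x _ => sum_nonneg fun y _ => sq_nonneg _
  have := nonneg_of_mul_nonneg_left h1 (by positivity)
  linarith

theorem sum_abs_cellDens_sub_le (w : α → α → ℝ) (τ : α → ι) (π : ι → κ) :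
    ∑ x, ∑ y, |cellDens w τ (τ x) (τ y)
        - cellDens w (fun x => π (τ x)) (π (τ x)) (π (τ y))|
      ≤ √(cellEnergy w τ - cellEnergy w fun x => π (τ x)) * (Fintype.card α : ℝ) ^ 2 := by
  have h1 := abs_sum_mul_le_sqrt
    (fun x y => |cellDens w τ (τ x) (τ y)
        - cellDens w (fun x => π (τ x)) (π (τ x)) (π (τ y))|) (fun _ _ => 1) (by simp)
    (e := cellEnergy w τ - cellEnergy w fun x => π (τ x))
    (by simp only [sq_abs]; exact (sum_cellDens_sub_sq w τ π).le)
  simp only [mul_one] at h1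
  exact (le_abs_self _).trans h1

end Partitions

section GreedyCells

/-- Cells of the `k`-th greedy partition. -/
abbrev Cell (k : ℕ) : Type := Fin k → Bool × Bool

/-- The coarser cell containing a given cell. -/
def Cell.trunc {k l : ℕ} (h : k ≤ l) (c : Cell l) : Cell k := fun i => c (Fin.castLE h i)

variable {α : Type*} [Fintype α]

theorem exists_max_cut (M : α → α → ℝ) : ∃ S : Finset α × Finset α, ∀ S' : Finset α × Finset α,
    |∑ x ∈ S'.1, ∑ y ∈ S'.2, M x y| ≤ |∑ x ∈ S.1, ∑ y ∈ S.2, M x y| := by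
  classical
  exact Finite.exists_max fun S : Finset α × Finset α => |∑ x ∈ S.1, ∑ y ∈ S.2, M x y|

open Classical in
/-- The greedy refining sequence of partitions of the vertex set of a weighted graph. -/
noncomputable def greedyCell (w : α → α → ℝ) : (k : ℕ) → α → Cell k
  | 0 => fun _ => Fin.elim0
  | k + 1 => fun x =>
    let S := (exists_max_cut fun x y =>
      w x y - cellDens w (greedyCell w k) (greedyCell w k x) (greedyCell w k y)).choose
    Fin.snoc (greedyCell w k x) (decide (x ∈ S.1), decide (x ∈ S.2))

theorem trunc_greedyCell (w : α → α → ℝ) {k l : ℕ} (h : k ≤ l) (x : α) :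
    (greedyCell w l x).trunc h = greedyCell w k x := by
  induction l, h using Nat.le_induction with
  | base => rfl
  | succ l h ih =>
    rw [← ih]
    funext i
    simp only [Cell.trunc, greedyCell]
    rw [show Fin.castLE (Nat.le_succ_of_le h) i = (Fin.castLE h i).castSucc from rfl,
      Fin.snoc_castSucc]

theorem cutLe_greedyCell (w : α → α → ℝ) (k : ℕ) :
    CutLe (fun x y => w x y - cellDens w (greedyCell w k) (greedyCell w k x) (greedyCell w k y))
      √(cellEnergy w (greedyCell w (k + 1)) - cellEnergy w (greedyCell w k)) := by
  classical
  set τ := greedyCell w k with hτ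
  set τ' := greedyCell w (k + 1) with hτ'
  set S := (exists_max_cut fun x y => w x y - cellDens w τ (τ x) (τ y)).choose with hS
  have hmax := (exists_max_cut fun x y => w x y - cellDens w τ (τ x) (τ y)).choose_spec
  have htr : (fun x => (τ' x).trunc k.le_succ) = τ := funext fun x => trunc_greedyCell w _ x
  have hlast : ∀ x, τ' x (Fin.last k) = (decide (x ∈ S.1), decide (x ∈ S.2)) := by
    intro x
    rw [hτ']
    simp only [greedyCell, Fin.snoc_last]
    rfl
  have hsq := sum_cellDens_sub_sq w τ' (Cell.trunc k.le_succ)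
  have htr' : ∀ x, (τ' x).trunc k.le_succ = τ x := fun x => congrFun htr x
  rw [htr] at hsq
  simp only [htr'] at hsq
  refine cutLe_of_finset fun A B => (hmax (A, B)).trans ?_
  set f : Cell (k + 1) → Cell (k + 1) → ℝ := fun c c' =>
    if (c (Fin.last k)).1 = true ∧ (c' (Fin.last k)).2 = true then 1 else 0 with hf
  have h1 := sum_cellDens_mul w τ' f
  have hfS : ∀ x y, f (τ' x) (τ' y) = if x ∈ S.1 ∧ y ∈ S.2 then 1 else 0 := by
    intro x y
    simp only [hf, hlast, decide_eq_true_eq]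
  have h2 : ∀ M : α → α → ℝ, ∑ x ∈ S.1, ∑ y ∈ S.2, M x y = ∑ x, ∑ y, M x y * f (τ' x) (τ' y) := by
    intro M
    have h3 : ∀ x, ∑ y, M x y * f (τ' x) (τ' y) = if x ∈ S.1 then ∑ y ∈ S.2, M x y else 0 := by
      intro x
      simp only [hfS, mul_ite, mul_one, mul_zero]
      split_ifs with hx <;> simp [hx, sum_ite_mem]
    simp only [h3, sum_ite_mem, univ_inter]
  change |∑ x ∈ S.1, ∑ y ∈ S.2, _| ≤ _
  rw [h2]
  have h3 : ∑ x, ∑ y, (w x y - cellDens w τ (τ x) (τ y)) * f (τ' x) (τ' y)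
      = ∑ x, ∑ y, (cellDens w τ' (τ' x) (τ' y) - cellDens w τ (τ x) (τ y)) * f (τ' x) (τ' y) := by
    simp only [sub_mul, sum_sub_distrib]
    rw [h1]
  rw [h3]
  exact abs_sum_mul_le_sqrt _ _ (fun x y => by rw [hfS]; split_ifs <;> simp) hsq.le

end GreedyCells

section Rounding

variable {α ι : Type*} [DecidableEq α] {m : ℕ}

theorem exists_disjoint_extension (S : Finset α) (q : Fin m → ℕ) (hsum : ∑ i, q i ≤ S.card)
    (A : Fin m → Finset α) (hAS : ∀ i, A i ⊆ S) (hA : Pairwise fun i j => Disjoint (A i) (A j))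
    (hAq : ∀ i, (A i).card ≤ q i) :
    ∃ U : Fin m → Finset α, (∀ i, A i ⊆ U i) ∧ (∀ i, U i ⊆ S) ∧
      (Pairwise fun i j => Disjoint (U i) (U j)) ∧ ∀ i, (U i).card = q i := by
  induction hn : ∑ i, (q i - (A i).card) using Nat.strong_induction_on generalizing A with
  | _ n ih =>
    by_cases hall : ∀ i, (A i).card = q i
    · exact ⟨A, fun _ => Subset.rfl, hAS, hA, hall⟩
    push Not at hall
    obtain ⟨i, hi⟩ := hall
    have hi' : (A i).card < q i := lt_of_le_of_ne (hAq i) hi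
    have hlt : (univ.biUnion A).card < S.card := by
      rw [card_biUnion fun i _ j _ hij => hA hij]
      exact (sum_lt_sum (fun i _ => hAq i) ⟨i, mem_univ i, hi'⟩).trans_le hsum
    obtain ⟨x, hxS, hxA⟩ := exists_mem_notMem_of_card_lt_card hlt
    have hx : ∀ j, x ∉ A j := fun j hj => hxA (mem_biUnion.2 ⟨j, mem_univ j, hj⟩)
    have hcard : ∀ j, (Function.update A i (insert x (A i)) j).card
        = (A j).card + if j = i then 1 else 0 := by
      intro j
      by_cases hj : j = i
      · subst hj; simp [hx]
      · simp [hj]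
    obtain ⟨U, h1, h2, h3, h4⟩ := ih (∑ j, (q j - (Function.update A i (insert x (A i)) j).card))
      (by
        rw [← hn]
        refine sum_lt_sum (fun j _ => ?_) ⟨i, mem_univ i, ?_⟩
        · rw [hcard]; lia
        · rw [hcard, if_pos rfl]; lia)
      (Function.update A i (insert x (A i)))
      (fun j => by
        by_cases hj : j = i
        · subst hj
          simpa using insert_subset hxS (hAS j)
        · simpa [hj] using hAS j)
      (fun j k hjk => by
        by_cases hj : j = i
        · subst hj
          simpa [hjk.symm, hx] using hA hjk
        · by_cases hk : k = i
          · subst hk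
            simpa [hj, hx] using hA hjk
          · simpa [hj, hk] using hA hjk)
      (fun j => by
        rw [hcard]
        by_cases hj : j = i
        · subst hj; simpa using hi'
        · simpa [hj] using hAq j) rfl
    refine ⟨U, fun j => ?_, h2, h3, h4⟩
    by_cases hj : j = i
    · subst hj
      have := h1 j
      rw [Function.update_self] at this
      exact (subset_insert _ _).trans this
    · have := h1 j
      rwa [Function.update_of_ne hj] at this

theorem exists_disjoint_rounding [Fintype α] [Fintype ι] [DecidableEq ι] (τ : α → ι)
    {θ : Fin m → ι → ℝ} (hθ : ∀ i c, 0 ≤ θ i c) (hθ1 : ∀ c, ∑ i, θ i c ≤ 1) {q : ℕ}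
    (hq : m * q ≤ Fintype.card α) :
    ∃ U : Fin m → Finset α, (Pairwise fun i j => Disjoint (U i) (U j)) ∧
      (∀ i, (U i).card = q) ∧ ∀ i c,
        |(((U i).filter fun x => τ x = c).card : ℝ)
            - θ i c * ((univ.filter fun x => τ x = c).card : ℝ)|
          ≤ |∑ c, θ i c * ((univ.filter fun x => τ x = c).card : ℝ) - q|
            + (Fintype.card ι + 1) := by
  set N : ι → ℕ := fun c => (univ.filter fun x => τ x = c).card with hN
  set f : Fin m → ι → ℕ := fun i c => ⌊θ i c * N c⌋₊ with hf
  have hfle : ∀ i c, (f i c : ℝ) ≤ θ i c * N c := fun i c =>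
    Nat.floor_le (mul_nonneg (hθ i c) (Nat.cast_nonneg _))
  have hfge : ∀ i c, θ i c * N c ≤ f i c + 1 := fun i c => (Nat.lt_floor_add_one _).le
  have hsumf : ∀ c, ∑ i, f i c ≤ N c := by
    intro c
    have h1 : ((∑ i, f i c : ℕ) : ℝ) ≤ N c := by
      push_cast
      refine (sum_le_sum fun i _ => hfle i c).trans ?_
      rw [← sum_mul]
      exact mul_le_of_le_one_left (Nat.cast_nonneg _) (hθ1 c)
    exact_mod_cast h1
  have hB := fun c => exists_disjoint_extension (univ.filter fun x => τ x = c) (fun i => f i c)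
    (hsumf c) (fun _ => ∅) (fun _ => empty_subset _) (fun _ _ _ => disjoint_empty_left _)
    (fun _ => Nat.zero_le _)
  choose B _ hBS hBd hBc using hB
  have hBτ : ∀ {c i x}, x ∈ B c i → τ x = c := fun h => (mem_filter.1 (hBS _ _ h)).2
  set A : Fin m → Finset α := fun i => univ.biUnion fun c => B c i with hA
  have hAc : ∀ i c, ((A i).filter fun x => τ x = c) = B c i := by
    intro i c
    ext x
    simp only [hA, mem_filter, mem_biUnion, mem_univ, true_and]
    constructor
    · rintro ⟨⟨c', hx⟩, hc⟩
      rwa [← hc, hBτ hx]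
    · exact fun hx => ⟨⟨c, hx⟩, hBτ hx⟩
  have hAd : Pairwise fun i j => Disjoint (A i) (A j) := by
    intro i j hij
    rw [disjoint_left]
    intro x hxi hxj
    obtain ⟨c, -, hc⟩ := mem_biUnion.1 hxi
    obtain ⟨c', -, hc'⟩ := mem_biUnion.1 hxj
    obtain rfl : c = c' := (hBτ hc).symm.trans (hBτ hc')
    exact disjoint_left.1 (hBd c hij) hc hc'
  have hAcard : ∀ i, (A i).card = ∑ c, f i c := by
    intro i
    rw [card_eq_sum_card_fiberwise (f := τ) (t := univ) (fun _ _ => mem_univ _)]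
    exact sum_congr rfl fun c _ => by rw [hAc, hBc]
  have htrim := fun i => exists_subset_card_eq (min_le_left (A i).card q)
  choose A' hA'A hA'c using htrim
  obtain ⟨U, hA'U, -, hUd, hUc⟩ := exists_disjoint_extension (univ : Finset α) (fun _ => q)
    (by simpa using hq) A' (fun _ => subset_univ _)
    (fun i j hij => (hAd hij).mono (hA'A i) (hA'A j)) (fun i => by rw [hA'c]; exact min_le_right _ _)
  refine ⟨U, hUd, hUc, fun i c => ?_⟩
  have h1 : (((A i).filter fun x => τ x = c).card) = f i c := by rw [hAc, hBc]
  have h2 : ((A' i).filter fun x => τ x = c).card ≤ ((A i).filter fun x => τ x = c).card :=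
    card_le_card (filter_subset_filter _ (hA'A i))
  have h3 : ((A' i).filter fun x => τ x = c).card ≤ ((U i).filter fun x => τ x = c).card :=
    card_le_card (filter_subset_filter _ (hA'U i))
  have h4 : ∀ D : Finset α, A' i ⊆ D → (D.filter fun x => τ x = c).card
      ≤ ((A' i).filter fun x => τ x = c).card + (D.card - (A' i).card) := by
    intro D hD
    rw [← card_sdiff_of_subset hD]
    refine (card_le_card fun x hx => ?_).trans (card_union_le _ _)
    rw [mem_filter] at hx
    by_cases hx' : x ∈ A' i
    · exact mem_union_left _ (mem_filter.2 ⟨hx', hx.2⟩)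
    · exact mem_union_right _ (mem_sdiff.2 ⟨hx.1, hx'⟩)
  have h5 := h4 _ (hA'A i)
  have h6 := h4 _ (hA'U i)
  rw [hUc, hA'c] at h6
  rw [hA'c, h1] at h5
  rw [h1] at h2
  have h7 : |(((U i).filter fun x => τ x = c).card : ℝ) - f i c| ≤ |((A i).card : ℝ) - q| := by
    rcases le_total (A i).card q with h | h
    · rw [min_eq_left h] at h5 h6
      rw [abs_of_nonpos (sub_nonpos.2 (by exact_mod_cast h : ((A i).card : ℝ) ≤ q)), abs_le]
      have e1 : (((U i).filter fun x => τ x = c).card) + (A i).card ≤ f i c + q := by lia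
      have e2 : f i c ≤ ((U i).filter fun x => τ x = c).card := by lia
      have e1' : ((((U i).filter fun x => τ x = c).card : ℝ)) + (A i).card ≤ f i c + q := by
        exact_mod_cast e1
      have e2' : (f i c : ℝ) ≤ ((U i).filter fun x => τ x = c).card := by exact_mod_cast e2
      have e3 : ((A i).card : ℝ) ≤ q := by exact_mod_cast h
      constructor <;> linarith
    · rw [min_eq_right h] at h5 h6
      rw [abs_of_nonneg (sub_nonneg.2 (by exact_mod_cast h : (q : ℝ) ≤ (A i).card)), abs_le]
      have e1 : f i c + q ≤ (((U i).filter fun x => τ x = c).card) + (A i).card := by lia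
      have e2 : ((U i).filter fun x => τ x = c).card ≤ f i c := by lia
      have e1' : (f i c : ℝ) + q ≤ ((((U i).filter fun x => τ x = c).card : ℝ)) + (A i).card := by
        exact_mod_cast e1
      have e2' : (((U i).filter fun x => τ x = c).card : ℝ) ≤ f i c := by exact_mod_cast e2
      have e3 : (q : ℝ) ≤ (A i).card := by exact_mod_cast h
      constructor <;> linarith
  have h8 : |((A i).card : ℝ) - ∑ c, θ i c * N c| ≤ Fintype.card ι := by
    rw [hAcard]
    push_cast
    rw [← sum_sub_distrib]
    refine (abs_sum_le_sum_abs _ _).trans ?_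
    refine (sum_le_sum fun c _ => (?_ : _ ≤ (1 : ℝ))).trans (by simp)
    rw [abs_le]
    constructor <;> linarith [hfle i c, hfge i c]
  have h9 : |(f i c : ℝ) - θ i c * N c| ≤ 1 := by
    rw [abs_le]
    constructor <;> linarith [hfle i c, hfge i c]
  have h10 := abs_sub_le (((U i).filter fun x => τ x = c).card : ℝ) (f i c) (θ i c * N c)
  have h11 := abs_sub_le ((A i).card : ℝ) (∑ c, θ i c * N c) q
  linarith

end Rounding

section CellLimits

/-- A limit object recorded on the binary cells: masses and densities for every level, such that
the densities form an approximate martingale, the symmetrized count of `F` is approximately constant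
on all balanced fractional partitions, and the densities stay away from the constant `p`. -/
structure CellLimit {m : ℕ} (F : SimpleGraph (Fin m)) (p : ℝ) where
  mass : ∀ k, Cell k → ℝ
  dens : ∀ k, Cell k → Cell k → ℝ
  err : ℕ → ℝ
  gap : ℝ
  mass_nonneg : ∀ k c, 0 ≤ mass k c
  sum_mass : ∀ k, ∑ c, mass k c = 1
  mass_trunc : ∀ {k l : ℕ} (h : k ≤ l) (c : Cell k),
    mass k c = ∑ c' with Cell.trunc h c' = c, mass l c'
  dens_mem : ∀ k c c', dens k c c' ∈ Set.Icc (0 : ℝ) 1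
  dens_comm : ∀ k c c', dens k c c' = dens k c' c
  err_nonneg : ∀ k, 0 ≤ err k
  tendsto_err : Tendsto err atTop (nhds 0)
  dens_trunc : ∀ {k l : ℕ} (h : k ≤ l),
    ∑ c, ∑ c', mass l c * mass l c' * |dens l c c' - dens k (c.trunc h) (c'.trunc h)| ≤ err k
  count : ∀ k (θ : Fin m → Cell k → ℝ), (∀ i c, 0 ≤ θ i c) → (∀ c, ∑ i, θ i c = 1) →
    (∀ i, ∑ c, θ i c * mass k c = 1 / m) →
    |∑ c : Fin m → Cell k, symEdgeProd F (dens k) c * ∏ i, θ i (c i) * mass k (c i)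
      - p ^ numEdges F * (1 / m) ^ m| ≤ numEdges F * err k
  gap_pos : 0 < gap
  gap_le : ∀ k, gap ≤ err k + ∑ c, ∑ c', mass k c * mass k c' * |dens k c c' - p|

theorem exists_tendsto_of_mem_Icc {ι : Type*} (l : Ultrafilter ι) (f : ι → ℝ)
    (hf : ∀ n, f n ∈ Set.Icc (0 : ℝ) 1) :
    ∃ a ∈ Set.Icc (0 : ℝ) 1, Tendsto f l (nhds a) := by
  obtain ⟨a, ha, hl⟩ := isCompact_Icc.ultrafilter_le_nhds' (l.map f)
    (Ultrafilter.mem_map.2 (univ_mem' hf))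
  exact ⟨a, ha, hl⟩

/-- The proportion of vertices with a given type. -/
noncomputable def cellMass {α ι : Type*} [Fintype α] [DecidableEq ι] (τ : α → ι) (c : ι) : ℝ :=
  ((univ.filter fun x => τ x = c).card : ℝ) / Fintype.card α

section Mass

variable {α ι : Type*} [Fintype α] [Fintype ι] [DecidableEq ι]

omit [Fintype ι] in
theorem cellMass_mem_Icc (τ : α → ι) (c : ι) : cellMass τ c ∈ Set.Icc (0 : ℝ) 1 :=
  ⟨by unfold cellMass; positivity,
    div_le_one_of_le₀ (by exact_mod_cast card_le_univ _) (by positivity)⟩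

theorem sum_cellMass [Nonempty α] (τ : α → ι) : ∑ c, cellMass τ c = 1 := by
  have h : ∑ c, (univ.filter fun x => τ x = c).card = Fintype.card α := by
    rw [← card_univ, card_eq_sum_card_fiberwise (f := τ) (t := univ) (by simp)]
  have h0 : (Fintype.card α : ℝ) ≠ 0 := by simp
  simp only [cellMass]
  rw [← sum_div, div_eq_one_iff_eq h0]
  exact_mod_cast h

omit [Fintype ι] in
theorem cellMass_comp {κ : Type*} [Fintype ι] [DecidableEq κ] (τ : α → ι) (π : ι → κ) (c : κ) :
    cellMass (fun x => π (τ x)) c = ∑ c' with π c' = c, cellMass τ c' := by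
  simp only [cellMass]
  rw [← sum_div]
  congr 1
  rw [card_eq_sum_card_fiberwise (f := τ) (t := univ.filter fun c' => π c' = c)]
  · push_cast
    refine sum_congr rfl fun c' hc' => ?_
    rw [mem_filter] at hc'
    congr 2
    ext x
    simp only [mem_filter, mem_univ, true_and]
    exact ⟨fun h => h.2, fun h => ⟨by rw [h, hc'.2], h⟩⟩
  · intro x hx
    simpa using hx

theorem sum_sum_comp_eq_cellMass [Nonempty α] (τ : α → ι) (g : ι → ι → ℝ) :
    (∑ x, ∑ y, g (τ x) (τ y)) = (∑ c, ∑ c', cellMass τ c * cellMass τ c' * g c c')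
      * (Fintype.card α : ℝ) ^ 2 := by
  have h0 : (Fintype.card α : ℝ) ≠ 0 := by simp
  rw [sum_sum_comp, sum_mul]
  refine sum_congr rfl fun c _ => ?_
  rw [sum_mul]
  refine sum_congr rfl fun c' _ => ?_
  simp only [cellMass]
  field_simp

end Mass

/-- Approximate counting identities on a cell level, for a weighted graph. -/
theorem abs_sum_cell_sub_le {m : ℕ} (F : SimpleGraph (Fin m)) {α ι : Type*} [Fintype α] [Nonempty α]
    [Fintype ι] [DecidableEq ι] [DecidableEq α] {w : α → α → ℝ}
    (hw : ∀ x y, w x y ∈ Set.Icc (0 : ℝ) 1) (τ : α → ι) {γ : ℝ}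
    (hc : CutLe (fun x y => w x y - cellDens w τ (τ x) (τ y)) γ) (U : Fin m → Finset α) :
    |(∑ x : Fin m → α, symEdgeProd F w x * ∏ i, if x i ∈ U i then (1 : ℝ) else 0)
          / (Fintype.card α : ℝ) ^ m
        - ∑ t : Fin m → ι, symEdgeProd F (cellDens w τ) t
          * ∏ i, (((U i).filter fun x => τ x = t i).card : ℝ) / Fintype.card α|
      ≤ numEdges F * γ := by
  have h0 : (0 : ℝ) < Fintype.card α := by exact_mod_cast Fintype.card_pos
  have h1 := abs_sum_symEdgeProd_sub_le F hw
    (w' := fun x y => cellDens w τ (τ x) (τ y)) (fun _ _ => cellDens_mem_Icc hw τ _ _) hc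
    (fun i a => if a ∈ U i then (1 : ℝ) else 0) (fun i a => by split_ifs <;> simp)
  have h2 := sum_comp_mul_prod τ (symEdgeProd F (cellDens w τ))
    (fun i a => if a ∈ U i then (1 : ℝ) else 0)
  have h3 : ∀ x, symEdgeProd F (fun x y => cellDens w τ (τ x) (τ y)) x
      = symEdgeProd F (cellDens w τ) (fun i => τ (x i)) := fun x => rfl
  simp only [h3] at h1
  rw [h2] at h1
  have h4 : ∀ t : Fin m → ι, ∏ i, (∑ a with τ a = t i, if a ∈ U i then (1 : ℝ) else 0)
      = (∏ i, (((U i).filter fun x => τ x = t i).card : ℝ) / Fintype.card α)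
        * (Fintype.card α : ℝ) ^ m := by
    intro t
    rw [prod_div_distrib, prod_const, card_univ, Fintype.card_fin, div_mul_cancel₀ _ (by positivity)]
    refine prod_congr rfl fun i _ => ?_
    rw [← sum_filter, sum_const, nsmul_eq_mul, mul_one]
    congr 2
    ext x
    simp [and_comm]
  simp only [h4, ← mul_assoc] at h1
  rw [← sum_mul] at h1
  rw [← mul_le_mul_iff_left₀ (pow_pos h0 m)]
  refine le_trans (le_of_eq ?_) h1
  rw [← abs_of_pos (pow_pos h0 m), ← abs_mul, sub_mul, abs_of_pos (pow_pos h0 m),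
    div_mul_cancel₀ _ (by positivity)]


theorem cellEnergy_greedyCell_mono {α : Type*} [Fintype α] (w : α → α → ℝ) {k l : ℕ} (h : k ≤ l) :
    cellEnergy w (greedyCell w k) ≤ cellEnergy w (greedyCell w l) := by
  have := cellEnergy_comp_le w (greedyCell w l) (Cell.trunc h)
  simpa only [trunc_greedyCell] using this

theorem exists_cellLimit {m : ℕ} (F : SimpleGraph (Fin m)) {p : ℝ} {V : ℕ → ℕ}
    (hV : Tendsto V atTop atTop) {w : ∀ n, Fin (V n) → Fin (V n) → ℝ}
    (hsym : ∀ n x y, w n x y = w n y x) (hw : ∀ n x y, w n x y ∈ Set.Icc (0 : ℝ) 1)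
    {ε : ℕ → ℝ} (hε : Tendsto ε atTop (nhds 0))
    (hcount : ∀ n, ∀ U : Fin m → Finset (Fin (V n)), (Pairwise fun i j => Disjoint (U i) (U j)) →
      (∀ i, (U i).card = ⌊1 / (m : ℝ) * (V n : ℝ)⌋₊) →
      |∑ x : Fin m → Fin (V n), symEdgeProd F (w n) x * ∏ i, (if x i ∈ U i then (1 : ℝ) else 0)
        - p ^ numEdges F * ∏ i, ((U i).card : ℝ)| ≤ ε n * (V n : ℝ) ^ m)
    {c : ℝ} (hc : 0 < c) (hbad : ∃ᶠ n in atTop, ¬ CutLe (fun x y => w n x y - p) c) :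
    Nonempty (CellLimit F p) := by
  classical
  have hne : (atTop ⊓ 𝓟 {n | ¬ CutLe (fun x y => w n x y - p) c}).NeBot :=
    frequently_iff_neBot.1 hbad
  let 𝒰 : Ultrafilter ℕ := Ultrafilter.of (atTop ⊓ 𝓟 {n | ¬ CutLe (fun x y => w n x y - p) c})
  have h𝒰 : (𝒰 : Filter ℕ) ≤ atTop := (Ultrafilter.of_le _).trans inf_le_left
  have hbad' : ∀ᶠ n in (𝒰 : Filter ℕ), ¬ CutLe (fun x y => w n x y - p) c :=
    le_principal_iff.1 ((Ultrafilter.of_le _).trans inf_le_right)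
  have hpos : ∀ᶠ n in (𝒰 : Filter ℕ), 0 < V n := h𝒰 (hV.eventually_gt_atTop 0)
  have hVr : Tendsto (fun n => (V n : ℝ)) 𝒰 atTop :=
    (tendsto_natCast_atTop_atTop.comp hV).mono_left h𝒰
  let τ : ∀ k n, Fin (V n) → Cell k := fun k n => greedyCell (w n) k
  have hτ : ∀ {k l : ℕ} (h : k ≤ l) (n : ℕ), (fun x => (τ l n x).trunc h) = τ k n :=
    fun h n => funext fun x => trunc_greedyCell _ h x
  choose mass hmass01 hmass using fun k (c : Cell k) =>
    exists_tendsto_of_mem_Icc 𝒰 (fun n => cellMass (τ k n) c) fun n => cellMass_mem_Icc _ _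
  choose dens hdens01 hdens using fun k (c c' : Cell k) =>
    exists_tendsto_of_mem_Icc 𝒰 (fun n => cellDens (w n) (τ k n) c c')
      fun n => cellDens_mem_Icc (hw n) _ _ _
  choose en hen01 hen using fun k =>
    exists_tendsto_of_mem_Icc 𝒰 (fun n => cellEnergy (w n) (τ k n))
      fun n => cellEnergy_mem_Icc (hw n) _
  have hmono : Monotone en := fun k l h =>
    le_of_tendsto_of_tendsto' (hen k) (hen l) fun n => cellEnergy_greedyCell_mono _ h
  have hbdd : BddAbove (Set.range en) := ⟨1, by rintro _ ⟨k, rfl⟩; exact (hen01 k).2⟩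
  have hE : Tendsto en atTop (nhds (⨆ k, en k)) := tendsto_atTop_ciSup hmono hbdd
  have hle : ∀ k, en k ≤ ⨆ k, en k := fun k => le_ciSup hbdd k
  have hγ : ∀ k l, Tendsto (fun n => √(cellEnergy (w n) (τ l n) - cellEnergy (w n) (τ k n))) 𝒰
      (nhds √(en l - en k)) := fun k l => ((hen l).sub (hen k)).sqrt
  refine ⟨⟨mass, dens, fun k => √((⨆ k, en k) - en k), c, fun k c => (hmass01 k c).1, fun k => ?_,
    fun {k l} h c => ?_, hdens01, fun k c c' => ?_, fun k => Real.sqrt_nonneg _, ?_,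
    fun {k l} h => ?_, fun k θ hθ hθ1 hθm => ?_, hc, fun k => ?_⟩⟩
  · refine tendsto_nhds_unique (tendsto_finsetSum _ fun c _ => hmass k c) ?_
    refine tendsto_const_nhds.congr' ?_
    filter_upwards [hpos] with n hn
    have : Nonempty (Fin (V n)) := ⟨⟨0, hn⟩⟩
    exact (sum_cellMass _).symm
  · refine tendsto_nhds_unique (hmass k c) ?_
    refine (tendsto_finsetSum _ fun c' _ => hmass l c').congr fun n => ?_
    rw [← hτ h n]
    exact (cellMass_comp (τ l n) (Cell.trunc h) c).symm
  · refine tendsto_nhds_unique (hdens k c c') ?_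
    exact (hdens k c' c).congr fun n => cellDens_comm (hsym n) _ _ _
  · have := ((tendsto_const_nhds (x := ⨆ k, en k)).sub hE).sqrt
    simpa using this
  · refine le_trans ?_ (Real.sqrt_le_sqrt (sub_le_sub_right (hle l) _))
    refine le_of_tendsto_of_tendsto (tendsto_finsetSum _ fun c _ => tendsto_finsetSum _ fun c' _ =>
      ((hmass l c).mul (hmass l c')).mul
        ((hdens l c c').sub (hdens k (c.trunc h) (c'.trunc h))).abs) (hγ k l) ?_
    filter_upwards [hpos] with n hn
    have : Nonempty (Fin (V n)) := ⟨⟨0, hn⟩⟩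
    have h1 := sum_abs_cellDens_sub_le (w n) (τ l n) (Cell.trunc h)
    rw [hτ h n, sum_sum_comp_eq_cellMass (τ l n) fun c c' =>
      |cellDens (w n) (τ l n) c c' - cellDens (w n) (τ k n) (c.trunc h) (c'.trunc h)|] at h1
    exact le_of_mul_le_mul_right h1 (by simp; positivity)
  · refine le_trans ?_ (mul_le_mul_of_nonneg_left
      (Real.sqrt_le_sqrt (sub_le_sub_right (hle (k + 1)) _)) (Nat.cast_nonneg _))
    have hq : ∀ n, m * ⌊1 / (m : ℝ) * (V n : ℝ)⌋₊ ≤ Fintype.card (Fin (V n)) := by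
      intro n
      rw [Fintype.card_fin]
      rcases Nat.eq_zero_or_pos m with rfl | hm
      · simp
      · have h1 : (⌊1 / (m : ℝ) * (V n : ℝ)⌋₊ : ℝ) ≤ 1 / (m : ℝ) * (V n : ℝ) :=
          Nat.floor_le (by positivity)
        have h2 : (m : ℝ) * (⌊1 / (m : ℝ) * (V n : ℝ)⌋₊ : ℝ) ≤ (V n : ℝ) := by
          refine (mul_le_mul_of_nonneg_left h1 (by positivity)).trans (le_of_eq ?_)
          field_simp
        exact_mod_cast h2
    choose U hUd hUq hU using fun n =>
      exists_disjoint_rounding (τ k n) hθ (fun c => (hθ1 c).le) (hq n)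
    have hqlim : Tendsto (fun n => (⌊1 / (m : ℝ) * (V n : ℝ)⌋₊ : ℝ) / (V n : ℝ)) 𝒰
        (nhds (1 / (m : ℝ))) :=
      (tendsto_nat_floor_mul_div_atTop (a := 1 / (m : ℝ)) (by positivity)).comp hVr
    have hUlim : ∀ i c, Tendsto (fun n => (((U n i).filter fun x => τ k n x = c).card : ℝ)
        / Fintype.card (Fin (V n))) 𝒰 (nhds (θ i c * mass k c)) := by
      intro i c
      have h1 : Tendsto (fun n => |∑ c, θ i c * cellMass (τ k n) c
          - (⌊1 / (m : ℝ) * (V n : ℝ)⌋₊ : ℝ) / (V n : ℝ)|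
            + (Fintype.card (Cell k) + 1) / (V n : ℝ)) 𝒰 (nhds (|1 / (m : ℝ) - 1 / m| + 0)) := by
        refine Tendsto.add (Tendsto.abs (Tendsto.sub ?_ hqlim)) (hVr.const_div_atTop _)
        rw [← hθm i]
        exact tendsto_finsetSum _ fun c _ => (hmass k c).const_mul _
      rw [sub_self, abs_zero, add_zero] at h1
      have h2 := squeeze_zero_norm' (a := fun n => |∑ c, θ i c * cellMass (τ k n) c
          - (⌊1 / (m : ℝ) * (V n : ℝ)⌋₊ : ℝ) / (V n : ℝ)|
            + (Fintype.card (Cell k) + 1) / (V n : ℝ))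
        (f := fun n => (((U n i).filter fun x => τ k n x = c).card : ℝ)
          / Fintype.card (Fin (V n)) - θ i c * cellMass (τ k n) c) ?_ h1
      · simpa using h2.add ((hmass k c).const_mul (θ i c))
      · filter_upwards [hpos] with n hn
        have hn' : (0 : ℝ) < V n := by exact_mod_cast hn
        have h3 := hU n i c
        rw [← div_le_div_iff_of_pos_right hn'] at h3
        have e1 : (((U n i).filter fun x => τ k n x = c).card : ℝ)
            / Fintype.card (Fin (V n)) - θ i c * cellMass (τ k n) c
            = ((((U n i).filter fun x => τ k n x = c).card : ℝ)
              - θ i c * ((univ.filter fun x => τ k n x = c).card : ℝ)) / V n := by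
          rw [cellMass, Fintype.card_fin]
          ring
        have e2 : ∑ c, θ i c * cellMass (τ k n) c - (⌊1 / (m : ℝ) * (V n : ℝ)⌋₊ : ℝ) / (V n : ℝ)
            = (∑ c, θ i c * ((univ.filter fun x => τ k n x = c).card : ℝ)
              - (⌊1 / (m : ℝ) * (V n : ℝ)⌋₊ : ℝ)) / V n := by
          rw [sub_div, sum_div]
          congr 1
          exact sum_congr rfl fun c _ => by rw [cellMass, Fintype.card_fin]; ring
        rw [Real.norm_eq_abs, e1, e2, abs_div, abs_div, abs_of_pos hn', ← add_div]
        exact h3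
    have hP : Tendsto (fun n => (∑ x : Fin m → Fin (V n), symEdgeProd F (w n) x
        * ∏ i, (if x i ∈ U n i then (1 : ℝ) else 0)) / (Fintype.card (Fin (V n)) : ℝ) ^ m) 𝒰
        (nhds (p ^ numEdges F * (1 / m) ^ m)) := by
      have h2 := squeeze_zero_norm' (a := ε)
        (f := fun n => (∑ x : Fin m → Fin (V n), symEdgeProd F (w n) x
          * ∏ i, (if x i ∈ U n i then (1 : ℝ) else 0)) / (Fintype.card (Fin (V n)) : ℝ) ^ m
          - p ^ numEdges F * ((⌊1 / (m : ℝ) * (V n : ℝ)⌋₊ : ℝ) / (V n : ℝ)) ^ m) (t₀ := (𝒰 : Filter ℕ)) ?_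
          (hε.mono_left h𝒰)
      · simpa using h2.add ((hqlim.pow m).const_mul (p ^ numEdges F))
      · filter_upwards [hpos] with n hn
        have hn' : (0 : ℝ) < V n := by exact_mod_cast hn
        have h3 := hcount n (U n) (hUd n) (hUq n)
        simp only [hUq, prod_const, card_univ, Fintype.card_fin] at h3
        rw [← mul_le_mul_iff_left₀ (pow_pos hn' m), Real.norm_eq_abs]
        refine le_trans (le_of_eq ?_) h3
        rw [← abs_of_pos (pow_pos hn' m), ← abs_mul, Fintype.card_fin,
          sub_mul, div_mul_cancel₀ _ (by positivity), div_pow, mul_assoc,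
          div_mul_cancel₀ _ (by positivity)]
    refine le_of_tendsto_of_tendsto (((tendsto_finsetSum _ fun t _ => Tendsto.mul
      (?_ : Tendsto (fun n => symEdgeProd F (cellDens (w n) (τ k n)) t) 𝒰 _)
      (tendsto_finsetProd _ fun i _ => hUlim i (t i))).sub hP).abs)
      ((hγ k (k + 1)).const_mul (numEdges F : ℝ)) ?_
    · simp only [symEdgeProd, edgeProd]
      exact (tendsto_finsetSum _ fun σ _ => tendsto_finsetProd _ fun e _ =>
        hdens k _ _).const_mul _
    · filter_upwards [hpos] with n hn
      have : Nonempty (Fin (V n)) := ⟨⟨0, hn⟩⟩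
      rw [abs_sub_comm]
      exact abs_sum_cell_sub_le F (hw n) (τ k n) (cutLe_greedyCell (w n) k) (U n)
  · refine le_trans ?_ (add_le_add_left (Real.sqrt_le_sqrt (sub_le_sub_right (hle (k + 1)) _)) _)
    refine le_of_tendsto_of_tendsto tendsto_const_nhds ((hγ k (k + 1)).add
      (tendsto_finsetSum _ fun c _ => tendsto_finsetSum _ fun c' _ =>
      ((hmass k c).mul (hmass k c')).mul ((hdens k c c').sub_const p).abs)) ?_
    filter_upwards [hpos, hbad'] with n hn hb
    have : Nonempty (Fin (V n)) := ⟨⟨0, hn⟩⟩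
    by_contra! hlt
    refine hb fun g h hg hh => ?_
    have h1 := cutLe_greedyCell (w n) k g h hg hh
    have h2 : |∑ x, ∑ y, (cellDens (w n) (τ k n) (τ k n x) (τ k n y) - p) * g x * h y|
        ≤ ∑ x, ∑ y, |cellDens (w n) (τ k n) (τ k n x) (τ k n y) - p| := by
      refine (abs_sum_le_sum_abs _ _).trans (sum_le_sum fun x _ =>
        (abs_sum_le_sum_abs _ _).trans (sum_le_sum fun y _ => ?_))
      rw [abs_mul, abs_mul, abs_of_nonneg (hg x).1, abs_of_nonneg (hh y).1, mul_assoc]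
      exact mul_le_of_le_one_right (abs_nonneg _) (mul_le_one₀ (hg x).2 (hh y).1 (hh y).2)
    rw [sum_sum_comp_eq_cellMass (τ k n) fun c c' => |cellDens (w n) (τ k n) c c' - p|] at h2
    have h3 : ∑ x, ∑ y, (w n x y - p) * g x * h y
        = ∑ x, ∑ y, (w n x y - cellDens (w n) (τ k n) (τ k n x) (τ k n y)) * g x * h y
          + ∑ x, ∑ y, (cellDens (w n) (τ k n) (τ k n x) (τ k n y) - p) * g x * h y := by
      simp only [← sum_add_distrib]
      exact sum_congr rfl fun x _ => sum_congr rfl fun y _ => by ring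
    rw [h3]
    refine (abs_add_le _ _).trans ((add_le_add h1 h2).trans ?_)
    rw [← add_mul]
    exact mul_le_mul_of_nonneg_right hlt.le (by positivity)

end CellLimits

section Marginals

variable {A J X : Type*} [Fintype A] [Fintype J] [Fintype X] [DecidableEq A] [DecidableEq J]

/-- Marginalization of a product measure along an injection of the index sets. -/
theorem sum_prod_mul_comp {e : A → J} (he : Function.Injective e) (q : J → X → ℝ)
    (hq : ∀ j, ∑ x, q j x = 1) (f : (A → X) → ℝ) :
    ∑ x : J → X, (∏ j, q j (x j)) * f (fun a => x (e a))
      = ∑ y : A → X, (∏ a, q (e a) (y a)) * f y := by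
  classical
  have key : ∀ y : A → X, ∑ x : J → X with (fun a => x (e a)) = y, ∏ j, q j (x j)
      = ∏ a, q (e a) (y a) := by
    intro y
    have h1 : (univ.filter fun x : J → X => (fun a => x (e a)) = y)
        = Fintype.piFinset fun j => univ.filter fun x => ∀ a, e a = j → x = y a := by
      ext x
      simp only [mem_filter, mem_univ, true_and, Fintype.mem_piFinset, funext_iff]
      exact ⟨fun h j a ha => ha ▸ h a, fun h a => h (e a) a rfl⟩
    rw [h1, ← prod_univ_sum]
    symm
    refine Fintype.prod_of_injective e he _ _ (fun j hj => ?_) fun a => ?_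
    · rw [filter_true_of_mem fun x _ a ha => (hj ⟨a, ha⟩).elim, hq]
    · have : (univ.filter fun x => ∀ a', e a' = e a → x = y a') = {y a} := by
        ext x
        simp only [mem_filter, mem_univ, true_and, mem_singleton]
        exact ⟨fun h => h a rfl, fun h a' ha' => by rw [he ha', h]⟩
      rw [this, sum_singleton]
  rw [← sum_fiberwise (s := univ) (g := fun (x : J → X) (a : A) => x (e a))]
  refine sum_congr rfl fun y _ => ?_
  rw [← key y, sum_mul]
  refine sum_congr rfl fun x hx => ?_
  rw [mem_filter] at hx
  rw [hx.2]

omit [Fintype A] [DecidableEq A] in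
theorem sum_prod_eq_one (q : J → X → ℝ) (hq : ∀ j, ∑ x, q j x = 1) :
    ∑ x : J → X, ∏ j, q j (x j) = 1 := by
  rw [← Fintype.prod_sum]
  simp [hq]

omit [Fintype A] [DecidableEq A] in
theorem sum_prod_mul_pair {i j : J} (hij : i ≠ j) (q : J → X → ℝ) (hq : ∀ j, ∑ x, q j x = 1)
    (g : X → X → ℝ) :
    ∑ x : J → X, (∏ l, q l (x l)) * g (x i) (x j) = ∑ a, ∑ b, q i a * q j b * g a b := by
  have h := sum_prod_mul_comp (e := ![i, j]) (by
    intro a b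
    fin_cases a <;> fin_cases b <;> simp [hij, hij.symm]) q hq fun y => g (y 0) (y 1)
  simp only [Matrix.cons_val_zero, Matrix.cons_val_one] at h
  rw [h, ← Fintype.sum_prod_type' (f := fun a b => q i a * q j b * g a b)]
  refine Fintype.sum_equiv (finTwoArrowEquiv X) _ _ fun y => ?_
  simp [Fin.prod_univ_two, finTwoArrowEquiv]

end Marginals

section SecondDifference

variable {m : ℕ} {X : Type*}

/-- The mixed second difference of a function of `m` variables in the variables `i` and `j`. -/
def secondDiff (S : (Fin m → X) → ℝ) (i j : Fin m) (x : Fin m ⊕ Bool → X) : ℝ :=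
  S (fun l => x (Sum.inl l)) - S (fun l => x (Function.update Sum.inl i (Sum.inr false) l))
    - S (fun l => x (Function.update Sum.inl j (Sum.inr true) l))
    + S (fun l => x (Function.update (Function.update Sum.inl i (Sum.inr false)) j (Sum.inr true) l))

/-- The multilinear form with coefficients `Γ`. -/
noncomputable def gammaMap [Fintype X] (Γ : (Fin m → X) → ℝ) :
    MultilinearMap ℝ (fun _ : Fin m => X → ℝ) ℝ :=
  ∑ c, Γ c • (MultilinearMap.mkPiAlgebra ℝ (Fin m) ℝ).compLinearMap fun i => LinearMap.proj (c i)

theorem gammaMap_apply [Fintype X] (Γ : (Fin m → X) → ℝ) (a : Fin m → X → ℝ) :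
    gammaMap Γ a = ∑ c, Γ c * ∏ i, a i (c i) := by
  simp [gammaMap]

variable [Fintype X] {Γ : (Fin m → X) → ℝ} {μ : X → ℝ} {K : ℝ}

theorem gammaMap_eq_of_balanced (hm : 0 < m) (hμ1 : ∑ c, μ c = 1)
    (h : ∀ θ : Fin m → X → ℝ, (∀ i c, 0 ≤ θ i c) → (∀ c, ∑ i, θ i c = 1) →
      (∀ i, ∑ c, θ i c * μ c = 1 / m) → ∑ c : Fin m → X, Γ c * ∏ i, θ i (c i) = K)
    (a : Fin m → X → ℝ) (ha : ∀ c, ∑ i, a i c = m) (ha1 : ∀ i, ∑ c, a i c * μ c = 1) :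
    gammaMap Γ a = m ^ m * K := by
  have hm' : (0 : ℝ) < m := by exact_mod_cast hm
  let P : Polynomial ℝ := ∑ c : Fin m → X, Polynomial.C (Γ c)
    * ∏ i, (1 + Polynomial.C (a i (c i) - 1) * Polynomial.X)
  have hP : ∀ t, P.eval t = ∑ c : Fin m → X, Γ c * ∏ i, (1 + (a i (c i) - 1) * t) := by
    intro t
    simp [P, Polynomial.eval_finsetSum, Polynomial.eval_prod]
  set M : ℝ := ∑ i, ∑ c, |a i c - 1| with hM
  have hM0 : 0 ≤ M := sum_nonneg fun i _ => sum_nonneg fun c _ => abs_nonneg _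
  have hMle : ∀ i c, |a i c - 1| ≤ M := fun i c =>
    (single_le_sum (f := fun c => |a i c - 1|) (fun c _ => abs_nonneg _) (mem_univ c)).trans
      (single_le_sum (f := fun i => ∑ c, |a i c - 1|)
        (fun i _ => sum_nonneg fun c _ => abs_nonneg _) (mem_univ i))
  have hPK : P = Polynomial.C (m ^ m * K) := by
    refine Polynomial.eq_of_infinite_eval_eq _ _
      ((Set.Icc_infinite (show (0 : ℝ) < 1 / (M + 1) by positivity)).mono ?_)
    intro t ht
    have key := h (fun i c => (1 + (a i c - 1) * t) / m) (fun i c => ?_) (fun c => ?_) fun i => ?_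
    · rw [Set.mem_ofPred_eq, hP, Polynomial.eval_C, ← key, mul_sum]
      refine sum_congr rfl fun c _ => ?_
      rw [prod_div_distrib, prod_const, card_univ, Fintype.card_fin]
      generalize ∏ l, (1 + (a l (c l) - 1) * t) = y
      field_simp
    · refine div_nonneg ?_ hm'.le
      have h1 : |(a i c - 1) * t| ≤ 1 := by
        rw [abs_mul, abs_of_nonneg ht.1]
        refine (mul_le_mul (hMle i c) ht.2 ht.1 hM0).trans ?_
        rw [mul_one_div, div_le_one (by positivity)]
        linarith
      linarith [neg_abs_le ((a i c - 1) * t)]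
    · rw [← sum_div, sum_add_distrib, ← sum_mul, sum_sub_distrib, ha]
      simp [hm'.ne']
    · have : ∀ c, (1 + (a i c - 1) * t) / m * μ c = (μ c + (a i c * μ c - μ c) * t) / m := by
        intro c; ring
      simp only [this]
      rw [← sum_div, sum_add_distrib, ← sum_mul, sum_sub_distrib, ha1, hμ1]
      simp
  have h1 := hP 1
  rw [hPK, Polynomial.eval_C] at h1
  rw [gammaMap_apply, h1]
  simp

theorem gammaMap_update_update_eq_zero (hm : 0 < m) (hμ1 : ∑ c, μ c = 1)
    (hperm : ∀ (σ : Equiv.Perm (Fin m)) c, Γ (fun i => c (σ i)) = Γ c)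
    (h : ∀ θ : Fin m → X → ℝ, (∀ i c, 0 ≤ θ i c) → (∀ c, ∑ i, θ i c = 1) →
      (∀ i, ∑ c, θ i c * μ c = 1 / m) → ∑ c : Fin m → X, Γ c * ∏ i, θ i (c i) = K)
    {r : Fin m → X → ℝ} (hr : ∀ i, ∑ c, r i c * μ c = 1) {i j : Fin m} (hij : i ≠ j)
    {φ ψ : X → ℝ} (hφ : ∑ c, φ c * μ c = 0) (hψ : ∑ c, ψ c * μ c = 0) :
    gammaMap Γ (Function.update (Function.update r i φ) j ψ) = 0 := by
  classical
  let B : (X → ℝ) → (X → ℝ) → ℝ := fun a b => gammaMap Γ (Function.update (Function.update r i a) j b)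
  have hBr : ∀ a b b', B a (b + b') = B a b + B a b' := fun a b b' =>
    (gammaMap Γ).map_update_add _ _ _ _
  have hsymm : ∀ a b, B a b = B b a := by
    intro a b
    simp only [B, gammaMap_apply]
    refine Fintype.sum_equiv (Equiv.arrowCongr (Equiv.swap i j) (Equiv.refl X)) _ _ fun c => ?_
    have e1 : (Equiv.arrowCongr (Equiv.swap i j) (Equiv.refl X)) c
        = fun l => c (Equiv.swap i j l) := by
      ext l
      simp [Equiv.arrowCongr]
    rw [e1, hperm]
    congr 1
    refine Fintype.prod_equiv (Equiv.swap i j) _ _ fun l => ?_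
    simp only [Equiv.swap_apply_self]
    by_cases hl : l = i
    · subst hl; simp [hij]
    by_cases hl' : l = j
    · subst hl'; simp [hij]
    rw [Equiv.swap_apply_of_ne_of_ne hl hl']
    simp [hl, hl']
  have hBl : ∀ a a' b, B (a + a') b = B a b + B a' b := fun a a' b => by
    rw [hsymm, hBr, hsymm b a, hsymm b a']
  set s : X → ℝ := fun c => m - ∑ l ∈ (univ.erase i).erase j, r l c with hs
  have hjm : j ∈ univ.erase i := by simp [hij.symm]
  have hsplit : ∀ f : Fin m → ℝ, ∑ l, f l = f i + (f j + ∑ l ∈ (univ.erase i).erase j, f l) := by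
    intro f
    rw [add_sum_erase _ f hjm, add_sum_erase _ f (mem_univ i)]
  have hs2 : ∑ c, s c * μ c = 2 := by
    have h1 : ∑ c, ∑ l, r l c * μ c = m := by
      rw [sum_comm]; simp [hr]
    have h2 : ∀ c, s c * μ c = m * μ c - ∑ l, r l c * μ c + (r i c * μ c + r j c * μ c) := by
      intro c
      rw [hsplit fun l => r l c * μ c, hs]
      simp only [sub_mul, sum_mul]
      ring
    simp only [h2]
    rw [sum_add_distrib, sum_sub_distrib, ← mul_sum, hμ1, h1, sum_add_distrib, hr, hr]
    ring
  have hconst : ∀ a : X → ℝ, ∑ c, a c * μ c = 1 → B a (s - a) = m ^ m * K := by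
    intro a ha
    refine gammaMap_eq_of_balanced hm hμ1 h _ (fun c => ?_) fun l => ?_
    · rw [hsplit]
      have h1 : ∀ l ∈ (univ.erase i).erase j,
          Function.update (Function.update r i a) j (s - a) l c = r l c := by
        intro l hl
        simp only [mem_erase] at hl
        rw [Function.update_of_ne hl.1, Function.update_of_ne hl.2.1]
      rw [sum_congr rfl h1]
      simp only [hs, Function.update_self, Function.update_of_ne hij, Pi.sub_apply]
      ring
    · by_cases hl : l = j
      · subst hl
        simp only [Function.update_self, Pi.sub_apply, sub_mul]
        rw [sum_sub_distrib, hs2, ha]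
        norm_num
      by_cases hl' : l = i
      · subst hl'; simpa [hl] using ha
      · simpa [hl, hl'] using hr l
  have e0 := hconst (r i) (hr i)
  have e1 := hconst (r i + φ) (by simp only [Pi.add_apply, add_mul]; rw [sum_add_distrib, hr, hφ, add_zero])
  have e2 := hconst (r i + ψ) (by simp only [Pi.add_apply, add_mul]; rw [sum_add_distrib, hr, hψ, add_zero])
  have e3 := hconst (r i + φ + ψ) (by
    simp only [Pi.add_apply, add_mul]; rw [sum_add_distrib, sum_add_distrib, hr, hφ, hψ]; ring)
  have hsub : ∀ a, B a (s - a) = B a s - B a a := fun a => (gammaMap Γ).map_update_sub _ _ _ _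
  rw [hsub] at e0 e1 e2 e3
  simp only [hBl, hBr] at e0 e1 e2 e3
  have := hsymm φ ψ
  have h4 : B φ ψ = 0 := by linarith
  exact h4

theorem secondDiff_div_prod_eq_zero (hm : 0 < m) (hμ1 : ∑ c, μ c = 1)
    (hperm : ∀ (σ : Equiv.Perm (Fin m)) c, Γ (fun i => c (σ i)) = Γ c)
    (h : ∀ θ : Fin m → X → ℝ, (∀ i c, 0 ≤ θ i c) → (∀ c, ∑ i, θ i c = 1) →
      (∀ i, ∑ c, θ i c * μ c = 1 / m) → ∑ c : Fin m → X, Γ c * ∏ i, θ i (c i) = K)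
    {i j : Fin m} (hij : i ≠ j) (x : Fin m ⊕ Bool → X) (hx : ∀ a, 0 < μ (x a)) :
    secondDiff (fun c => Γ c / ∏ l, μ (c l)) i j x = 0 := by
  classical
  let δ : X → X → ℝ := fun y => Pi.single y (μ y)⁻¹
  have hδ : ∀ a, ∑ c, δ (x a) c * μ c = 1 := by
    intro a
    rw [sum_eq_single (x a) (fun c _ hc => by simp [δ, hc]) (by simp)]
    simp [δ, (hx a).ne']
  have hS : ∀ c : Fin m → X, Γ c / ∏ l, μ (c l) = gammaMap Γ fun l => δ (c l) := by
    intro c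
    rw [gammaMap_apply, sum_eq_single c]
    · simp [δ, div_eq_mul_inv]
    · intro c' _ hc'
      obtain ⟨l, hl⟩ := Function.ne_iff.1 hc'
      rw [prod_eq_zero (mem_univ l) (by simp [δ, hl]), mul_zero]
    · simp
  let r : Fin m → X → ℝ := fun l => δ (x (Sum.inl l))
  have h0 := gammaMap_update_update_eq_zero hm hμ1 hperm h (r := r) (fun l => hδ _) hij
    (φ := δ (x (Sum.inl i)) - δ (x (Sum.inr false)))
    (ψ := δ (x (Sum.inl j)) - δ (x (Sum.inr true)))
    (by simp [sub_mul, hδ]) (by simp [sub_mul, hδ])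
  rw [MultilinearMap.map_update_sub, Function.update_comm hij, MultilinearMap.map_update_sub,
    Function.update_comm hij, MultilinearMap.map_update_sub] at h0
  simp only [secondDiff, hS]
  have e0 : (fun l => δ (x (Sum.inl l))) = Function.update (Function.update r j (δ (x (Sum.inl j))))
      i (δ (x (Sum.inl i))) := by
    simp [r]
  have e1 : (fun l => δ (x (Function.update Sum.inl i (Sum.inr false) l)))
      = Function.update (Function.update r j (δ (x (Sum.inl j)))) i (δ (x (Sum.inr false))) := by
    ext l
    by_cases hl : l = i
    · subst hl; simp
    · by_cases hl' : l = j
      · subst hl'; simp [hl]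
      · simp [hl, r]
  have e2 : (fun l => δ (x (Function.update Sum.inl j (Sum.inr true) l)))
      = Function.update (Function.update r j (δ (x (Sum.inr true)))) i (δ (x (Sum.inl i))) := by
    ext l
    by_cases hl : l = i
    · subst hl; simp [hij]
    · by_cases hl' : l = j
      · subst hl'; simp [hl]
      · simp [hl, hl', r]
  have e3 : (fun l => δ (x (Function.update (Function.update Sum.inl i (Sum.inr false)) j
      (Sum.inr true) l)))
      = Function.update (Function.update r j (δ (x (Sum.inr true)))) i (δ (x (Sum.inr false))) := by
    ext l
    by_cases hl : l = i
    · subst hl; simp [hij]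
    · by_cases hl' : l = j
      · subst hl'; simp [hl]
      · simp [hl, hl', r]
  rw [e0, e1, e2, e3]
  linarith

omit [Fintype X] in
theorem injective_update_inl {β : Type*} {f : Fin m → Fin m ⊕ β} (hf : Function.Injective f)
    {b : β} (hb : ∀ l, f l ≠ Sum.inr b) (i : Fin m) :
    Function.Injective (Function.update f i (Sum.inr b)) := by
  intro a a' h
  by_cases ha : a = i <;> by_cases ha' : a' = i
  · rw [ha, ha']
  · subst ha
    rw [Function.update_self, Function.update_of_ne ha'] at h
    exact (hb _ h.symm).elim
  · subst ha'
    rw [Function.update_self, Function.update_of_ne ha] at h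
    exact (hb _ h).elim
  · rw [Function.update_of_ne ha, Function.update_of_ne ha'] at h
    exact hf h

theorem sum_abs_secondDiff_le (hm : 0 < m) (hμ0 : ∀ c, 0 ≤ μ c) (hμ1 : ∑ c, μ c = 1)
    (hperm : ∀ (σ : Equiv.Perm (Fin m)) c, Γ (fun i => c (σ i)) = Γ c)
    (h : ∀ θ : Fin m → X → ℝ, (∀ i c, 0 ≤ θ i c) → (∀ c, ∑ i, θ i c = 1) →
      (∀ i, ∑ c, θ i c * μ c = 1 / m) → ∑ c : Fin m → X, Γ c * ∏ i, θ i (c i) = K)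
    {S : (Fin m → X) → ℝ} {E : ℝ} (hE : ∑ c, |Γ c - S c * ∏ l, μ (c l)| ≤ E)
    {i j : Fin m} (hij : i ≠ j) :
    ∑ x : Fin m ⊕ Bool → X, (∏ a, μ (x a)) * |secondDiff S i j x| ≤ 4 * E := by
  classical
  let T : (Fin m → X) → ℝ := fun c => S c - Γ c / ∏ l, μ (c l)
  have hT : ∑ c, (∏ l, μ (c l)) * |T c| ≤ E := by
    refine (sum_le_sum fun c _ => ?_).trans hE
    have hp : 0 ≤ ∏ l, μ (c l) := prod_nonneg fun l _ => hμ0 _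
    rcases hp.eq_or_lt with h0 | h0
    · rw [← h0]; simp
    · have h1 : (∏ l, μ (c l)) * T c = S c * ∏ l, μ (c l) - Γ c := by
        simp only [T]
        field_simp
      rw [abs_sub_comm (Γ c), ← h1, abs_mul, abs_of_pos h0]
  have hmarg : ∀ e : Fin m → Fin m ⊕ Bool, Function.Injective e →
      ∑ x : Fin m ⊕ Bool → X, (∏ a, μ (x a)) * |T fun l => x (e l)| ≤ E := fun e he =>
    (sum_prod_mul_comp he (fun _ => μ) (fun _ => hμ1) fun c => |T c|).trans_le hT
  let e1 : Fin m → Fin m ⊕ Bool := Function.update Sum.inl i (Sum.inr false)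
  let e2 : Fin m → Fin m ⊕ Bool := Function.update Sum.inl j (Sum.inr true)
  let e3 : Fin m → Fin m ⊕ Bool := Function.update e1 j (Sum.inr true)
  have h0 := hmarg Sum.inl Sum.inl_injective
  have h1 := hmarg e1 (injective_update_inl Sum.inl_injective (by simp) i)
  have h2 := hmarg e2 (injective_update_inl Sum.inl_injective (by simp) j)
  have h3 := hmarg e3 (injective_update_inl
    (injective_update_inl Sum.inl_injective (by simp) i) (fun l => by
      by_cases hl : l = i
      · subst hl; simp
      · simp [hl]) j)
  have hle : ∀ x : Fin m ⊕ Bool → X, (∏ a, μ (x a)) * |secondDiff S i j x|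
      ≤ (∏ a, μ (x a)) * |T fun l => x (Sum.inl l)| + (∏ a, μ (x a)) * |T fun l => x (e1 l)|
        + (∏ a, μ (x a)) * |T fun l => x (e2 l)| + (∏ a, μ (x a)) * |T fun l => x (e3 l)| := by
    intro x
    by_cases hx : ∀ a, 0 < μ (x a)
    · rw [← mul_add, ← mul_add, ← mul_add]
      refine mul_le_mul_of_nonneg_left ?_ (prod_nonneg fun a _ => hμ0 _)
      have h4 := secondDiff_div_prod_eq_zero hm hμ1 hperm h hij x hx
      have h5 : secondDiff S i j x = T (fun l => x (Sum.inl l)) - T (fun l => x (e1 l))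
          - T (fun l => x (e2 l)) + T (fun l => x (e3 l)) := by
        simp only [secondDiff] at h4
        simp only [secondDiff, T, e1, e2, e3]
        linarith
      rw [h5]
      refine (abs_add_le _ _).trans (add_le_add_left ((abs_sub _ _).trans
        (add_le_add_left (abs_sub _ _) _)) _)
    · push Not at hx
      obtain ⟨a, ha⟩ := hx
      rw [prod_eq_zero (mem_univ a) (le_antisymm ha (hμ0 _))]
      simp
  refine (sum_le_sum fun x _ => hle x).trans ?_
  simp only [sum_add_distrib]
  linarith

end SecondDifference

/-- Averaged deviations of the symmetrized count between two kernels on a probability space. -/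
theorem sum_prod_mul_abs_symEdgeProd_sub_le {m : ℕ} (F : SimpleGraph (Fin m)) {X : Type*} [Fintype X]
    {d d' : X → X → ℝ} (hd : ∀ a b, d a b ∈ Set.Icc (0 : ℝ) 1)
    (hd' : ∀ a b, d' a b ∈ Set.Icc (0 : ℝ) 1) {μ : X → ℝ} (hμ : ∀ x, 0 ≤ μ x) (hμ1 : ∑ x, μ x = 1)
    {K : ℝ} (hK : ∑ a, ∑ b, μ a * μ b * |d a b - d' a b| ≤ K) :
    ∑ c : Fin m → X, (∏ i, μ (c i)) * |symEdgeProd F d c - symEdgeProd F d' c|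
      ≤ numEdges F * K := by
  have hle : ∀ c : Fin m → X, |symEdgeProd F d c - symEdgeProd F d' c|
      ≤ (m.factorial : ℝ)⁻¹ * ∑ σ : Equiv.Perm (Fin m), ∑ e ∈ edgePairs F,
        |d (c (σ e.1)) (c (σ e.2)) - d' (c (σ e.1)) (c (σ e.2))| := by
    intro c
    rw [symEdgeProd, symEdgeProd, ← mul_sub, ← sum_sub_distrib, abs_mul,
      abs_of_nonneg (a := (m.factorial : ℝ)⁻¹) (by positivity)]
    refine mul_le_mul_of_nonneg_left ((abs_sum_le_sum_abs _ _).trans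
      (sum_le_sum fun σ _ => ?_)) (by positivity)
    exact abs_edgeProd_sub_le F hd hd' _ _
  refine (sum_le_sum fun c _ => mul_le_mul_of_nonneg_left (hle c)
    (prod_nonneg fun i _ => hμ _)).trans ?_
  have h1 : ∑ c : Fin m → X, (∏ i, μ (c i)) * ((m.factorial : ℝ)⁻¹
        * ∑ σ : Equiv.Perm (Fin m), ∑ e ∈ edgePairs F,
          |d (c (σ e.1)) (c (σ e.2)) - d' (c (σ e.1)) (c (σ e.2))|)
      = (m.factorial : ℝ)⁻¹ * ∑ σ : Equiv.Perm (Fin m), ∑ e ∈ edgePairs F,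
        ∑ c : Fin m → X, (∏ i, μ (c i))
          * |d (c (σ e.1)) (c (σ e.2)) - d' (c (σ e.1)) (c (σ e.2))| := by
    simp only [mul_sum]
    rw [sum_comm]
    refine sum_congr rfl fun σ _ => ?_
    rw [sum_comm]
    exact sum_congr rfl fun e _ => sum_congr rfl fun c _ => by ring
  have h2 : ∀ (σ : Equiv.Perm (Fin m)), ∀ e ∈ edgePairs F,
      ∑ c : Fin m → X, (∏ i, μ (c i))
        * |d (c (σ e.1)) (c (σ e.2)) - d' (c (σ e.1)) (c (σ e.2))| ≤ K := by
    intro σ e he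
    have hne : σ e.1 ≠ σ e.2 := fun hc => (mem_edgePairs.1 he).1.ne (σ.injective hc)
    rw [sum_prod_mul_pair hne (fun _ => μ) (fun _ => hμ1) fun a b => |d a b - d' a b|]
    exact hK
  rw [h1]
  refine (mul_le_mul_of_nonneg_left (sum_le_sum fun σ _ => sum_le_sum (h2 σ))
    (by positivity)).trans (le_of_eq ?_)
  rw [sum_const, sum_const, card_univ, Fintype.card_perm, Fintype.card_fin, nsmul_eq_mul,
    nsmul_eq_mul, numEdges_eq_card, ← mul_assoc, inv_mul_cancel₀ (by positivity), one_mul]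

namespace CellLimit

variable {m : ℕ} {F : SimpleGraph (Fin m)} {p : ℝ} (L : CellLimit F p)

/-- Averages of functions of coarse cells over fine cells. -/
theorem sum_mul_trunc {k l : ℕ} (h : k ≤ l) (f : Cell k → ℝ) :
    ∑ c, f (Cell.trunc h c) * L.mass l c = ∑ c, f c * L.mass k c := by
  rw [← sum_fiberwise (s := univ) (g := Cell.trunc h)]
  refine sum_congr rfl fun c _ => ?_
  rw [L.mass_trunc h, mul_sum]
  refine sum_congr rfl fun c' hc' => ?_
  rw [mem_filter] at hc'
  rw [hc'.2]

theorem sum_abs_symEdgeProd_sub_le {k l : ℕ} (h : k ≤ l) :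
    ∑ c : Fin m → Cell l, (∏ i, L.mass l (c i)) * |symEdgeProd F (L.dens l) c
      - symEdgeProd F (L.dens k) (fun i => (c i).trunc h)| ≤ numEdges F * L.err k := by
  have hK : ∑ a, ∑ b, L.mass l a * L.mass l b
      * |L.dens l a b - (fun a b => L.dens k (a.trunc h) (b.trunc h)) a b| ≤ L.err k :=
    L.dens_trunc h
  have h1 := sum_prod_mul_abs_symEdgeProd_sub_le F (L.dens_mem l) (fun _ _ => L.dens_mem k _ _)
    (L.mass_nonneg l) (L.sum_mass l) hK
  refine le_trans (le_of_eq (sum_congr rfl fun c _ => ?_)) h1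
  congr 2

/-- The mass of the symmetrized count of level `l` over a tuple of coarser cells. -/
noncomputable def coarseCount {k l : ℕ} (h : k ≤ l) (c : Fin m → Cell k) : ℝ :=
  ∑ c' : Fin m → Cell l with (fun i => (c' i).trunc h) = c,
    symEdgeProd F (L.dens l) c' * ∏ i, L.mass l (c' i)

theorem coarseCount_mem_Icc {k l : ℕ} (h : k ≤ l) (c : Fin m → Cell k) :
    L.coarseCount h c ∈ Set.Icc (0 : ℝ) 1 := by
  have hs := symEdgeProd_mem_Icc F (L.dens_mem l)
  have hp : ∀ c' : Fin m → Cell l, 0 ≤ ∏ i, L.mass l (c' i) := fun c' =>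
    prod_nonneg fun i _ => L.mass_nonneg l _
  refine ⟨sum_nonneg fun c' _ => mul_nonneg (hs c').1 (hp c'), ?_⟩
  refine (sum_le_sum fun c' _ => mul_le_of_le_one_left (hp c') (hs c').2).trans ?_
  exact (sum_le_sum_of_subset_of_nonneg (subset_univ _) fun c' _ _ => hp c').trans_eq
    (sum_prod_eq_one (fun _ => L.mass l) fun _ => L.sum_mass l)

theorem coarseCount_perm {k l : ℕ} (h : k ≤ l) (σ : Equiv.Perm (Fin m)) (c : Fin m → Cell k) :
    L.coarseCount h (fun i => c (σ i)) = L.coarseCount h c := by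
  classical
  simp only [coarseCount, sum_filter]
  refine Fintype.sum_equiv (Equiv.arrowCongr σ (Equiv.refl _)) _ _ fun c' => ?_
  have e1 : ∀ i, (Equiv.arrowCongr σ (Equiv.refl (Cell l))) c' i = c' (σ.symm i) := fun i => rfl
  have e2 : symEdgeProd F (L.dens l) (Equiv.arrowCongr σ (Equiv.refl (Cell l)) c')
      = symEdgeProd F (L.dens l) c' := symEdgeProd_perm F (L.dens l) c' σ.symm
  have e3 : ∏ i, L.mass l (Equiv.arrowCongr σ (Equiv.refl (Cell l)) c' i)
      = ∏ i, L.mass l (c' i) := Equiv.prod_comp σ.symm fun i => L.mass l (c' i)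
  rw [e2, e3]
  refine if_congr ?_ rfl rfl
  simp only [e1, funext_iff]
  exact ⟨fun h i => by simpa using h (σ.symm i), fun h i => by simpa using h (σ i)⟩

theorem sum_coarseCount_mul_prod {k l : ℕ} (h : k ≤ l) (θ : Fin m → Cell k → ℝ) :
    ∑ c, L.coarseCount h c * ∏ i, θ i (c i) = ∑ c : Fin m → Cell l,
      symEdgeProd F (L.dens l) c * ∏ i, θ i ((c i).trunc h) * L.mass l (c i) := by
  rw [← sum_fiberwise (s := univ) (g := fun (c : Fin m → Cell l) i => (c i).trunc h)]
  refine sum_congr rfl fun c _ => ?_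
  rw [coarseCount, sum_mul]
  refine sum_congr rfl fun c' hc' => ?_
  rw [mem_filter] at hc'
  rw [← hc'.2, prod_mul_distrib]
  ring

theorem sum_abs_coarseCount_sub_le {k l : ℕ} (h : k ≤ l) :
    ∑ c, |L.coarseCount h c - symEdgeProd F (L.dens k) c * ∏ i, L.mass k (c i)|
      ≤ numEdges F * L.err k := by
  refine le_trans ?_ (L.sum_abs_symEdgeProd_sub_le h)
  rw [← sum_fiberwise (s := univ) (g := fun (c : Fin m → Cell l) i => (c i).trunc h)]
  refine sum_le_sum fun c _ => ?_
  have h1 : ∏ i, L.mass k (c i) = ∑ c' : Fin m → Cell l with (fun i => (c' i).trunc h) = c,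
      ∏ i, L.mass l (c' i) := by
    simp only [L.mass_trunc h]
    rw [prod_univ_sum]
    refine sum_congr ?_ fun _ _ => rfl
    ext c'
    simp [Fintype.mem_piFinset, funext_iff]
  rw [h1, coarseCount, mul_sum, ← sum_sub_distrib]
  refine (abs_sum_le_sum_abs _ _).trans (sum_le_sum fun c' hc' => le_of_eq ?_)
  rw [mem_filter] at hc'
  rw [← sub_mul, abs_mul, mul_comm, hc'.2,
    abs_of_nonneg (prod_nonneg fun i _ => L.mass_nonneg l _)]

theorem sum_abs_secondDiff_symEdgeProd_le (hm : 0 < m) (k : ℕ) {i j : Fin m} (hij : i ≠ j) :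
    ∑ x : Fin m ⊕ Bool → Cell k, (∏ a, L.mass k (x a))
      * |secondDiff (symEdgeProd F (L.dens k)) i j x| ≤ 4 * (numEdges F * L.err k) := by
  let 𝒰 : Ultrafilter ℕ := Ultrafilter.of atTop
  have h𝒰 : (𝒰 : Filter ℕ) ≤ atTop := Ultrafilter.of_le _
  choose Γ _ hΓ using fun c : Fin m → Cell k => exists_tendsto_of_mem_Icc 𝒰
    (fun n => L.coarseCount (Nat.le_add_right k n) c) fun n => L.coarseCount_mem_Icc _ _
  refine sum_abs_secondDiff_le (Γ := Γ) (K := p ^ numEdges F * (1 / m) ^ m) hm (L.mass_nonneg k)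
    (L.sum_mass k) (fun σ c => ?_) (fun θ hθ hθ1 hθm => ?_) ?_ hij
  · exact tendsto_nhds_unique ((hΓ fun i => c (σ i)).congr fun n => L.coarseCount_perm _ σ c) (hΓ c)
  · refine tendsto_nhds_unique (tendsto_finsetSum _ fun c _ => (hΓ c).mul_const _) ?_
    have h1 : Tendsto (fun n => (numEdges F : ℝ) * L.err (k + n)) 𝒰 (nhds 0) := by
      have := (L.tendsto_err.comp (tendsto_add_atTop_nat k)).const_mul (numEdges F : ℝ)
      simp only [mul_zero] at this
      refine (this.mono_left h𝒰).congr fun n => ?_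
      simp [add_comm]
    have h2 := squeeze_zero_norm' (Eventually.of_forall fun n => ?_) h1
      (f := fun n => ∑ c, L.coarseCount (Nat.le_add_right k n) c * ∏ i, θ i (c i)
        - p ^ numEdges F * (1 / m) ^ m)
    · simpa using h2.add_const (p ^ numEdges F * (1 / (m : ℝ)) ^ m)
    · rw [Real.norm_eq_abs, sum_coarseCount_mul_prod]
      refine L.count (k + n) (fun i c => θ i (c.trunc (Nat.le_add_right k n))) (fun i c => hθ _ _)
        (fun c => hθ1 _) fun i => ?_
      rw [L.sum_mul_trunc (Nat.le_add_right k n) (θ i), hθm]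
  · refine le_of_tendsto (tendsto_finsetSum _ fun c _ =>
      ((hΓ c).sub_const (symEdgeProd F (L.dens k) c * ∏ i, L.mass k (c i))).abs) ?_
    exact Eventually.of_forall fun n => L.sum_abs_coarseCount_sub_le _

end CellLimit

theorem abs_sub_mul_pow_le_abs_pow_sub {x y : ℝ} (hx : 0 ≤ x) (hy : 0 ≤ y) (e : ℕ) :
    |x - y| * y ^ e ≤ |x ^ (e + 1) - y ^ (e + 1)| := by
  rcases le_total y x with h | h
  · rw [abs_of_nonneg (sub_nonneg.2 h), abs_of_nonneg (sub_nonneg.2 (pow_le_pow_left₀ hy h _))]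
    have := mul_le_mul_of_nonneg_left (pow_le_pow_left₀ hy h e) hx
    rw [pow_succ', pow_succ', sub_mul]
    linarith
  · rw [abs_of_nonpos (sub_nonpos.2 h), abs_of_nonpos (sub_nonpos.2 (pow_le_pow_left₀ hx h _))]
    have := mul_le_mul_of_nonneg_left (pow_le_pow_left₀ hx h e) hx
    rw [pow_succ', pow_succ', neg_sub, neg_sub, sub_mul]
    linarith

namespace CellLimit

variable {m : ℕ} {F : SimpleGraph (Fin m)} {p : ℝ} (L : CellLimit F p)

/-- The average of the symmetrized count at level `k`. -/
noncomputable def meanCount (k : ℕ) : ℝ :=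
  ∑ c : Fin m → Cell k, (∏ i, L.mass k (c i)) * symEdgeProd F (L.dens k) c

/-- The average difference of two independent densities at level `k`. -/
noncomputable def spread (k : ℕ) : ℝ :=
  ∑ c : Fin 4 → Cell k, (∏ i, L.mass k (c i)) * |L.dens k (c 0) (c 1) - L.dens k (c 2) (c 3)|

theorem abs_meanCount_sub_le (hm : 0 < m) (k : ℕ) :
    |L.meanCount k - p ^ numEdges F| ≤ m ^ m * (numEdges F * L.err k) := by
  have hm' : (0 : ℝ) < m := by exact_mod_cast hm
  have h := L.count k (fun _ _ => 1 / m) (fun _ _ => by positivity) (fun c => by simp [hm'.ne'])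
    (fun i => by rw [← mul_sum, L.sum_mass, mul_one])
  have h1 : ∑ c : Fin m → Cell k, symEdgeProd F (L.dens k) c * ∏ i, 1 / (m : ℝ) * L.mass k (c i)
      = (1 / m) ^ m * L.meanCount k := by
    rw [meanCount, mul_sum]
    refine sum_congr rfl fun c _ => ?_
    rw [prod_mul_distrib, prod_const, card_univ, Fintype.card_fin]
    ring
  rw [h1, mul_comm (p ^ _), ← mul_sub, abs_mul, abs_of_nonneg (by positivity)] at h
  have h2 := mul_le_mul_of_nonneg_left h (show (0 : ℝ) ≤ m ^ m by positivity)
  rwa [← mul_assoc, ← mul_pow, mul_one_div_cancel hm'.ne', one_pow, one_mul] at h2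

theorem spread_eq (k : ℕ) : L.spread k = ∑ a, ∑ b, L.mass k a * L.mass k b *
    ∑ c, ∑ d, L.mass k c * L.mass k d * |L.dens k a b - L.dens k c d| := by
  let E : (Fin 4 → Cell k) ≃ Cell k × Cell k × Cell k × Cell k :=
    { toFun := fun c => (c 0, c 1, c 2, c 3)
      invFun := fun q => ![q.1, q.2.1, q.2.2.1, q.2.2.2]
      left_inv := fun c => by
        ext1 i
        fin_cases i <;> rfl
      right_inv := fun q => rfl }
  rw [spread, Fintype.sum_equiv E _ (fun q => L.mass k q.1 * L.mass k q.2.1 *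
    (L.mass k q.2.2.1 * L.mass k q.2.2.2 * |L.dens k q.1 q.2.1 - L.dens k q.2.2.1 q.2.2.2|))]
  · simp only [Fintype.sum_prod_type, mul_sum]
  · intro c
    show _ = L.mass k (c 0) * L.mass k (c 1) * (L.mass k (c 2) * L.mass k (c 3)
      * |L.dens k (c 0) (c 1) - L.dens k (c 2) (c 3)|)
    rw [Fin.prod_univ_four]
    ring

theorem gap_le_spread (hm : 0 < m) (hp : 0 < p) (he : 0 < numEdges F) (k : ℕ) :
    L.gap ≤ L.spread k + L.err k
      + (numEdges F * L.spread k + m ^ m * (numEdges F * L.err k)) / p ^ (numEdges F - 1) := by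
  set M : ℝ := ∑ a, ∑ b, L.mass k a * L.mass k b * L.dens k a b with hM
  have hμ1 : ∑ a, ∑ b, L.mass k a * L.mass k b = 1 := by
    simp [← mul_sum, L.sum_mass]
  have hμ : ∀ a b, 0 ≤ L.mass k a * L.mass k b := fun a b =>
    mul_nonneg (L.mass_nonneg k a) (L.mass_nonneg k b)
  have hM01 : M ∈ Set.Icc (0 : ℝ) 1 := by
    refine ⟨sum_nonneg fun a _ => sum_nonneg fun b _ => mul_nonneg (hμ a b) (L.dens_mem k a b).1, ?_⟩
    rw [← hμ1]
    exact sum_le_sum fun a _ => sum_le_sum fun b _ =>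
      mul_le_of_le_one_right (hμ a b) (L.dens_mem k a b).2
  have hdev : ∑ a, ∑ b, L.mass k a * L.mass k b * |L.dens k a b - M| ≤ L.spread k := by
    rw [spread_eq]
    refine sum_le_sum fun a _ => sum_le_sum fun b _ => mul_le_mul_of_nonneg_left ?_ (hμ a b)
    have h1 : L.dens k a b - M
        = ∑ c, ∑ d, L.mass k c * L.mass k d * (L.dens k a b - L.dens k c d) := by
      simp only [mul_sub, sum_sub_distrib, ← sum_mul, hμ1, one_mul]
      rfl
    rw [h1]
    refine (abs_sum_le_sum_abs _ _).trans (sum_le_sum fun c _ =>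
      (abs_sum_le_sum_abs _ _).trans (sum_le_sum fun d _ => ?_))
    rw [abs_mul, abs_of_nonneg (hμ c d)]
  have h1 := sum_prod_mul_abs_symEdgeProd_sub_le F (L.dens_mem k) (d' := fun _ _ => M)
    (fun _ _ => hM01) (L.mass_nonneg k) (L.sum_mass k) hdev
  have h2 : |L.meanCount k - M ^ numEdges F| ≤ numEdges F * L.spread k := by
    refine le_trans ?_ h1
    have h3 : L.meanCount k - M ^ numEdges F = ∑ c : Fin m → Cell k, (∏ i, L.mass k (c i))
        * (symEdgeProd F (L.dens k) c - symEdgeProd F (fun _ _ => M) c) := by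
      simp only [symEdgeProd_const, mul_sub, sum_sub_distrib, ← sum_mul]
      rw [sum_prod_eq_one (fun _ => L.mass k) fun _ => L.sum_mass k, one_mul, meanCount]
    rw [h3]
    refine (abs_sum_le_sum_abs _ _).trans (sum_le_sum fun c _ => ?_)
    rw [abs_mul, abs_of_nonneg (prod_nonneg fun i _ => L.mass_nonneg k _)]
  have h3 := L.abs_meanCount_sub_le hm k
  have h4 : |M ^ numEdges F - p ^ numEdges F|
      ≤ numEdges F * L.spread k + m ^ m * (numEdges F * L.err k) :=
    (abs_sub_le _ (L.meanCount k) _).trans (add_le_add (by rwa [abs_sub_comm]) h3)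
  have h5 : |M - p| ≤ (numEdges F * L.spread k + m ^ m * (numEdges F * L.err k))
      / p ^ (numEdges F - 1) := by
    rw [le_div_iff₀ (by positivity)]
    refine le_trans ?_ h4
    have := abs_sub_mul_pow_le_abs_pow_sub hM01.1 hp.le (numEdges F - 1)
    rwa [Nat.sub_add_cancel he] at this
  have h6 : ∑ a, ∑ b, L.mass k a * L.mass k b * |L.dens k a b - p|
      ≤ L.spread k + |M - p| := by
    refine le_trans ?_ (add_le_add_left hdev _)
    rw [← one_mul |M - p|, ← hμ1]
    simp only [sum_mul, ← sum_add_distrib, ← mul_add]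
    exact sum_le_sum fun a _ => sum_le_sum fun b _ =>
      mul_le_mul_of_nonneg_left (abs_sub_le _ _ _) (hμ a b)
  linarith [L.gap_le k]

theorem exists_eventually_le_spread (hm : 0 < m) (hp : 0 < p) (he : 0 < numEdges F) :
    ∃ κ > 0, ∀ᶠ k in atTop, κ ≤ L.spread k * L.meanCount k := by
  have hpe : 0 < p ^ (numEdges F - 1) := by positivity
  set A : ℝ := 1 + numEdges F / p ^ (numEdges F - 1) with hA
  have hA0 : 0 < A := by positivity
  refine ⟨L.gap / (2 * A) * (p ^ numEdges F / 2), mul_pos (div_pos L.gap_pos (by positivity))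
    (by positivity), ?_⟩
  have h1 : Tendsto (fun k => L.err k + m ^ m * (numEdges F * L.err k) / p ^ (numEdges F - 1)) atTop
      (nhds (0 + m ^ m * (numEdges F * 0) / p ^ (numEdges F - 1))) :=
    L.tendsto_err.add (((L.tendsto_err.const_mul _).const_mul _).div_const _)
  have h2 : Tendsto (fun k => (m : ℝ) ^ m * (numEdges F * L.err k)) atTop
      (nhds (m ^ m * (numEdges F * 0))) := (L.tendsto_err.const_mul _).const_mul _
  simp only [mul_zero, zero_div, add_zero] at h1 h2
  filter_upwards [h1.eventually (gt_mem_nhds (half_pos L.gap_pos)),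
    h2.eventually (gt_mem_nhds (show 0 < p ^ numEdges F / 2 by positivity))] with k h3 h4
  refine mul_le_mul ?_ ?_ (by positivity) ?_
  · rw [div_le_iff₀ (by positivity)]
    have h5 := L.gap_le_spread hm hp he k
    have h6 : L.spread k * (2 * A) = 2 * (L.spread k + numEdges F * L.spread k
        / p ^ (numEdges F - 1)) := by rw [hA]; ring
    rw [add_div] at h5
    rw [h6]
    linarith
  · linarith [(abs_le.1 (L.abs_meanCount_sub_le hm k)).1]
  · exact sum_nonneg fun c _ => mul_nonneg (prod_nonneg fun i _ => L.mass_nonneg k _) (abs_nonneg _)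

end CellLimit

/-- A first moment argument: if the average of `G ≤ 1` is at least `κ` and the deviations `D j`
are small on average, then some outcome has all deviations small and `G` at least `κ / 2`. -/
theorem exists_le_and_forall_le {Ω J : Type*} [Fintype Ω] [Fintype J] {w G : Ω → ℝ}
    (hw : ∀ ω, 0 ≤ w ω) (hw1 : ∑ ω, w ω = 1) (hG : ∀ ω, G ω ≤ 1) {κ : ℝ} (hκ : 0 < κ)
    (hGκ : κ ≤ ∑ ω, w ω * G ω) {D : J → Ω → ℝ} (hD : ∀ j ω, 0 ≤ D j ω) {η δ : ℝ} (hη : 0 < η)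
    (hDδ : ∀ j, ∑ ω, w ω * D j ω ≤ δ) (hδ : Fintype.card J * δ ≤ η * (κ / 2)) :
    ∃ ω, κ / 2 ≤ G ω ∧ ∀ j, D j ω ≤ η := by
  by_contra! hcon
  have h1 : ∀ ω, w ω * (G ω - η⁻¹ * ∑ j, D j ω) ≤ w ω * (κ / 2) := by
    intro ω
    refine mul_le_mul_of_nonneg_left ?_ (hw ω)
    by_contra! hlt
    have h0 : 0 ≤ η⁻¹ * ∑ j, D j ω := mul_nonneg (by positivity) (sum_nonneg fun j _ => hD j ω)
    obtain ⟨j, hj⟩ := hcon ω (by linarith)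
    have h2 : D j ω ≤ ∑ j, D j ω :=
      single_le_sum (f := fun j => D j ω) (fun j _ => hD j ω) (mem_univ j)
    have h3 : 1 ≤ η⁻¹ * ∑ j, D j ω := by
      rw [← inv_mul_cancel₀ hη.ne']
      exact mul_le_mul_of_nonneg_left (hj.le.trans h2) (by positivity)
    linarith [hG ω]
  have h2 : ∃ ω, w ω * (G ω - η⁻¹ * ∑ j, D j ω) < w ω * (κ / 2) := by
    by_contra! hge
    have hz : ∀ ω, w ω = 0 := by
      intro ω
      by_contra hne
      have hpos : 0 < w ω := lt_of_le_of_ne (hw ω) (Ne.symm hne)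
      have h4 := le_of_mul_le_mul_left (hge ω) hpos
      have h5 : κ / 2 ≤ G ω := by
        have : 0 ≤ η⁻¹ * ∑ j, D j ω :=
          mul_nonneg (by positivity) (sum_nonneg fun j _ => hD j ω)
        linarith
      obtain ⟨j, hj⟩ := hcon ω h5
      have h6 : D j ω ≤ ∑ j, D j ω :=
        single_le_sum (f := fun j => D j ω) (fun j _ => hD j ω) (mem_univ j)
      have h7 : 1 < η⁻¹ * ∑ j, D j ω := by
        rw [← inv_mul_cancel₀ hη.ne']
        exact mul_lt_mul_of_pos_left (hj.trans_le h6) (by positivity)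
      linarith [hG ω]
    simp [hz] at hw1
  have h3 := sum_lt_sum (fun ω (_ : ω ∈ univ) => h1 ω) (by simpa using h2)
  rw [← sum_mul, hw1, one_mul] at h3
  have h4 : ∑ ω, w ω * (G ω - η⁻¹ * ∑ j, D j ω)
      = ∑ ω, w ω * G ω - η⁻¹ * ∑ j, ∑ ω, w ω * D j ω := by
    rw [sum_comm (s := (univ : Finset J))]
    simp only [mul_sub, sum_sub_distrib, mul_sum]
    congr 1
    exact sum_congr rfl fun ω _ => sum_congr rfl fun j _ => by ring
  have h5 : η⁻¹ * ∑ j, ∑ ω, w ω * D j ω ≤ κ / 2 := by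
    rw [inv_mul_le_iff₀ hη]
    refine le_trans ((sum_le_sum fun j _ => hDδ j).trans_eq ?_) hδ
    rw [sum_const, card_univ, nsmul_eq_mul]
  linarith

section Sample

variable {C X : Type*} [Fintype C] [Fintype X] [DecidableEq C]

/-- The conditional distribution of a fine cell given its coarse cell. -/
noncomputable def condMass (μ : C → ℝ) (ν : X → ℝ) (π : X → C) (c : C) (x : X) : ℝ :=
  if μ c = 0 then ν x else if π x = c then ν x / μ c else 0

variable {μ : C → ℝ} {ν : X → ℝ} {π : X → C}

omit [Fintype C] [Fintype X] in
theorem condMass_nonneg (hμ : ∀ c, 0 ≤ μ c) (hν : ∀ x, 0 ≤ ν x) (c : C) (x : X) :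
    0 ≤ condMass μ ν π c x := by
  unfold condMass
  have := hμ c
  have := hν x
  split_ifs <;> positivity

omit [Fintype C] in
theorem sum_condMass (hν1 : ∑ x, ν x = 1) (hπ : ∀ c, μ c = ∑ x with π x = c, ν x) (c : C) :
    ∑ x, condMass μ ν π c x = 1 := by
  unfold condMass
  by_cases h : μ c = 0
  · simp [h, hν1]
  · simp only [h, if_false]
    rw [← sum_filter, ← sum_div, ← hπ, div_self h]

omit [Fintype C] in
theorem mul_condMass (hν : ∀ x, 0 ≤ ν x) (hπ : ∀ c, μ c = ∑ x with π x = c, ν x) (c : C) (x : X) :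
    μ c * condMass μ ν π c x = if π x = c then ν x else 0 := by
  unfold condMass
  by_cases h : μ c = 0
  · rw [if_pos h, h, zero_mul]
    split_ifs with hx
    · rw [hπ, sum_eq_zero_iff_of_nonneg fun x _ => hν x] at h
      exact (h x (by simp [hx])).symm
    · rfl
  · rw [if_neg h]
    split_ifs
    · field_simp
    · simp

omit [Fintype X] in
theorem condMass_le (hμ : ∀ c, 0 ≤ μ c) (hν : ∀ x, 0 ≤ ν x) (c : C) (x : X) :
    condMass μ ν π c x ≤ (1 + ∑ c, (μ c)⁻¹) * ν x := by
  have h0 : ∀ c, 0 ≤ (μ c)⁻¹ := fun c => inv_nonneg.2 (hμ c)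
  have h1 : (μ c)⁻¹ ≤ ∑ c, (μ c)⁻¹ := single_le_sum (fun c _ => h0 c) (mem_univ c)
  have h2 := hν x
  have h3 := h0 c
  have h4 : 0 ≤ ∑ c, (μ c)⁻¹ := sum_nonneg fun c _ => h0 c
  unfold condMass
  split_ifs
  · nlinarith
  · rw [div_eq_mul_inv, mul_comm]
    exact mul_le_mul_of_nonneg_right (by linarith) h2
  · positivity

theorem sum_mul_condMass_pair (hν : ∀ x, 0 ≤ ν x) (hπ : ∀ c, μ c = ∑ x with π x = c, ν x)
    (g : C → C → X → X → ℝ) :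
    ∑ c, ∑ c', μ c * μ c' * ∑ x, ∑ x', condMass μ ν π c x * condMass μ ν π c' x' * g c c' x x'
      = ∑ x, ∑ x', ν x * ν x' * g (π x) (π x') x x' := by
  have h1 : ∀ c c', μ c * μ c' * ∑ x, ∑ x', condMass μ ν π c x * condMass μ ν π c' x' * g c c' x x'
      = ∑ x, ∑ x', (if π x = c then ν x else 0) * (if π x' = c' then ν x' else 0)
        * g c c' x x' := by
    intro c c'
    rw [mul_sum]
    refine sum_congr rfl fun x _ => ?_
    rw [mul_sum]
    refine sum_congr rfl fun x' _ => ?_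
    rw [← mul_condMass hν hπ, ← mul_condMass hν hπ]
    ring
  simp only [h1]
  have h2 : ∀ c, ∑ c', ∑ x, ∑ x', (if π x = c then ν x else 0) * (if π x' = c' then ν x' else 0)
        * g c c' x x' = ∑ x, ∑ x', (if π x = c then ν x else 0) * ν x' * g c (π x') x x' := by
    intro c
    rw [sum_comm]
    refine sum_congr rfl fun x _ => ?_
    rw [sum_comm]
    refine sum_congr rfl fun x' _ => ?_
    rw [sum_eq_single (π x')]
    · simp
    · intro c' _ hne
      simp [Ne.symm hne]
    · simp
  simp only [h2]
  rw [sum_comm]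
  refine sum_congr rfl fun x _ => ?_
  rw [sum_comm]
  refine sum_congr rfl fun x' _ => ?_
  rw [sum_eq_single (π x)]
  · simp
  · intro c' _ hne
    simp [Ne.symm hne]
  · simp

end Sample

namespace CellLimit

variable {m : ℕ} {F : SimpleGraph (Fin m)} {p : ℝ} (L : CellLimit F p)

theorem sum_spread_mul_count (k : ℕ) :
    ∑ c : Fin 4 ⊕ Fin m → Cell k, (∏ s, L.mass k (c s)) *
      (|L.dens k (c (Sum.inl 0)) (c (Sum.inl 1)) - L.dens k (c (Sum.inl 2)) (c (Sum.inl 3))|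
        * symEdgeProd F (L.dens k) (fun i => c (Sum.inr i))) = L.spread k * L.meanCount k := by
  rw [spread, meanCount, sum_mul_sum, ← Fintype.sum_prod_type']
  refine Fintype.sum_equiv (Equiv.sumArrowEquivProdArrow (Fin 4) (Fin m) (Cell k)) _ _ fun c => ?_
  rw [Fintype.prod_sum_type]
  show _ = ((∏ i, L.mass k (c (Sum.inl i))) *
    |L.dens k (c (Sum.inl 0)) (c (Sum.inl 1)) - L.dens k (c (Sum.inl 2)) (c (Sum.inl 3))|)
    * ((∏ i, L.mass k (c (Sum.inr i))) * symEdgeProd F (L.dens k) (fun i => c (Sum.inr i)))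
  ring

/-- Sampling cells at two levels produces arrays on which the counting condition is nearly exact. -/
theorem exists_array (L : CellLimit F p) (hm : 0 < m) (hp : 0 < p) (he : 0 < numEdges F) : ∃ κ > 0,
    ∀ (T : Type) [Fintype T] [DecidableEq T] (η : ℝ), 0 < η →
    ∃ (b : Fin 4 ⊕ Fin m → Fin 4 ⊕ Fin m → ℝ)
      (B : (Fin 4 ⊕ Fin m) × T → (Fin 4 ⊕ Fin m) × T → ℝ),
      (∀ s s', b s s' ∈ Set.Icc (0 : ℝ) 1) ∧ (∀ x y, B x y ∈ Set.Icc (0 : ℝ) 1) ∧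
      (∀ x y, B x y = B y x) ∧
      (∀ s s' t t', s ≠ s' → |B (s, t) (s', t') - b s s'| ≤ η) ∧
      (∀ e : Fin m ⊕ Bool → (Fin 4 ⊕ Fin m) × T, Function.Injective e → ∀ i j, i ≠ j →
        |secondDiff (symEdgeProd F B) i j e| ≤ η) ∧
      κ ≤ |b (Sum.inl 0) (Sum.inl 1) - b (Sum.inl 2) (Sum.inl 3)|
        * symEdgeProd F b (fun i => Sum.inr i) := by
  obtain ⟨κ, hκ, hev⟩ := L.exists_eventually_le_spread hm hp he
  refine ⟨κ / 2, half_pos hκ, fun T _ _ η hη => ?_⟩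
  let I := Fin 4 ⊕ Fin m
  let J := ((I × T) × (I × T)) ⊕ ((Fin m ⊕ Bool → I × T) × (Fin m × Fin m))
  -- the two levels
  have hδ : 0 < η * (κ / 2) / (Fintype.card J + 1) := by positivity
  obtain ⟨k, hk1, hk2⟩ := (hev.and (L.tendsto_err.eventually (gt_mem_nhds hδ))).exists
  set M : ℝ := 1 + ∑ c, (L.mass k c)⁻¹ with hM
  have hM0 : 0 ≤ M := by
    have : 0 ≤ ∑ c, (L.mass k c)⁻¹ := sum_nonneg fun c _ => inv_nonneg.2 (L.mass_nonneg k c)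
    positivity
  have hlim : Tendsto (fun l => M ^ (m + 2) * (4 * (numEdges F * L.err l))) atTop
      (nhds (M ^ (m + 2) * (4 * (numEdges F * 0)))) :=
    ((L.tendsto_err.const_mul _).const_mul _).const_mul _
  simp only [mul_zero] at hlim
  obtain ⟨l, hl1, hkl⟩ := ((hlim.eventually (gt_mem_nhds hδ)).and (eventually_ge_atTop k)).exists
  let q : Cell k → Cell l → ℝ := condMass (L.mass k) (L.mass l) (Cell.trunc hkl)
  have hq0 : ∀ c x, 0 ≤ q c x := condMass_nonneg (L.mass_nonneg k) (L.mass_nonneg l)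
  have hq1 : ∀ c, ∑ x, q c x = 1 := sum_condMass (L.sum_mass l) (L.mass_trunc hkl)
  let w : (I → Cell k) × (I × T → Cell l) → ℝ := fun ω =>
    (∏ s, L.mass k (ω.1 s)) * ∏ j : I × T, q (ω.1 j.1) (ω.2 j)
  have hexp : ∀ f : (I → Cell k) × (I × T → Cell l) → ℝ, ∑ ω, w ω * f ω
      = ∑ c : I → Cell k, (∏ s, L.mass k (c s)) *
        ∑ x : I × T → Cell l, (∏ j : I × T, q (c j.1) (x j)) * f (c, x) := by
    intro f
    rw [Fintype.sum_prod_type]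
    refine sum_congr rfl fun c _ => ?_
    rw [mul_sum]
    exact sum_congr rfl fun x _ => mul_assoc _ _ _
  have hx1 : ∀ c : I → Cell k, ∑ x : I × T → Cell l, ∏ j : I × T, q (c j.1) (x j) = 1 := fun c =>
    sum_prod_eq_one (fun j : I × T => q (c j.1)) fun j => hq1 _
  have hc1 : ∑ c : I → Cell k, ∏ s, L.mass k (c s) = 1 :=
    sum_prod_eq_one (fun _ => L.mass k) fun _ => L.sum_mass k
  have hP0 : ∀ c : I → Cell k, 0 ≤ ∏ s, L.mass k (c s) := fun c =>
    prod_nonneg fun _ _ => L.mass_nonneg k _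
  let G : (I → Cell k) × (I × T → Cell l) → ℝ := fun ω =>
    |L.dens k (ω.1 (Sum.inl 0)) (ω.1 (Sum.inl 1)) - L.dens k (ω.1 (Sum.inl 2)) (ω.1 (Sum.inl 3))|
      * symEdgeProd F (L.dens k) (fun i => ω.1 (Sum.inr i))
  let D : J → (I → Cell k) × (I × T → Cell l) → ℝ := Sum.elim
    (fun r ω => if r.1.1 = r.2.1 then 0 else
      |L.dens l (ω.2 r.1) (ω.2 r.2) - L.dens k (ω.1 r.1.1) (ω.1 r.2.1)|)
    (fun r ω => open Classical in if Function.Injective r.1 ∧ r.2.1 ≠ r.2.2 then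
      |secondDiff (symEdgeProd F (L.dens l)) r.2.1 r.2.2 (fun a => ω.2 (r.1 a))| else 0)
  have hGκ : κ ≤ ∑ ω, w ω * G ω := by
    rw [hexp]
    simp only [G, ← sum_mul, hx1, one_mul]
    rw [L.sum_spread_mul_count k]
    exact hk1
  have hDδ : ∀ j, ∑ ω, w ω * D j ω ≤ η * (κ / 2) / (Fintype.card J + 1) := by
    rintro (r | r)
    · rw [hexp]
      simp only [D, Sum.elim_inl]
      by_cases hr : r.1.1 = r.2.1
      · simp only [hr, if_true, mul_zero, sum_const_zero]
        exact hδ.le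
      · simp only [hr, if_false]
        have hne : r.1 ≠ r.2 := fun h => hr (congrArg Prod.fst h)
        have h1 : ∀ c : I → Cell k, ∑ x : I × T → Cell l, (∏ j : I × T, q (c j.1) (x j))
            * |L.dens l (x r.1) (x r.2) - L.dens k (c r.1.1) (c r.2.1)|
            = ∑ a, ∑ a', q (c r.1.1) a * q (c r.2.1) a'
              * |L.dens l a a' - L.dens k (c r.1.1) (c r.2.1)| := fun c =>
          sum_prod_mul_pair hne (fun j : I × T => q (c j.1)) (fun j => hq1 _)
            fun a a' => |L.dens l a a' - L.dens k (c r.1.1) (c r.2.1)|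
        simp only [h1]
        rw [sum_prod_mul_pair hr (fun _ => L.mass k) (fun _ => L.sum_mass k)
          fun c c' => ∑ a, ∑ a', q c a * q c' a' * |L.dens l a a' - L.dens k c c'|,
          sum_mul_condMass_pair (L.mass_nonneg l) (L.mass_trunc hkl)
            fun c c' a a' => |L.dens l a a' - L.dens k c c'|]
        exact (L.dens_trunc hkl).trans hk2.le
    · rw [hexp]
      simp only [D, Sum.elim_inr]
      split_ifs with hr
      · refine le_trans ?_ (one_mul (η * (κ / 2) / (Fintype.card J + 1))).le
        refine le_trans ?_ (congrArg (· * _) hc1).le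
        rw [sum_mul]
        refine sum_le_sum fun c _ => mul_le_mul_of_nonneg_left ?_ (hP0 c)
        refine le_trans ?_ hl1.le
        rw [sum_prod_mul_comp hr.1 (fun j : I × T => q (c j.1)) (fun j => hq1 _)
          fun y => |secondDiff (symEdgeProd F (L.dens l)) r.2.1 r.2.2 y|]
        refine le_trans ?_ (mul_le_mul_of_nonneg_left
          (L.sum_abs_secondDiff_symEdgeProd_le hm l hr.2) (by positivity))
        rw [mul_sum]
        refine sum_le_sum fun y _ => ?_
        rw [← mul_assoc]
        refine mul_le_mul_of_nonneg_right ?_ (abs_nonneg _)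
        refine (prod_le_prod (fun a _ => hq0 _ _) fun a _ =>
          condMass_le (L.mass_nonneg k) (L.mass_nonneg l) _ _).trans_eq ?_
        rw [prod_mul_distrib, prod_const, card_univ, Fintype.card_sum, Fintype.card_fin,
          Fintype.card_bool]
      · simp only [mul_zero, sum_const_zero]
        exact hδ.le
  obtain ⟨ω, hω, hωD⟩ := exists_le_and_forall_le (w := w) (G := G) (D := D) (κ := κ)
    (δ := η * (κ / 2) / (Fintype.card J + 1))
    (fun ω => mul_nonneg (hP0 _) (prod_nonneg fun _ _ => hq0 _ _))
    (by simpa [hx1, hc1] using hexp fun _ => 1)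
    (fun ω => by
      have h1 := symEdgeProd_mem_Icc F (L.dens_mem k) (fun i => ω.1 (Sum.inr i))
      refine mul_le_one₀ ?_ h1.1 h1.2
      have h2 := L.dens_mem k (ω.1 (Sum.inl 0)) (ω.1 (Sum.inl 1))
      have h3 := L.dens_mem k (ω.1 (Sum.inl 2)) (ω.1 (Sum.inl 3))
      rw [abs_le]
      constructor <;> linarith [h2.1, h2.2, h3.1, h3.2])
    hκ hGκ
    (by
      rintro (r | r) ω
      · simp only [D, Sum.elim_inl]
        split_ifs <;> positivity
      · simp only [D, Sum.elim_inr]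
        split_ifs <;> positivity)
    hη hDδ
    (by
      rw [mul_div_assoc', div_le_iff₀ (by positivity)]
      have : 0 < η * (κ / 2) := by positivity
      nlinarith)
  refine ⟨fun s s' => L.dens k (ω.1 s) (ω.1 s'), fun x y => L.dens l (ω.2 x) (ω.2 y),
    fun _ _ => L.dens_mem k _ _, fun _ _ => L.dens_mem l _ _, fun _ _ => L.dens_comm l _ _,
    fun s s' t t' hs => ?_, fun e he' i j hij => ?_, hω⟩
  · have := hωD (Sum.inl ((s, t), (s', t')))
    simpa only [D, Sum.elim_inl, hs, if_false] using this
  · have := hωD (Sum.inr (e, (i, j)))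
    simp only [D, Sum.elim_inr] at this
    rw [if_pos ⟨he', hij⟩] at this
    exact this

end CellLimit

section Limits

variable {m : ℕ} (F : SimpleGraph (Fin m)) {ι Y Z : Type*} {l : Filter ι}

theorem tendsto_symEdgeProd {W : ι → Y → Y → ℝ} {y : ι → Fin m → Y} {β : Z → Z → ℝ}
    {t : Fin m → Z}
    (h : ∀ a b, a ≠ b → Tendsto (fun n => W n (y n a) (y n b)) l (nhds (β (t a) (t b)))) :
    Tendsto (fun n => symEdgeProd F (W n) (y n)) l (nhds (symEdgeProd F β t)) :=
  (tendsto_finsetSum _ fun σ _ => tendsto_finsetProd _ fun _ he =>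
    h _ _ fun hc => (mem_edgePairs.1 he).1.ne (σ.injective hc)).const_mul _

theorem tendsto_secondDiff {W : ι → Y → Y → ℝ} {y : ι → Fin m ⊕ Bool → Y} {β : Z → Z → ℝ}
    {t : Fin m ⊕ Bool → Z}
    (h : ∀ a b, a ≠ b → Tendsto (fun n => W n (y n a) (y n b)) l (nhds (β (t a) (t b))))
    (i j : Fin m) :
    Tendsto (fun n => secondDiff (symEdgeProd F (W n)) i j (y n)) l
      (nhds (secondDiff (symEdgeProd F β) i j t)) := by
  have key : ∀ ρ : Fin m → Fin m ⊕ Bool, Function.Injective ρ →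
      Tendsto (fun n => symEdgeProd F (W n) fun a => y n (ρ a)) l
        (nhds (symEdgeProd F β fun a => t (ρ a))) := fun ρ hρ =>
    tendsto_symEdgeProd F fun a b hab => h _ _ (hρ.ne hab)
  have h1 := injective_update_inl (b := false) Sum.inl_injective (by simp) i
  have h2 := injective_update_inl (b := true) Sum.inl_injective (by simp) j
  have h3 := injective_update_inl (b := true) h1 (fun a => by
      by_cases ha : a = i
      · subst ha; simp
      · simp [ha]) j
  exact (((key _ Sum.inl_injective).sub (key _ h1)).sub (key _ h2)).add (key _ h3)

theorem secondDiff_symEdgeProd_comp (B : Z → Z → ℝ) (c : Y → Z) (i j : Fin m)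
    (e : Fin m ⊕ Bool → Y) : secondDiff (symEdgeProd F fun x y => B (c x) (c y)) i j e
      = secondDiff (symEdgeProd F B) i j (fun a => c (e a)) := rfl

end Limits

/-- A finite family of symmetric arrays is approximately constant off the diagonal on some
infinite-to-finite selection of indices. -/
theorem exists_approx_homogeneous {I : Type*} [Finite I] {f : I → ℕ → ℕ → ℝ}
    (hf : ∀ s a b, f s a b ∈ Set.Icc (0 : ℝ) 1) (hsymm : ∀ s a b, f s a b = f s b a) :
    ∃ γ : I → ℝ, (∀ s, γ s ∈ Set.Icc (0 : ℝ) 1) ∧ ∀ (η : ℝ), 0 < η → ∀ n : ℕ,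
      ∃ S : Finset ℕ, S.card = n ∧ ∀ s, ∀ a ∈ S, ∀ b ∈ S, a ≠ b → |f s a b - γ s| < η := by
  let 𝒰 : Ultrafilter ℕ := Ultrafilter.of atTop
  have h𝒰 : (𝒰 : Filter ℕ) ≤ atTop := Ultrafilter.of_le _
  choose g hg hgl using fun s a => exists_tendsto_of_mem_Icc 𝒰 (f s a) (hf s a)
  choose γ hγ hγl using fun s => exists_tendsto_of_mem_Icc 𝒰 (g s) (hg s)
  refine ⟨γ, hγ, fun η hη n => ?_⟩
  suffices h : ∃ S : Finset ℕ, S.card = n ∧ (∀ s, ∀ a ∈ S, |g s a - γ s| < η) ∧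
      ∀ s, ∀ a ∈ S, ∀ b ∈ S, a ≠ b → |f s a b - γ s| < η by
    obtain ⟨S, h1, _, h2⟩ := h
    exact ⟨S, h1, h2⟩
  induction n with
  | zero => exact ⟨∅, by simp⟩
  | succ n ih =>
    obtain ⟨S, hS, h1, h2⟩ := ih
    have e1 : ∀ᶠ x in (𝒰 : Filter ℕ), ∀ s, |g s x - γ s| < η :=
      eventually_all.2 fun s => by
        simpa [Real.dist_eq] using (Metric.tendsto_nhds.1 (hγl s)) η hη
    have e2 : ∀ᶠ x in (𝒰 : Filter ℕ), ∀ s, ∀ a ∈ S, |f s a x - γ s| < η := by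
      refine eventually_all.2 fun s => (eventually_all_finset S).2 fun a ha => ?_
      exact ((hgl s a).sub_const (γ s)).abs.eventually (gt_mem_nhds (h1 s a ha))
    have e3 : ∀ᶠ x in (𝒰 : Filter ℕ), ∀ a ∈ S, a < x :=
      (eventually_all_finset S).2 fun a _ => h𝒰 (eventually_gt_atTop a)
    obtain ⟨x, hx1, hx2, hx3⟩ := (e1.and (e2.and e3)).exists
    have hxS : x ∉ S := fun hx => (hx3 x hx).ne rfl
    refine ⟨insert x S, by rw [card_insert_of_notMem hxS, hS], fun s a ha => ?_,
      fun s a ha b hb hab => ?_⟩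
    · rcases mem_insert.1 ha with rfl | ha
      · exact hx1 s
      · exact h1 s a ha
    · rcases mem_insert.1 ha with rfl | ha' <;> rcases mem_insert.1 hb with rfl | hb'
      · exact (hab rfl).elim
      · rw [hsymm]
        exact hx2 s b hb'
      · exact hx2 s a ha'
      · exact h2 s a ha' b hb' hab

/-- From a limit object one obtains a finite symmetric kernel, not constant, whose symmetrized
counts have vanishing mixed second differences. -/
theorem CellLimit.exists_kernel {m : ℕ} {F : SimpleGraph (Fin m)} {p : ℝ} (L : CellLimit F p)
    (hm : 0 < m) (hp : 0 < p) (he : 0 < numEdges F) :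
    ∃ β : Fin 4 ⊕ Fin m → Fin 4 ⊕ Fin m → ℝ, (∀ s s', β s s' = β s' s) ∧
      (∀ s s', β s s' ∈ Set.Icc (0 : ℝ) 1) ∧
      (∀ t : Fin m ⊕ Bool → Fin 4 ⊕ Fin m, ∀ i j, i ≠ j →
        secondDiff (symEdgeProd F β) i j t = 0) ∧
      0 < |β (Sum.inl 0) (Sum.inl 1) - β (Sum.inl 2) (Sum.inl 3)|
        * symEdgeProd F β (fun i => Sum.inr i) := by
  classical
  obtain ⟨κ, hκ, hex⟩ := L.exists_array hm hp he
  choose b B hb hB hBsymm hBb hdiff hκb using fun n : ℕ =>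
    hex (Fin (n + 1)) (1 / ((n : ℝ) + 1)) (by positivity)
  let 𝒰 : Ultrafilter ℕ := Ultrafilter.of atTop
  have h𝒰 : (𝒰 : Filter ℕ) ≤ atTop := Ultrafilter.of_le _
  have hη : Tendsto (fun n : ℕ => 1 / ((n : ℝ) + 1)) 𝒰 (nhds 0) :=
    tendsto_one_div_add_atTop_nhds_zero_nat.mono_left h𝒰
  choose b' hb' hbl using fun s s' => exists_tendsto_of_mem_Icc 𝒰 (fun n => b n s s')
    fun n => hb n s s'
  let clamp : ∀ n : ℕ, (Fin 4 ⊕ Fin m) × ℕ → (Fin 4 ⊕ Fin m) × Fin (n + 1) :=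
    fun n x => (x.1, Fin.ofNat (n + 1) x.2)
  choose B' hB' hBl using fun x y => exists_tendsto_of_mem_Icc 𝒰
    (fun n => B n (clamp n x) (clamp n y)) fun n => hB n _ _
  have hBsymm' : ∀ x y, B' x y = B' y x := fun x y =>
    tendsto_nhds_unique (hBl x y) (by simpa only [hBsymm _ (clamp _ x)] using hBl y x)
  have hBb' : ∀ s s' t t', s ≠ s' → B' (s, t) (s', t') = b' s s' := by
    intro s s' t t' hs
    have h1 := ((hBl (s, t) (s', t')).sub (hbl s s')).abs
    have h2 := le_of_tendsto_of_tendsto h1 hη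
      (Eventually.of_forall fun n => hBb n s s' _ _ hs)
    exact sub_eq_zero.1 (abs_nonpos_iff.1 h2)
  have hdiff' : ∀ e : Fin m ⊕ Bool → (Fin 4 ⊕ Fin m) × ℕ, Function.Injective e → ∀ i j, i ≠ j →
      secondDiff (symEdgeProd F B') i j e = 0 := by
    intro e he' i j hij
    have h1 := tendsto_secondDiff F (W := fun n x y => B n (clamp n x) (clamp n y)) (y := fun _ => e)
      (β := B') (t := e) (l := (𝒰 : Filter ℕ)) (fun a b _ => hBl _ _) i j
    refine abs_nonpos_iff.1 (le_of_tendsto_of_tendsto h1.abs hη ?_)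
    have h2 : ∀ᶠ n in (𝒰 : Filter ℕ), ∀ a, (e a).2 ≤ n :=
      eventually_all.2 fun a => h𝒰 (eventually_ge_atTop _)
    filter_upwards [h2] with n hn
    rw [secondDiff_symEdgeProd_comp F (B n) (clamp n)]
    refine hdiff n (fun a => clamp n (e a)) (fun a a' haa => he' ?_) i j hij
    have h3 := Prod.ext_iff.1 haa
    refine Prod.ext h3.1 ?_
    have h4 : (e a).2 % (n + 1) = (e a').2 % (n + 1) := congrArg Fin.val h3.2
    rwa [Nat.mod_eq_of_lt (Nat.lt_succ_of_le (hn a)),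
      Nat.mod_eq_of_lt (Nat.lt_succ_of_le (hn a'))] at h4
  obtain ⟨γ, hγ, hsel⟩ := exists_approx_homogeneous (f := fun s a b => B' (s, a) (s, b))
    (fun s a b => hB' _ _) fun s a b => hBsymm' _ _
  let β : Fin 4 ⊕ Fin m → Fin 4 ⊕ Fin m → ℝ := fun s s' => if s = s' then γ s else b' s s'
  have hβne : ∀ {s s'}, s ≠ s' → β s s' = b' s s' := fun h => if_neg h
  refine ⟨β, fun s s' => ?_, fun s s' => ?_, fun t i j hij => ?_, ?_⟩
  · by_cases h : s = s'
    · rw [h]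
    · rw [hβne h, hβne (Ne.symm h), ← hBb' s s' 0 0 h, ← hBb' s' s 0 0 (Ne.symm h), hBsymm']
  · by_cases h : s = s'
    · subst h
      simpa [β] using hγ s
    · rw [hβne h]
      exact hb' s s'
  · choose S hS hSγ using fun n : ℕ => hsel (1 / ((n : ℝ) + 1)) (by positivity)
      (Fintype.card (Fin m ⊕ Bool))
    let y : ∀ n : ℕ, Fin m ⊕ Bool → ℕ := fun n a =>
      (S n).orderEmbOfFin (hS n) (Fintype.equivFin _ a)
    have hy : ∀ n, Function.Injective (y n) := fun n =>
      ((S n).orderEmbOfFin (hS n)).injective.comp (Fintype.equivFin _).injective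
    have hyS : ∀ n a, y n a ∈ S n := fun n a => orderEmbOfFin_mem _ _ _
    have h1 := tendsto_secondDiff F (W := fun _ : ℕ => B') (y := fun n a => (t a, y n a))
      (β := β) (t := t) (l := atTop) (fun a b hab => by
        by_cases h : t a = t b
        · have h2 : β (t a) (t b) = γ (t a) := by simp [β, h]
          rw [h2, tendsto_iff_norm_sub_tendsto_zero]
          refine squeeze_zero (fun n => norm_nonneg _) (fun n => ?_)
            tendsto_one_div_add_atTop_nhds_zero_nat
          rw [← h, Real.norm_eq_abs]
          exact (hSγ n (t a) _ (hyS n a) _ (hyS n b) fun hc => hab (hy n hc)).le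
        · rw [hβne h]
          simp only [hBb' _ _ _ _ h]
          exact tendsto_const_nhds) i j
    have h2 : ∀ n, secondDiff (symEdgeProd F B') i j (fun a => (t a, y n a)) = 0 := fun n =>
      hdiff' _ (fun a a' haa => hy n (Prod.ext_iff.1 haa).2) i j hij
    simp only [h2] at h1
    exact (tendsto_nhds_unique h1 tendsto_const_nhds)
  · refine hκ.trans_le ?_
    rw [hβne (by simp), hβne (by simp)]
    refine ge_of_tendsto' (((hbl _ _).sub (hbl _ _)).abs.mul
      (tendsto_symEdgeProd F (W := b) (y := fun _ i => Sum.inr i) (β := β)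
        (t := fun i => Sum.inr i) fun i j hij => ?_)) hκb
    rw [hβne (by simpa using hij)]
    exact hbl _ _

section Separation

variable {m : ℕ} {X : Type*} {S : (Fin m → X) → ℝ}

theorem add_eq_add_of_secondDiff_eq_zero
    (h : ∀ x : Fin m ⊕ Bool → X, ∀ i j, i ≠ j → secondDiff S i j x = 0) (x : Fin m → X)
    {i j : Fin m} (hij : i ≠ j) (a b : X) :
    S (Function.update (Function.update x i a) j b) - S (Function.update x i a)
      = S (Function.update x j b) - S x := by
  have h1 := h (Sum.elim x fun t => if t then b else a) i j hij
  have e1 : (fun l => (Sum.elim x fun t => if t = true then b else a : Fin m ⊕ Bool → X)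
      (Function.update Sum.inl i (Sum.inr false) l)) = Function.update x i a := by
    funext l
    by_cases hl : l = i
    · subst hl; simp
    · simp [hl]
  have e2 : (fun l => (Sum.elim x fun t => if t = true then b else a : Fin m ⊕ Bool → X)
      (Function.update Sum.inl j (Sum.inr true) l)) = Function.update x j b := by
    funext l
    by_cases hl : l = j
    · subst hl; simp
    · simp [hl]
  have e3 : (fun l => (Sum.elim x fun t => if t = true then b else a : Fin m ⊕ Bool → X)
      (Function.update (Function.update Sum.inl i (Sum.inr false)) j (Sum.inr true) l))
      = Function.update (Function.update x i a) j b := by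
    funext l
    by_cases hl : l = j
    · subst hl; simp
    · by_cases hl' : l = i
      · subst hl'; simp [hl]
      · simp [hl, hl']
  rw [secondDiff, e1, e2, e3] at h1
  simp only [Sum.elim_inl] at h1
  linarith

theorem piecewise_sub_of_secondDiff_eq_zero
    (h : ∀ x : Fin m ⊕ Bool → X, ∀ i j, i ≠ j → secondDiff S i j x = 0) (r t : Fin m → X)
    (A : Finset (Fin m)) (j : Fin m) (hj : j ∉ A) (b : X) :
    S (Function.update (A.piecewise t r) j b) - S (A.piecewise t r)
      = S (Function.update r j b) - S r := by
  induction A using Finset.induction_on with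
  | empty => simp
  | insert i A hi ih =>
    rw [mem_insert, not_or] at hj
    rw [piecewise_insert, add_eq_add_of_secondDiff_eq_zero h _ (Ne.symm hj.1), ih hj.2]

theorem piecewise_eq_of_secondDiff_eq_zero
    (h : ∀ x : Fin m ⊕ Bool → X, ∀ i j, i ≠ j → secondDiff S i j x = 0) (r t : Fin m → X)
    (A : Finset (Fin m)) :
    S (A.piecewise t r) = S r + ∑ i ∈ A, (S (Function.update r i (t i)) - S r) := by
  induction A using Finset.induction_on with
  | empty => simp
  | insert i A hi ih =>
    rw [sum_insert hi, piecewise_insert]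
    linarith [piecewise_sub_of_secondDiff_eq_zero h r t A i hi (t i)]

/-- A symmetric function with vanishing mixed second differences is an average of its values on
the diagonal. -/
theorem mul_eq_sum_diag_of_secondDiff_eq_zero (hm : 0 < m)
    (hperm : ∀ (x : Fin m → X) (σ : Equiv.Perm (Fin m)), S (fun i => x (σ i)) = S x)
    (h : ∀ x : Fin m ⊕ Bool → X, ∀ i j, i ≠ j → secondDiff S i j x = 0) (t : Fin m → X) :
    m * S t = ∑ i, S fun _ => t i := by
  have i₀ : Fin m := ⟨0, hm⟩
  let r : Fin m → X := fun _ => t i₀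
  have hswap : ∀ i a, S (Function.update r i a) = S (Function.update r i₀ a) := by
    intro i a
    rw [← hperm (Function.update r i₀ a) (Equiv.swap i i₀)]
    congr 1
    funext l
    by_cases hl : l = i
    · subst hl; simp
    · have : Equiv.swap i i₀ l ≠ i₀ := fun hc => hl (by
        rw [Equiv.swap_apply_eq_iff, Equiv.swap_apply_right] at hc
        exact hc)
      simp [hl, this, r]
  have key : ∀ t : Fin m → X, S t = S r + ∑ i, (S (Function.update r i₀ (t i)) - S r) := by
    intro t
    have h1 := piecewise_eq_of_secondDiff_eq_zero h r t univ
    rw [piecewise_univ] at h1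
    simpa only [hswap] using h1
  have hdiag : ∀ a, S (fun _ => a) = S r + m * (S (Function.update r i₀ a) - S r) := by
    intro a
    rw [key fun _ => a, sum_const, card_univ, Fintype.card_fin, nsmul_eq_mul]
  simp only [hdiag]
  rw [key t, sum_add_distrib, sum_const, card_univ, Fintype.card_fin, nsmul_eq_mul, mul_add,
    mul_sum]

end Separation

/-- A nonconstant finite kernel whose symmetrized counts have vanishing mixed second differences
yields an affine family of weighted counts. -/
theorem exists_affine_of_secondDiff_eq_zero {m : ℕ} (F : SimpleGraph (Fin m)) (hm : 0 < m)
    (he : 0 < numEdges F) {I : Type*} {β : I → I → ℝ} (hβs : ∀ s s', β s s' = β s' s)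
    (hβ : ∀ s s', β s s' ∈ Set.Icc (0 : ℝ) 1)
    (h : ∀ x : Fin m ⊕ Bool → I, ∀ i j, i ≠ j → secondDiff (symEdgeProd F β) i j x = 0)
    {s₀ s₁ s₂ s₃ : I} (hne : β s₀ s₁ ≠ β s₂ s₃) {t : Fin m → I} (ht : symEdgeProd F β t ≠ 0) :
    ∃ u v s : ℝ, 0 ≤ u ∧ 0 ≤ v ∧ 0 ≤ s ∧ ¬ (u = v ∧ v = s) ∧
      ∃ a b : ℝ, ¬ (a = 0 ∧ b = 0) ∧ ∀ k ≤ m,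
        ∑ A ∈ Finset.powersetCard k (Finset.univ : Finset (Fin m)),
            u ^ edgesIn F A * v ^ edgesIn F Aᶜ * s ^ edgesBetween F A Aᶜ
          = (m.choose k : ℝ) * (a + b * k) := by
  have hm' : (m : ℝ) ≠ 0 := by exact_mod_cast hm.ne'
  have hdiag : ∀ a, symEdgeProd F β (fun _ => a) = β a a ^ numEdges F := fun a => by
    rw [numEdges_eq_card, ← prod_const]
    exact symEdgeProd_of_edgeProd_const fun σ => rfl
  have key : ∀ t : Fin m → I, m * symEdgeProd F β t = ∑ i, β (t i) (t i) ^ numEdges F := by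
    intro t
    rw [mul_eq_sum_diag_of_secondDiff_eq_zero hm (symEdgeProd_perm F β) h t]
    simp only [hdiag]
  by_cases hpair : ∃ s s', ¬ (β s s = β s' s' ∧ β s' s' = β s s') ∧ ¬ (β s s = 0 ∧ β s' s' = 0)
  · obtain ⟨s, s', h1, h2⟩ := hpair
    set u := β s s
    set v := β s' s'
    refine ⟨u, v, β s s', (hβ _ _).1, (hβ _ _).1, (hβ _ _).1, h1, v ^ numEdges F,
      (u ^ numEdges F - v ^ numEdges F) / m, ?_, fun k hk => ?_⟩
    · rintro ⟨h3, h4⟩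
      have h5 := (div_eq_zero_iff.1 h4).resolve_right hm'
      rw [h3, sub_zero] at h5
      exact h2 ⟨(pow_eq_zero_iff he.ne').1 h5, (pow_eq_zero_iff he.ne').1 h3⟩
    · obtain ⟨A, _, hA⟩ := exists_subset_card_eq
        (show k ≤ (univ : Finset (Fin m)).card by simpa using hk)
      simp only [weight_eq_edgeProd]
      subst hA
      rw [← choose_mul_symEdgeProd]
      congr 1
      have hker : typeKernel u v (β s s') = fun x y : Bool =>
          β (if x then s else s') (if y then s else s') := by
        funext x y
        cases x <;> cases y <;> simp [typeKernel, u, v, hβs s' s]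
      have h3 := key fun i => if typeOf A i then s else s'
      have h4 : symEdgeProd F (typeKernel u v (β s s')) (typeOf A)
          = symEdgeProd F β fun i => if typeOf A i then s else s' := by
        rw [hker]
        rfl
      have h5 : ∀ i, β (if typeOf A i then s else s') (if typeOf A i then s else s') ^ numEdges F
          = v ^ numEdges F + if i ∈ A then u ^ numEdges F - v ^ numEdges F else 0 := by
        intro i
        by_cases hi : i ∈ A <;> simp [typeOf, hi, u, v]
      rw [h4, ← mul_right_inj' hm', h3]
      simp only [h5, sum_add_distrib, sum_const, card_univ, Fintype.card_fin, nsmul_eq_mul,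
        sum_ite_mem, univ_inter]
      field_simp
  · push Not at hpair
    exfalso
    have h1 : ∀ s s', β s s = β s' s' := by
      intro s s'
      by_contra hc
      have := hpair s s' fun h => absurd h hc
      exact hc (this.1.trans this.2.symm)
    by_cases h0 : β s₀ s₀ = 0
    · refine ht ?_
      have h2 := key t
      simp only [fun i => h1 (t i) s₀, h0, zero_pow he.ne', sum_const_zero] at h2
      exact (mul_eq_zero.1 h2).resolve_left hm'
    · have h2 : ∀ s s', β s s' = β s₀ s₀ := by
        intro s s'
        by_contra hc
        have := hpair s s' fun _ h => hc (h.symm.trans (h1 _ _))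
        exact h0 ((h1 _ _).trans this.1)
      exact hne ((h2 _ _).trans (h2 _ _).symm)

/-- A sequence of kernels which are not quasi-random but satisfy the balanced symmetrized counting
condition yields an affine family of weighted counts. -/
theorem exists_affine_of_kernels {m : ℕ} (F : SimpleGraph (Fin m)) {p : ℝ} (hp : 0 < p) {V : ℕ → ℕ}
    (hV : Tendsto V atTop atTop) {w : ∀ n, Fin (V n) → Fin (V n) → ℝ}
    (hsym : ∀ n x y, w n x y = w n y x) (hw : ∀ n x y, w n x y ∈ Set.Icc (0 : ℝ) 1)
    {ε : ℕ → ℝ} (hε : Tendsto ε atTop (nhds 0))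
    (hcount : ∀ n, ∀ U : Fin m → Finset (Fin (V n)), (Pairwise fun i j => Disjoint (U i) (U j)) →
      (∀ i, (U i).card = ⌊1 / (m : ℝ) * (V n : ℝ)⌋₊) →
      |∑ x : Fin m → Fin (V n), symEdgeProd F (w n) x * ∏ i, (if x i ∈ U i then (1 : ℝ) else 0)
        - p ^ numEdges F * ∏ i, ((U i).card : ℝ)| ≤ ε n * (V n : ℝ) ^ m)
    {c : ℝ} (hc : 0 < c) (hbad : ∃ᶠ n in atTop, ¬ CutLe (fun x y => w n x y - p) c) :
    ∃ u v s : ℝ, 0 ≤ u ∧ 0 ≤ v ∧ 0 ≤ s ∧ ¬ (u = v ∧ v = s) ∧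
      ∃ a b : ℝ, ¬ (a = 0 ∧ b = 0) ∧ ∀ k ≤ m,
        ∑ A ∈ Finset.powersetCard k (Finset.univ : Finset (Fin m)),
            u ^ edgesIn F A * v ^ edgesIn F Aᶜ * s ^ edgesBetween F A Aᶜ
          = (m.choose k : ℝ) * (a + b * k) := by
  by_cases he : 0 < numEdges F
  · have hm : 0 < m := by
      rw [numEdges_eq_card, card_pos] at he
      obtain ⟨e, _⟩ := he
      exact e.1.pos
    obtain ⟨L⟩ := exists_cellLimit F hV hsym hw hε hcount hc hbad
    obtain ⟨β, hβs, hβ, h, hpos⟩ := L.exists_kernel hm hp he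
    exact exists_affine_of_secondDiff_eq_zero F hm he hβs hβ h
      (sub_ne_zero.1 (abs_ne_zero.1 (left_ne_zero_of_mul hpos.ne'))) (right_ne_zero_of_mul hpos.ne')
  · have h0 : edgePairs F = ∅ := by
      rw [← card_eq_zero, ← numEdges_eq_card]
      omega
    refine ⟨0, 0, 1, le_rfl, le_rfl, zero_le_one, by simp, 1, 0, by simp, fun k hk => ?_⟩
    simp only [weight_eq_edgeProd, edgeProd, h0, prod_empty]
    simp

section UnitMeasure

/-- Lebesgue measure on `[0,1)`. -/
noncomputable def unitMeasure : Measure ℝ := volume.restrict (Set.Ico 0 1)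

instance : IsProbabilityMeasure unitMeasure :=
  ⟨by rw [unitMeasure, Measure.restrict_apply_univ, Real.volume_Ico]; simp⟩

theorem unitMeasure_prod :
    unitMeasure.prod unitMeasure = (volume : Measure (ℝ × ℝ)).restrict unitSquare := by
  rw [unitMeasure, Measure.restrict_congr_set (Ico_ae_eq_Icc (μ := volume)),
    Measure.prod_restrict, Measure.volume_eq_prod, unitSquare]

theorem measurePreserving_pi_pair {m : ℕ} {Ω : Type*} [MeasurableSpace Ω] (μ : Measure Ω)
    [IsProbabilityMeasure μ] {i j : Fin m} (hij : i ≠ j) :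
    MeasurePreserving (fun x : Fin m → Ω => (x i, x j)) (Measure.pi fun _ => μ) (μ.prod μ) := by
  refine ⟨by fun_prop, ?_⟩
  have h : ProbabilityTheory.IndepFun (fun x : Fin m → Ω => x i) (fun x => x j)
      (Measure.pi fun _ => μ) := (ProbabilityTheory.iIndepFun_pi (ι := Fin m) (μ := fun _ => μ)
    (X := fun _ => (id : Ω → Ω)) (fun _ => aemeasurable_id)).indepFun hij
  rw [ProbabilityTheory.indepFun_iff_map_prod_eq_prod_map_map 
    (measurable_pi_apply i).aemeasurable (measurable_pi_apply j).aemeasurable] at h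
  have e : ∀ k : Fin m, Measure.map (fun x : Fin m → Ω => x k) (Measure.pi fun _ => μ) = μ :=
    fun k => (measurePreserving_eval (fun _ : Fin m => μ) k).map_eq
  rw [e, e] at h
  exact h

variable {m : ℕ}

theorem measurable_symEdgeProd {Ω : Type*} [MeasurableSpace Ω] (F : SimpleGraph (Fin m))
    {W : Ω → Ω → ℝ} (hW : Measurable (Function.uncurry W)) :
    Measurable fun x : Fin m → Ω => symEdgeProd F W x := by
  unfold symEdgeProd edgeProd
  refine Measurable.const_mul (Finset.measurable_fun_sum _ fun σ _ =>
    Finset.measurable_fun_prod _ fun e _ => ?_) _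
  exact hW.comp (f := fun x : Fin m → Ω => (x (σ e.1), x (σ e.2)))
    ((measurable_pi_apply _).prodMk (measurable_pi_apply _))

theorem integral_abs_symEdgeProd_sub_le {Ω : Type*} [MeasurableSpace Ω] (μ : Measure Ω)
    [IsProbabilityMeasure μ] (F : SimpleGraph (Fin m)) {W W' : Ω → Ω → ℝ}
    (hWm : Measurable (Function.uncurry W)) (hWm' : Measurable (Function.uncurry W'))
    (hW : ∀ x y, W x y ∈ Set.Icc (0 : ℝ) 1) (hW' : ∀ x y, W' x y ∈ Set.Icc (0 : ℝ) 1) :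
    ∫ x, |symEdgeProd F W x - symEdgeProd F W' x| ∂(Measure.pi fun _ => μ)
      ≤ numEdges F * ∫ z, |W z.1 z.2 - W' z.1 z.2| ∂(μ.prod μ) := by
  have hdm : Measurable fun z : Ω × Ω => |W z.1 z.2 - W' z.1 z.2| :=
    measurable_abs.comp (hWm.sub hWm')
  have hdi : Integrable (fun z : Ω × Ω => |W z.1 z.2 - W' z.1 z.2|) (μ.prod μ) := by
    refine Integrable.of_bound hdm.aestronglyMeasurable 1 (Eventually.of_forall fun z => ?_)
    rw [Real.norm_eq_abs, abs_abs]
    exact abs_sub_le_of_le_of_le (hW _ _).1 (hW _ _).2 (hW' _ _).1 (hW' _ _).2 |>.trans (by simp)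
  have hmp : ∀ (σ : Equiv.Perm (Fin m)), ∀ e ∈ edgePairs F,
      MeasurePreserving (fun x : Fin m → Ω => (x (σ e.1), x (σ e.2)))
        (Measure.pi fun _ => μ) (μ.prod μ) := fun σ e he =>
    measurePreserving_pi_pair μ (σ.injective.ne (mem_edgePairs.1 he).1.ne)
  have hintegrable : ∀ (σ : Equiv.Perm (Fin m)), ∀ e ∈ edgePairs F,
      Integrable (fun x : Fin m → Ω => |W (x (σ e.1)) (x (σ e.2)) - W' (x (σ e.1)) (x (σ e.2))|)
        (Measure.pi fun _ => μ) := fun σ e he =>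
    (hmp σ e he).integrable_comp_of_integrable hdi
  calc ∫ x, |symEdgeProd F W x - symEdgeProd F W' x| ∂(Measure.pi fun _ => μ)
      ≤ ∫ x, (m.factorial : ℝ)⁻¹ * ∑ σ : Equiv.Perm (Fin m), ∑ e ∈ edgePairs F,
          |W (x (σ e.1)) (x (σ e.2)) - W' (x (σ e.1)) (x (σ e.2))| ∂(Measure.pi fun _ => μ) := by
        refine integral_mono_of_nonneg (Eventually.of_forall fun _ => abs_nonneg _) ?_
          (Eventually.of_forall fun x => ?_)
        · exact (integrable_finsetSum _ fun σ _ => integrable_finsetSum _ fun e he =>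
            hintegrable σ e he).const_mul _
        · simp only [symEdgeProd, ← mul_sub, ← sum_sub_distrib, abs_mul]
          rw [abs_of_nonneg (by positivity : (0 : ℝ) ≤ (m.factorial : ℝ)⁻¹)]
          gcongr
          exact (abs_sum_le_sum_abs _ _).trans (sum_le_sum fun σ _ =>
            abs_edgeProd_sub_le F hW hW' _ _)
    _ = numEdges F * ∫ z, |W z.1 z.2 - W' z.1 z.2| ∂(μ.prod μ) := by
        rw [integral_const_mul, integral_finsetSum _ fun σ _ => integrable_finsetSum _ fun e he =>
          hintegrable σ e he]
        have : ∀ σ : Equiv.Perm (Fin m), ∫ x, ∑ e ∈ edgePairs F,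
            |W (x (σ e.1)) (x (σ e.2)) - W' (x (σ e.1)) (x (σ e.2))| ∂(Measure.pi fun _ => μ)
            = numEdges F * ∫ z, |W z.1 z.2 - W' z.1 z.2| ∂(μ.prod μ) := fun σ => by
          rw [integral_finsetSum _ fun e he => hintegrable σ e he, numEdges_eq_card, ← nsmul_eq_mul]
          refine sum_eq_card_nsmul fun e he => ?_
          rw [← (hmp σ e he).map_eq, integral_map (hmp σ e he).aemeasurable]
          exact hdm.aestronglyMeasurable
        rw [sum_congr rfl fun σ _ => this σ, sum_const, card_univ, Fintype.card_perm,
          Fintype.card_fin, nsmul_eq_mul, ← mul_assoc, inv_mul_cancel₀ (by positivity), one_mul]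

theorem abs_setIntegral_symEdgeProd_sub_le (F : SimpleGraph (Fin m)) {W W' : ℝ → ℝ → ℝ}
    (hWm : Measurable (Function.uncurry W)) (hWm' : Measurable (Function.uncurry W'))
    (hW : ∀ x y, W x y ∈ Set.Icc (0 : ℝ) 1) (hW' : ∀ x y, W' x y ∈ Set.Icc (0 : ℝ) 1)
    {A : Fin m → Set ℝ} (hA : ∀ i, A i ⊆ Set.Ico 0 1) :
    |(∫ x in Set.univ.pi A, symEdgeProd F W x) - ∫ x in Set.univ.pi A, symEdgeProd F W' x|
      ≤ numEdges F * ∫ z, |W z.1 z.2 - W' z.1 z.2| ∂(unitMeasure.prod unitMeasure) := by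
  have hbd : ∀ {W : ℝ → ℝ → ℝ}, Measurable (Function.uncurry W) →
      (∀ x y, W x y ∈ Set.Icc (0 : ℝ) 1) → ∀ (ν : Measure (Fin m → ℝ)) [IsFiniteMeasure ν],
      Integrable (fun x => symEdgeProd F W x) ν := fun hm h ν _ => by
    refine Integrable.of_bound (measurable_symEdgeProd F hm).aestronglyMeasurable 1
      (Eventually.of_forall fun x => ?_)
    rw [Real.norm_eq_abs, abs_of_nonneg (symEdgeProd_mem_Icc F h x).1]
    exact (symEdgeProd_mem_Icc F h x).2
  have hr : (volume : Measure (Fin m → ℝ)).restrict (Set.univ.pi A)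
      = (Measure.pi fun _ => unitMeasure).restrict (Set.univ.pi A) := by
    rw [unitMeasure, volume_pi, ← Measure.restrict_pi_pi, Measure.restrict_restrict_of_subset
      (Set.pi_mono fun i _ => hA i)]
  rw [hr, ← integral_sub (hbd hWm hW _) (hbd hWm' hW' _)]
  refine abs_integral_le_integral_abs.trans (le_trans ?_
    (integral_abs_symEdgeProd_sub_le unitMeasure F hWm hWm' hW hW'))
  exact setIntegral_le_integral ((hbd hWm hW _).sub (hbd hWm' hW' _)).abs
    (Eventually.of_forall fun _ => abs_nonneg _)

end UnitMeasure

theorem exists_affine_of_not_isQuasirandom_iff {m : ℕ} (F : SimpleGraph (Fin m)) {p : ℝ}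
    (hp0 : 0 < p) (hp1 : p ≤ 1) {V : ℕ → ℕ} {G : ∀ n, SimpleGraph (Fin (V n))}
    (hV : Tendsto V atTop atTop)
    (h : ¬ (SatisfiesPt F p (fun _ => 1 / (m : ℝ)) V G ↔ IsQuasirandom p V G)) :
    ∃ u v s : ℝ, 0 ≤ u ∧ 0 ≤ v ∧ 0 ≤ s ∧ ¬ (u = v ∧ v = s) ∧
      ∃ a b : ℝ, ¬ (a = 0 ∧ b = 0) ∧ ∀ k ≤ m,
        ∑ A ∈ Finset.powersetCard k (Finset.univ : Finset (Fin m)),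
            u ^ edgesIn F A * v ^ edgesIn F Aᶜ * s ^ edgesBetween F A Aᶜ
          = (m.choose k : ℝ) * (a + b * k) := by
  have hp : p ∈ Set.Icc (0 : ℝ) 1 := ⟨hp0.le, hp1⟩
  have hnq : ¬ IsQuasirandom p V G := fun hq =>
    h ⟨fun _ => hq, fun _ => satisfiesPt_of_isQuasirandom hp hV hq F _⟩
  have hs : SatisfiesPt F p (fun _ => 1 / (m : ℝ)) V G := by
    by_contra hs
    exact h ⟨fun h => absurd h hs, fun h => absurd h hnq⟩
  obtain ⟨ε, hε, hcount⟩ := hs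
  have hcut : ∃ c > 0, ∃ᶠ n in atTop, ¬ CutLe (fun x y => adjKernel (G n) x y - p) c := by
    by_contra! hcut
    refine hnq (isQuasirandom_of_cutLe hp hV fun c hc => ?_)
    simpa [Filter.Frequently] using hcut c hc
  obtain ⟨c, hc, hbad⟩ := hcut
  refine exists_affine_of_kernels F hp0 hV (fun n => adjKernel_comm (G n))
    (fun n => adjKernel_mem_Icc (G n)) hε (fun n U hU hcard => ?_) hc hbad
  have h1 := hcount n U hU hcard
  rw [symCount_eq_sum F (G n) U hU] at h1
  convert h1

section Cells

/-- The index of the cell `[i/N, (i+1)/N)` containing a point of `[0,1)`. -/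
noncomputable def cell {N : ℕ} (hN : 0 < N) (x : ℝ) : Fin N :=
  ⟨⌊(N : ℝ) * x⌋₊ % N, Nat.mod_lt _ hN⟩

variable {N : ℕ} (hN : 0 < N)

theorem measurable_cell : Measurable (cell hN) := by
  refine (measurable_of_countable fun k : ℕ => (⟨k % N, Nat.mod_lt _ hN⟩ : Fin N)).comp ?_
  exact Nat.measurable_floor.comp (measurable_const_mul _)

theorem measurableSet_cell_preimage (s : Set (Fin N)) : MeasurableSet (cell hN ⁻¹' s) :=
  measurable_cell hN (Set.toFinite s).measurableSet

theorem cell_val {x : ℝ} (hx : x ∈ Set.Ico (0 : ℝ) 1) : (cell hN x : ℕ) = ⌊(N : ℝ) * x⌋₊ := by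
  have hNr : (0 : ℝ) < N := by exact_mod_cast hN
  refine Nat.mod_eq_of_lt ?_
  rw [Nat.floor_lt (mul_nonneg hNr.le hx.1)]
  nlinarith [hx.2]

theorem cell_preimage_inter (i : Fin N) :
    cell hN ⁻¹' {i} ∩ Set.Ico 0 1 = Set.Ico ((i : ℝ) / N) (((i : ℝ) + 1) / N) := by
  have hNr : (0 : ℝ) < N := by exact_mod_cast hN
  have hi : ((i : ℕ) : ℝ) + 1 ≤ N := by exact_mod_cast i.2
  ext x
  have key : ∀ hx : x ∈ Set.Ico (0 : ℝ) 1,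
      cell hN x = i ↔ (i : ℝ) ≤ N * x ∧ N * x < i + 1 := fun hx => by
    rw [Fin.ext_iff, cell_val hN hx, Nat.floor_eq_iff (mul_nonneg hNr.le hx.1)]
  rw [Set.mem_Ico, div_le_iff₀ hNr, lt_div_iff₀ hNr, mul_comm x]
  constructor
  · rintro ⟨h1, hx⟩
    exact (key hx).1 h1
  · rintro ⟨h1, h2⟩
    have hx : x ∈ Set.Ico (0 : ℝ) 1 := by
      constructor
      · have : (0 : ℝ) ≤ N * x := le_trans (by positivity) h1
        exact nonneg_of_mul_nonneg_right this hNr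
      · nlinarith
    exact ⟨(key hx).2 ⟨h1, h2⟩, hx⟩

theorem measureReal_cell (i : Fin N) :
    volume.real (cell hN ⁻¹' {i} ∩ Set.Ico 0 1) = 1 / N := by
  have hNr : (0 : ℝ) < N := by exact_mod_cast hN
  rw [cell_preimage_inter, Real.volume_real_Ico_of_le (by gcongr; linarith)]
  ring

theorem abs_sub_cell_le {x : ℝ} (hx : x ∈ Set.Ico (0 : ℝ) 1) :
    |x - (cell hN x : ℝ) / N| ≤ 1 / N := by
  have hNr : (0 : ℝ) < N := by exact_mod_cast hN
  have h : x ∈ cell hN ⁻¹' {cell hN x} ∩ Set.Ico 0 1 := ⟨rfl, hx⟩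
  rw [cell_preimage_inter, Set.mem_Ico, add_div] at h
  rw [abs_of_nonneg (by linarith [h.1])]
  linarith [h.2]

theorem measurable_cell_kernel (w : Fin N → Fin N → ℝ) :
    Measurable (Function.uncurry fun x y : ℝ => w (cell hN x) (cell hN y)) :=
  (measurable_of_countable (Function.uncurry w)).comp
    (((measurable_cell hN).comp measurable_fst).prodMk ((measurable_cell hN).comp measurable_snd))

theorem ae_mem_Ico_prod :
    ∀ᵐ z ∂(unitMeasure.prod unitMeasure), z.1 ∈ Set.Ico (0 : ℝ) 1 ∧ z.2 ∈ Set.Ico (0 : ℝ) 1 := by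
  rw [unitMeasure, Measure.prod_restrict]
  exact ae_restrict_mem (measurableSet_Ico.prod measurableSet_Ico)

theorem integrable_abs_sub_of_mem_Icc {Ω : Type*} [MeasurableSpace Ω] (ν : Measure Ω)
    [IsFiniteMeasure ν] {f g : Ω → ℝ} (hf : Measurable f) (hg : Measurable g)
    (hf1 : ∀ x, f x ∈ Set.Icc (0 : ℝ) 1) (hg1 : ∀ x, g x ∈ Set.Icc (0 : ℝ) 1) :
    Integrable (fun x => |f x - g x|) ν := by
  refine Integrable.of_bound (measurable_abs.comp (hf.sub hg)).aestronglyMeasurable 1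
    (Eventually.of_forall fun z => ?_)
  rw [Real.norm_eq_abs, abs_abs]
  exact (abs_sub_le_of_le_of_le (hf1 _).1 (hf1 _).2 (hg1 _).1 (hg1 _).2).trans (by simp)

theorem abs_sub_clip_le {t : ℝ} (ht : t ∈ Set.Icc (0 : ℝ) 1) (r : ℝ) :
    |t - max 0 (min 1 r)| ≤ |t - r| := by
  obtain ⟨h0, h1⟩ := ht
  rcases le_total r 0 with h | h
  · rw [min_eq_right (by linarith), max_eq_left h, abs_of_nonneg (by linarith),
      abs_of_nonneg (by linarith)]
    linarith
  · rcases le_total r 1 with h' | h'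
    · rw [min_eq_right h', max_eq_right h]
    · rw [min_eq_left h', max_eq_right zero_le_one, abs_of_nonpos (by linarith),
        abs_of_nonpos (by linarith)]
      linarith

theorem exists_step_approx {W : ℝ → ℝ → ℝ} (hW : IsGraphon W) {ε : ℝ} (hε : 0 < ε) :
    ∃ N₀ : ℕ, ∀ (N : ℕ) (hN : 0 < N), N₀ ≤ N → ∃ w : Fin N → Fin N → ℝ,
      (∀ i j, w i j = w j i) ∧ (∀ i j, w i j ∈ Set.Icc (0 : ℝ) 1) ∧
      ∫ z, |W z.1 z.2 - w (cell hN z.1) (cell hN z.2)| ∂(unitMeasure.prod unitMeasure) ≤ ε := by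
  obtain ⟨hWm, hWs, hW01⟩ := hW
  have hWi : Integrable (Function.uncurry W) (unitMeasure.prod unitMeasure) := by
    refine Integrable.of_bound hWm.aestronglyMeasurable 1 (Eventually.of_forall fun z => ?_)
    rw [Real.norm_eq_abs, Function.uncurry, abs_of_nonneg (hW01 _ _).1]
    exact (hW01 _ _).2
  obtain ⟨g, hgc, hgW, hgcont, hgi⟩ := hWi.exists_hasCompactSupport_integral_sub_le (half_pos hε)
  have hgu := hgc.uniformContinuous_of_continuous hgcont
  obtain ⟨δ, hδ, hgδ⟩ := Metric.uniformContinuous_iff.1 hgu (ε / 2) (half_pos hε)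
  obtain ⟨N₀, hN₀⟩ := exists_nat_gt (1 / δ)
  refine ⟨N₀, fun N hN hle => ?_⟩
  have hNr : (0 : ℝ) < N := by exact_mod_cast hN
  have hNδ : 1 / (N : ℝ) < δ := by
    rw [div_lt_comm₀ hNr hδ]
    exact hN₀.trans_le (by exact_mod_cast hle)
  set w : Fin N → Fin N → ℝ := fun i j =>
    max 0 (min 1 ((g ((i : ℝ) / N, (j : ℝ) / N) + g ((j : ℝ) / N, (i : ℝ) / N)) / 2)) with hw
  have hw01 : ∀ i j, w i j ∈ Set.Icc (0 : ℝ) 1 := fun i j =>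
    ⟨le_max_left _ _, max_le zero_le_one (min_le_left _ _)⟩
  refine ⟨w, fun i j => by simp only [hw]; rw [add_comm], hw01, ?_⟩
  have hd : Integrable (fun z : ℝ × ℝ => ‖Function.uncurry W z - g z‖)
    (unitMeasure.prod unitMeasure) := (hWi.sub hgi).norm
  have hswap : ∫ z : ℝ × ℝ, ‖Function.uncurry W z.swap - g z.swap‖ ∂(unitMeasure.prod unitMeasure)
      = ∫ z, ‖Function.uncurry W z - g z‖ ∂(unitMeasure.prod unitMeasure) :=
    integral_prod_swap fun z => ‖Function.uncurry W z - g z‖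
  have hds : Integrable (fun z : ℝ × ℝ => ‖Function.uncurry W z.swap - g z.swap‖)
    (unitMeasure.prod unitMeasure) := hd.swap
  have hsum : Integrable (fun z : ℝ × ℝ => 1 / 2 * ‖Function.uncurry W z - g z‖
      + 1 / 2 * ‖Function.uncurry W z.swap - g z.swap‖) (unitMeasure.prod unitMeasure) :=
    (hd.const_mul _).add (hds.const_mul _)
  calc ∫ z, |W z.1 z.2 - w (cell hN z.1) (cell hN z.2)| ∂(unitMeasure.prod unitMeasure)
      ≤ ∫ z : ℝ × ℝ, (1 / 2 * ‖Function.uncurry W z - g z‖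
          + 1 / 2 * ‖Function.uncurry W z.swap - g z.swap‖ + ε / 2)
          ∂(unitMeasure.prod unitMeasure) := by
        refine integral_mono_ae ?_ (hsum.add (integrable_const _)) ?_
        · exact integrable_abs_sub_of_mem_Icc _ hWm (measurable_cell_kernel hN w)
            (fun _ => hW01 _ _) fun _ => hw01 _ _
        · filter_upwards [ae_mem_Ico_prod] with z hz
          refine (abs_sub_clip_le (hW01 _ _) _).trans ?_
          have h1 := abs_sub_cell_le hN hz.1
          have h2 := abs_sub_cell_le hN hz.2
          have h3 : dist (g z) (g ((cell hN z.1 : ℝ) / N, (cell hN z.2 : ℝ) / N)) < ε / 2 := by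
            refine hgδ ?_
            rw [Prod.dist_eq]
            exact max_lt (h1.trans_lt hNδ) (h2.trans_lt hNδ)
          have h4 : dist (g z.swap) (g ((cell hN z.2 : ℝ) / N, (cell hN z.1 : ℝ) / N))
              < ε / 2 := by
            refine hgδ ?_
            rw [Prod.dist_eq]
            exact max_lt (h2.trans_lt hNδ) (h1.trans_lt hNδ)
          rw [Real.dist_eq] at h3 h4
          simp only [Real.norm_eq_abs, Function.uncurry, Prod.fst_swap, Prod.snd_swap]
          rw [hWs z.2 z.1]
          have h5 := abs_sub_le (W z.1 z.2) (g z) (g ((cell hN z.1 : ℝ) / N, (cell hN z.2 : ℝ) / N))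
          have h6 := abs_sub_le (W z.1 z.2) (g z.swap)
            (g ((cell hN z.2 : ℝ) / N, (cell hN z.1 : ℝ) / N))
          have h7 := abs_add_le
            (W z.1 z.2 - g ((cell hN z.1 : ℝ) / N, (cell hN z.2 : ℝ) / N))
            (W z.1 z.2 - g ((cell hN z.2 : ℝ) / N, (cell hN z.1 : ℝ) / N))
          have h8 : W z.1 z.2 - (g ((cell hN z.1 : ℝ) / N, (cell hN z.2 : ℝ) / N)
                + g ((cell hN z.2 : ℝ) / N, (cell hN z.1 : ℝ) / N)) / 2
              = 1 / 2 * ((W z.1 z.2 - g ((cell hN z.1 : ℝ) / N, (cell hN z.2 : ℝ) / N))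
                + (W z.1 z.2 - g ((cell hN z.2 : ℝ) / N, (cell hN z.1 : ℝ) / N))) := by ring
          rw [h8, abs_mul, abs_of_nonneg (by norm_num : (0 : ℝ) ≤ 1 / 2)]
          linarith
    _ ≤ ε := by
        rw [integral_add hsum (integrable_const _),
          integral_add (hd.const_mul _) (hds.const_mul _), integral_const_mul, integral_const_mul,
          hswap]
        simp only [integral_const, probReal_univ, one_smul]
        linarith

end Cells

section GraphonToAlgebra

variable {m : ℕ}

theorem setIntegral_cell_kernel {N : ℕ} (hN : 0 < N) (M : Fin N → Fin N → ℝ) {S T : Set ℝ} :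
    ∫ z in S ×ˢ T, M (cell hN z.1) (cell hN z.2) ∂(unitMeasure.prod unitMeasure)
      = ∑ i, ∑ j, M i j * (unitMeasure.restrict S).real (cell hN ⁻¹' {i})
          * (unitMeasure.restrict T).real (cell hN ⁻¹' {j}) := by
  have hτ : Measurable fun z : ℝ × ℝ => (cell hN z.1, cell hN z.2) :=
    ((measurable_cell hN).comp measurable_fst).prodMk ((measurable_cell hN).comp measurable_snd)
  rw [← Measure.prod_restrict]
  have h1 := integral_map (μ := (unitMeasure.restrict S).prod (unitMeasure.restrict T))
    hτ.aemeasurable (f := fun q : Fin N × Fin N => M q.1 q.2)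
    (measurable_of_countable _).aestronglyMeasurable
  rw [← h1, integral_fintype (Integrable.of_finite), Fintype.sum_prod_type]
  refine sum_congr rfl fun i _ => sum_congr rfl fun j _ => ?_
  have h2 : (fun z : ℝ × ℝ => (cell hN z.1, cell hN z.2)) ⁻¹' {(i, j)}
      = (cell hN ⁻¹' {i}) ×ˢ (cell hN ⁻¹' {j}) := by
    ext z
    simp
  rw [map_measureReal_apply hτ (measurableSet_singleton _), h2, measureReal_prod_prod]
  simp only [smul_eq_mul]
  ring

theorem unitMeasure_restrict_real_cell_le {N : ℕ} (hN : 0 < N) (S : Set ℝ) (i : Fin N) :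
    (unitMeasure.restrict S).real (cell hN ⁻¹' {i}) ≤ 1 / N := by
  rw [← measureReal_cell hN i]
  have h := measurableSet_cell_preimage hN {i}
  refine (ENNReal.toReal_mono (measure_ne_top _ _) (Measure.restrict_le_self _)).trans ?_
  rw [unitMeasure, Measure.restrict_apply h, measureReal_def]

theorem abs_setIntegral_cell_kernel_le {N : ℕ} (hN : 0 < N) {M : Fin N → Fin N → ℝ} {c : ℝ}
    (hM : CutLe M c) (S T : Set ℝ) :
    |∫ z in S ×ˢ T, M (cell hN z.1) (cell hN z.2) ∂(unitMeasure.prod unitMeasure)| ≤ c := by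
  have hNr : (0 : ℝ) < N := by exact_mod_cast hN
  have hmem : ∀ (S : Set ℝ) (i : Fin N),
      (N : ℝ) * (unitMeasure.restrict S).real (cell hN ⁻¹' {i}) ∈ Set.Icc (0 : ℝ) 1 := fun S i => by
    refine ⟨by positivity, ?_⟩
    have := unitMeasure_restrict_real_cell_le hN S i
    rw [le_div_iff₀ hNr] at this
    linarith
  have h := hM (fun i => N * (unitMeasure.restrict S).real (cell hN ⁻¹' {i}))
    (fun i => N * (unitMeasure.restrict T).real (cell hN ⁻¹' {i})) (hmem S) (hmem T)
  rw [setIntegral_cell_kernel]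
  rw [Fintype.card_fin] at h
  have e : ∑ i, ∑ j, M i j * (N * (unitMeasure.restrict S).real (cell hN ⁻¹' {i}))
        * (N * (unitMeasure.restrict T).real (cell hN ⁻¹' {j}))
      = (N : ℝ) ^ 2 * ∑ i, ∑ j, M i j * (unitMeasure.restrict S).real (cell hN ⁻¹' {i})
        * (unitMeasure.restrict T).real (cell hN ⁻¹' {j}) := by
    simp only [mul_sum]
    refine sum_congr rfl fun i _ => sum_congr rfl fun j _ => ?_
    ring
  rw [e, abs_mul, abs_of_pos (by positivity : (0 : ℝ) < (N : ℝ) ^ 2), mul_comm] at h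
  exact le_of_mul_le_mul_right h (by positivity)

theorem ae_eq_const_of_setIntegral_eq {f : ℝ × ℝ → ℝ} (hf : Measurable f)
    (hf1 : ∀ z, f z ∈ Set.Icc (0 : ℝ) 1) {p : ℝ} (hp : 0 < p)
    (h : ∀ S T, MeasurableSet S → MeasurableSet T →
      ∫ z in S ×ˢ T, (f z - p) ∂(unitMeasure.prod unitMeasure) = 0) :
    f =ᵐ[volume.restrict unitSquare] fun _ => p := by
  have hfi : ∀ (ν : Measure (ℝ × ℝ)) [IsFiniteMeasure ν], Integrable f ν := fun ν _ => by
    refine Integrable.of_bound hf.aestronglyMeasurable 1 (Eventually.of_forall fun z => ?_)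
    rw [Real.norm_eq_abs, abs_of_nonneg (hf1 z).1]
    exact (hf1 z).2
  have hm : Measurable fun z => ENNReal.ofReal (p⁻¹ * f z) := (hf.const_mul _).ennreal_ofReal
  have h1 : unitMeasure.prod unitMeasure
      = (unitMeasure.prod unitMeasure).withDensity fun z => ENNReal.ofReal (p⁻¹ * f z) := by
    refine Measure.prod_eq fun S T hS hT => ?_
    rw [withDensity_apply _ (hS.prod hT), ← ofReal_integral_eq_lintegral_ofReal
      ((hfi _).const_mul _) (Eventually.of_forall fun z => mul_nonneg (by positivity) (hf1 z).1),
      integral_const_mul]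
    have h2 := h S T hS hT
    rw [integral_sub (hfi _) (integrable_const _), integral_const, sub_eq_zero] at h2
    rw [h2, smul_eq_mul, mul_comm, mul_assoc, mul_inv_cancel₀ hp.ne', mul_one,
      measureReal_restrict_apply_univ, measureReal_def, ENNReal.ofReal_toReal (measure_ne_top _ _),
      Measure.prod_prod]
  rw [← unitMeasure_prod]
  have h3 : (unitMeasure.prod unitMeasure).withDensity 1
      = (unitMeasure.prod unitMeasure).withDensity fun z => ENNReal.ofReal (p⁻¹ * f z) := by
    rw [withDensity_one]
    exact h1
  have h4 := (withDensity_eq_iff measurable_one.aemeasurable hm.aemeasurable (by simp)).1 h3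
  filter_upwards [h4] with z hz
  have h5 : p⁻¹ * f z = 1 := by
    rw [Pi.one_apply, eq_comm, ENNReal.ofReal_eq_one] at hz
    exact hz
  rw [inv_mul_eq_div, div_eq_one_iff_eq hp.ne'] at h5
  exact h5

theorem ae_eq_const_of_cutLe {W : ℝ → ℝ → ℝ} (hW : IsGraphon W) {p : ℝ} (hp : 0 < p) {V : ℕ → ℕ}
    (hV : ∀ n, 0 < V n) {w : ∀ n, Fin (V n) → Fin (V n) → ℝ}
    (hw : ∀ n x y, w n x y ∈ Set.Icc (0 : ℝ) 1) {δ : ℕ → ℝ} (hδ : Tendsto δ atTop (nhds 0))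
    (hwW : ∀ n, ∫ z, |W z.1 z.2 - w n (cell (hV n) z.1) (cell (hV n) z.2)|
      ∂(unitMeasure.prod unitMeasure) ≤ δ n)
    (hcut : ∀ c > 0, ∀ᶠ n in atTop, CutLe (fun x y => w n x y - p) c) :
    (fun z : ℝ × ℝ => W z.1 z.2) =ᵐ[volume.restrict unitSquare] fun _ => p := by
  refine ae_eq_const_of_setIntegral_eq hW.1 (fun _ => hW.2.2 _ _) hp fun S T hS hT => ?_
  set I := ∫ z in S ×ˢ T, (W z.1 z.2 - p) ∂(unitMeasure.prod unitMeasure) with hI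
  have hintegrable : ∀ {f : ℝ × ℝ → ℝ}, Measurable f → (∀ z, f z ∈ Set.Icc (0 : ℝ) 1) →
      ∀ (ν : Measure (ℝ × ℝ)) [IsFiniteMeasure ν], Integrable f ν := fun hf hf1 ν _ => by
    refine Integrable.of_bound hf.aestronglyMeasurable 1 (Eventually.of_forall fun z => ?_)
    rw [Real.norm_eq_abs, abs_of_nonneg (hf1 z).1]
    exact (hf1 z).2
  have key : ∀ c > 0, |I| ≤ c := fun c hc => by
    have hlim : Tendsto (fun n => δ n + c) atTop (nhds c) := by simpa using hδ.add_const c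
    refine ge_of_tendsto hlim ?_
    filter_upwards [hcut c hc] with n hn
    have h1 := abs_setIntegral_cell_kernel_le (hV n) hn S T
    have hwm : Measurable fun z : ℝ × ℝ => w n (cell (hV n) z.1) (cell (hV n) z.2) :=
      measurable_cell_kernel (hV n) (w n)
    have hWi := hintegrable (f := fun z => W z.1 z.2) hW.1 (fun _ => hW.2.2 _ _)
      ((unitMeasure.prod unitMeasure).restrict (S ×ˢ T))
    have hwi := hintegrable hwm (fun _ => hw n _ _) ((unitMeasure.prod unitMeasure).restrict (S ×ˢ T))
    have h2 : I = (∫ z in S ×ˢ T, (W z.1 z.2 - w n (cell (hV n) z.1) (cell (hV n) z.2))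
        ∂(unitMeasure.prod unitMeasure))
        + ∫ z in S ×ˢ T, (w n (cell (hV n) z.1) (cell (hV n) z.2) - p)
          ∂(unitMeasure.prod unitMeasure) := by
      rw [hI, integral_sub hWi (integrable_const _), integral_sub hWi hwi,
        integral_sub hwi (integrable_const _)]
      ring
    have h3 : |∫ z in S ×ˢ T, (W z.1 z.2 - w n (cell (hV n) z.1) (cell (hV n) z.2))
        ∂(unitMeasure.prod unitMeasure)| ≤ δ n :=
      abs_integral_le_integral_abs.trans ((setIntegral_le_integral
        (integrable_abs_sub_of_mem_Icc _ hW.1 hwm (fun _ => hW.2.2 _ _) fun _ => hw n _ _)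
        (Eventually.of_forall fun _ => abs_nonneg _)).trans (hwW n))
    rw [h2]
    exact (abs_add_le _ _).trans (add_le_add h3 h1)
  have h0 : |I| ≤ 0 := le_of_forall_pos_le_add fun c hc => by simpa using key c hc
  exact abs_nonpos_iff.1 h0

theorem abs_sum_symEdgeProd_sub_le_of_graphonPt (F : SimpleGraph (Fin m)) (hm : 0 < m)
    {W : ℝ → ℝ → ℝ} (hW : IsGraphon W) {p : ℝ} (hP : GraphonPt F W p fun _ => 1 / (m : ℝ))
    {k : ℕ} (hN : 0 < m * k) {w : Fin (m * k) → Fin (m * k) → ℝ}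
    (hw : ∀ x y, w x y ∈ Set.Icc (0 : ℝ) 1) {δ : ℝ}
    (hwW : ∫ z, |W z.1 z.2 - w (cell hN z.1) (cell hN z.2)| ∂(unitMeasure.prod unitMeasure) ≤ δ)
    {U : Fin m → Finset (Fin (m * k))} (hU : Pairwise fun i j => Disjoint (U i) (U j))
    (hcard : ∀ i, (U i).card = k) :
    |∑ x : Fin m → Fin (m * k), symEdgeProd F w x * ∏ i, (if x i ∈ U i then (1 : ℝ) else 0)
      - p ^ numEdges F * ∏ i, ((U i).card : ℝ)| ≤ numEdges F * δ * ((m * k : ℕ) : ℝ) ^ m := by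
  have hmr : (0 : ℝ) < m := by exact_mod_cast hm
  have hNr : (0 : ℝ) < ((m * k : ℕ) : ℝ) := by exact_mod_cast hN
  set A : Fin m → Set ℝ := fun i => cell hN ⁻¹' (U i) ∩ Set.Ico 0 1 with hA
  have hAm : ∀ i, MeasurableSet (A i) := fun i =>
    (measurableSet_cell_preimage hN _).inter measurableSet_Ico
  have hcell : ∀ (i : Fin m) (y : Fin (m * k)), volume.real (cell hN ⁻¹' {y} ∩ A i)
      = ((m * k : ℕ) : ℝ)⁻¹ * if y ∈ U i then (1 : ℝ) else 0 := fun i y => by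
    split_ifs with hy
    · rw [mul_one, inv_eq_one_div, ← measureReal_cell hN y]
      congr 1
      ext x
      simp only [hA, Set.mem_inter_iff, Set.mem_preimage, Set.mem_singleton_iff, mem_coe]
      exact ⟨fun h => ⟨h.1, h.2.2⟩, fun h => ⟨h.1, h.1 ▸ hy, h.2⟩⟩
    · rw [mul_zero]
      have : cell hN ⁻¹' {y} ∩ A i = ∅ := by
        ext x
        simp only [hA, Set.mem_inter_iff, Set.mem_preimage, Set.mem_singleton_iff, mem_coe,
          Set.mem_empty_iff_false, iff_false]
        rintro ⟨rfl, h, _⟩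
        exact hy h
      rw [this, measureReal_empty]
  have hfin : ∀ i, volume (A i) ≠ ⊤ := fun i =>
    ((measure_mono Set.inter_subset_right).trans_lt (by simp)).ne
  have hvol : ∀ i, volume (A i) = ENNReal.ofReal (1 / (m : ℝ)) := fun i => by
    rw [← ENNReal.ofReal_toReal (hfin i), ← measureReal_def]
    congr 1
    have h1 : A i = ⋃ y ∈ U i, cell hN ⁻¹' {y} ∩ A i := by
      ext x
      simp only [hA, Set.mem_iUnion, Set.mem_inter_iff, Set.mem_preimage, Set.mem_singleton_iff,
        mem_coe, exists_prop]
      exact ⟨fun h => ⟨_, h.1, rfl, h⟩, fun ⟨_, _, _, h⟩ => h⟩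
    have hfin' : ∀ y ∈ U i, volume (cell hN ⁻¹' {y} ∩ A i) ≠ ⊤ := fun y _ =>
      ((measure_mono Set.inter_subset_right).trans_lt (hfin i).lt_top).ne
    rw [h1, measureReal_biUnion_finset _ _ hfin']
    · rw [sum_congr rfl fun y hy => (hcell i y).trans (by rw [if_pos hy]), sum_const, hcard]
      have hk : (k : ℝ) ≠ 0 := by
        rintro h
        rw [Nat.cast_eq_zero] at h
        simp [h] at hN
      rw [nsmul_eq_mul]
      push_cast
      field_simp
    · intro y _ z _ hyz
      refine Set.disjoint_left.2 fun x hx hx' => hyz ?_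
      exact hx.1.symm.trans hx'.1
    · exact fun y _ => (measurableSet_cell_preimage hN _).inter (hAm i)
  have h1 := hP A hAm (fun i => Set.inter_subset_right.trans Set.Ico_subset_Icc_self)
    (fun i j hij => Set.disjoint_left.2 fun x hx hx' =>
      Finset.disjoint_left.1 (hU hij) hx.1 hx'.1) hvol
  simp only [psiSym_eq_symEdgeProd] at h1
  have h2 := setIntegral_pi_comp hfin (fun y => measurableSet_cell_preimage hN {y})
    fun t => symEdgeProd F w t
  have h3 := abs_setIntegral_symEdgeProd_sub_le F hW.1 (measurable_cell_kernel hN w) hW.2.2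
    (fun _ _ => hw _ _) (A := A) fun i => Set.inter_subset_right
  have h4 : ∫ x in Set.univ.pi A, symEdgeProd F (fun x y : ℝ => w (cell hN x) (cell hN y)) x
      = ∑ t, symEdgeProd F w t * ∏ i, volume.real (cell hN ⁻¹' {t i} ∩ A i) := h2
  rw [h1, h4] at h3
  simp only [hcell, prod_mul_distrib, prod_const, card_univ, Fintype.card_fin, hcard] at h3 ⊢
  have h5 : p ^ numEdges F * (k : ℝ) ^ m
      = ((m * k : ℕ) : ℝ) ^ m * (p ^ numEdges F * (1 / (m : ℝ)) ^ m) := by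
    push_cast
    rw [mul_pow, div_pow, one_pow]
    field_simp
  have h6 : ∑ x : Fin m → Fin (m * k), symEdgeProd F w x * ∏ i, (if x i ∈ U i then (1 : ℝ) else 0)
      = ((m * k : ℕ) : ℝ) ^ m * ∑ t, symEdgeProd F w t
        * (((m * k : ℕ) : ℝ)⁻¹ ^ m * ∏ i, if t i ∈ U i then (1 : ℝ) else 0) := by
    rw [mul_sum]
    refine sum_congr rfl fun x _ => ?_
    rw [inv_pow]
    field_simp
  rw [h5, h6, ← mul_sub, abs_mul, abs_of_pos (by positivity : (0 : ℝ) < ((m * k : ℕ) : ℝ) ^ m),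
    mul_comm, abs_sub_comm]
  refine mul_le_mul_of_nonneg_right (h3.trans ?_) (by positivity)
  exact mul_le_mul_of_nonneg_left hwW (by positivity)

theorem exists_affine_of_graphon (F : SimpleGraph (Fin m)) {p : ℝ} (hp : 0 < p)
    {W : ℝ → ℝ → ℝ} (hW : IsGraphon W)
    (hne : ¬ ((fun z : ℝ × ℝ => W z.1 z.2) =ᵐ[volume.restrict unitSquare] fun _ => p))
    (hP : GraphonPt F W p fun _ => 1 / (m : ℝ)) :
    ∃ u v s : ℝ, 0 ≤ u ∧ 0 ≤ v ∧ 0 ≤ s ∧ ¬ (u = v ∧ v = s) ∧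
      ∃ a b : ℝ, ¬ (a = 0 ∧ b = 0) ∧ ∀ k ≤ m,
        ∑ A ∈ Finset.powersetCard k (Finset.univ : Finset (Fin m)),
            u ^ edgesIn F A * v ^ edgesIn F Aᶜ * s ^ edgesBetween F A Aᶜ
          = (m.choose k : ℝ) * (a + b * k) := by
  rcases Nat.eq_zero_or_pos m with rfl | hm
  · refine ⟨0, 0, 1, le_rfl, le_rfl, zero_le_one, by simp, 1, 0, by simp, fun k hk => ?_⟩
    obtain rfl := Nat.le_zero.1 hk
    simp [edgesIn, edgesBetween]
  · have hmr : (0 : ℝ) < m := by exact_mod_cast hm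
    choose N₀ hN₀ using fun n : ℕ =>
      exists_step_approx hW (ε := 1 / ((n : ℝ) + 1)) (by positivity)
    set k : ℕ → ℕ := fun n => max (n + 1) (N₀ n) with hk
    have hk1 : ∀ n, n + 1 ≤ k n := fun n => le_max_left _ _
    have hV : ∀ n, 0 < m * k n := fun n => Nat.mul_pos hm (by have := hk1 n; omega)
    choose w hws hw01 hwW using fun n => hN₀ n (m * k n) (hV n)
      ((le_max_right _ _).trans (Nat.le_mul_of_pos_left _ hm))
    have hVt : Tendsto (fun n => m * k n) atTop atTop :=
      tendsto_atTop_mono (fun n => ((Nat.le_succ n).trans (hk1 n)).trans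
        (Nat.le_mul_of_pos_left _ hm)) tendsto_id
    have hδ : Tendsto (fun n : ℕ => 1 / ((n : ℝ) + 1)) atTop (nhds 0) :=
      tendsto_one_div_add_atTop_nhds_zero_nat
    have hbad : ∃ c > 0, ∃ᶠ n in atTop, ¬ CutLe (fun x y => w n x y - p) c := by
      by_contra! hcut
      refine hne (ae_eq_const_of_cutLe hW hp hV hw01 hδ hwW fun c hc => ?_)
      simpa [Filter.Frequently] using hcut c hc
    obtain ⟨c, hc, hbad⟩ := hbad
    refine exists_affine_of_kernels F hp hVt hws hw01
      (ε := fun n => numEdges F * (1 / ((n : ℝ) + 1))) (by simpa using hδ.const_mul (numEdges F : ℝ))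
      (fun n U hU hcard => ?_) hc hbad
    refine abs_sum_symEdgeProd_sub_le_of_graphonPt F hm hW hP (hV n) (hw01 n) (hwW n) hU fun i => ?_
    rw [hcard i]
    have : 1 / (m : ℝ) * ((m * k n : ℕ) : ℝ) = (k n : ℕ) := by
      push_cast
      field_simp
    rw [this, Nat.floor_natCast]

end GraphonToAlgebra

open Polynomial in
/-- **Lemma (Lalg).** For a graph `F` on `m` vertices, the following are equivalent:
(i) `P̃(F;1/m,…,1/m)` fails to be `p`-quasi-random for some `p ∈ (0,1]`;
(ii) for some `p ∈ (0,1]` some graphon not a.e. equal to `p` satisfies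
`P̃^W(F;1/m,…,1/m)`;
(iii) there are `u,v,s ≥ 0` not all equal and `(a,b) ≠ (0,0)` with
`∑_{|A|=k} u^(e_F A) v^(e_F Aᶜ) s^(e_F(A,Aᶜ)) = C(m,k)(a + bk)` for `k = 0,…,m`;
(iv) there are `u,v,s ≥ 0` not all equal such that
`Λ(q) = ∑_A u^(e_F A) v^(e_F Aᶜ) s^(e_F(A,Aᶜ)) q^|A| (1−q)^(m−|A|)` has degree `≤ 1`
and is not identically zero;
(v) there are `u,v,s ≥ 0` not all equal such that
`Λ̂(x) = ∑_A u^(e_F A) v^(e_F Aᶜ) s^(e_F(A,Aᶜ)) (x−1)^|A|` is divisible by `x^(m−1)`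
and is not identically zero. -/
theorem stmt17 {m : ℕ} (F : SimpleGraph (Fin m)) :
    ((∃ p : ℝ, 0 < p ∧ p ≤ 1 ∧
        ¬ (∀ (V : ℕ → ℕ) (G : ∀ n, SimpleGraph (Fin (V n))), Tendsto V atTop atTop →
            (SatisfiesPt F p (fun _ => 1 / (m : ℝ)) V G ↔ IsQuasirandom p V G)))
      ↔ (∃ p : ℝ, 0 < p ∧ p ≤ 1 ∧ ∃ W : ℝ → ℝ → ℝ, IsGraphon W ∧
          ¬ ((fun z : ℝ × ℝ => W z.1 z.2)
              =ᵐ[volume.restrict unitSquare] fun _ => p) ∧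
          GraphonPt F W p (fun _ => 1 / (m : ℝ))))
    ∧ ((∃ p : ℝ, 0 < p ∧ p ≤ 1 ∧ ∃ W : ℝ → ℝ → ℝ, IsGraphon W ∧
          ¬ ((fun z : ℝ × ℝ => W z.1 z.2)
              =ᵐ[volume.restrict unitSquare] fun _ => p) ∧
          GraphonPt F W p (fun _ => 1 / (m : ℝ)))
      ↔ (∃ u v s : ℝ, 0 ≤ u ∧ 0 ≤ v ∧ 0 ≤ s ∧ ¬ (u = v ∧ v = s) ∧
          ∃ a b : ℝ, ¬ (a = 0 ∧ b = 0) ∧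
          ∀ k ≤ m,
            ∑ A ∈ Finset.powersetCard k (Finset.univ : Finset (Fin m)),
                u ^ edgesIn F A * v ^ edgesIn F Aᶜ * s ^ edgesBetween F A Aᶜ
              = (m.choose k : ℝ) * (a + b * k)))
    ∧ ((∃ u v s : ℝ, 0 ≤ u ∧ 0 ≤ v ∧ 0 ≤ s ∧ ¬ (u = v ∧ v = s) ∧
          ∃ a b : ℝ, ¬ (a = 0 ∧ b = 0) ∧
          ∀ k ≤ m,
            ∑ A ∈ Finset.powersetCard k (Finset.univ : Finset (Fin m)),
                u ^ edgesIn F A * v ^ edgesIn F Aᶜ * s ^ edgesBetween F A Aᶜ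
              = (m.choose k : ℝ) * (a + b * k))
      ↔ (∃ u v s : ℝ, 0 ≤ u ∧ 0 ≤ v ∧ 0 ≤ s ∧ ¬ (u = v ∧ v = s) ∧
          (∑ A : Finset (Fin m),
              C (u ^ edgesIn F A * v ^ edgesIn F Aᶜ * s ^ edgesBetween F A Aᶜ) *
                X ^ A.card * (1 - X) ^ (m - A.card) : ℝ[X]).degree ≤ 1 ∧
          (∑ A : Finset (Fin m),
              C (u ^ edgesIn F A * v ^ edgesIn F Aᶜ * s ^ edgesBetween F A Aᶜ) *
                X ^ A.card * (1 - X) ^ (m - A.card) : ℝ[X]) ≠ 0))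
    ∧ ((∃ u v s : ℝ, 0 ≤ u ∧ 0 ≤ v ∧ 0 ≤ s ∧ ¬ (u = v ∧ v = s) ∧
          (∑ A : Finset (Fin m),
              C (u ^ edgesIn F A * v ^ edgesIn F Aᶜ * s ^ edgesBetween F A Aᶜ) *
                X ^ A.card * (1 - X) ^ (m - A.card) : ℝ[X]).degree ≤ 1 ∧
          (∑ A : Finset (Fin m),
              C (u ^ edgesIn F A * v ^ edgesIn F Aᶜ * s ^ edgesBetween F A Aᶜ) *
                X ^ A.card * (1 - X) ^ (m - A.card) : ℝ[X]) ≠ 0)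
      ↔ (∃ u v s : ℝ, 0 ≤ u ∧ 0 ≤ v ∧ 0 ≤ s ∧ ¬ (u = v ∧ v = s) ∧
          (X ^ (m - 1) : ℝ[X]) ∣
            (∑ A : Finset (Fin m),
              C (u ^ edgesIn F A * v ^ edgesIn F Aᶜ * s ^ edgesBetween F A Aᶜ) *
                (X - 1) ^ A.card : ℝ[X]) ∧
          (∑ A : Finset (Fin m),
              C (u ^ edgesIn F A * v ^ edgesIn F Aᶜ * s ^ edgesBetween F A Aᶜ) *
                (X - 1) ^ A.card : ℝ[X]) ≠ 0)) := by
  have h23 : (∃ u v s : ℝ, 0 ≤ u ∧ 0 ≤ v ∧ 0 ≤ s ∧ ¬ (u = v ∧ v = s) ∧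
      ∃ a b : ℝ, ¬ (a = 0 ∧ b = 0) ∧ ∀ k ≤ m,
        ∑ A ∈ Finset.powersetCard k (Finset.univ : Finset (Fin m)),
            u ^ edgesIn F A * v ^ edgesIn F Aᶜ * s ^ edgesBetween F A Aᶜ
          = (m.choose k : ℝ) * (a + b * k)) →
      ∃ p : ℝ, 0 < p ∧ p ≤ 1 ∧ ∃ W : ℝ → ℝ → ℝ, IsGraphon W ∧
        ¬ ((fun z : ℝ × ℝ => W z.1 z.2) =ᵐ[volume.restrict unitSquare] fun _ => p) ∧
        GraphonPt F W p (fun _ => 1 / (m : ℝ)) := by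
    rintro ⟨u, v, s, hu, hv, hs, hne, a, b, hab, h⟩
    obtain ⟨K, a', b', p, hsym, hK, hKne, hψ, hp0, hp1, hp⟩ :=
      exists_affine_kernel F hu hv hs hne hab h
    exact ⟨p, hp0, hp1, exists_graphon_of_affine_kernel F hsym hK hKne hψ hp⟩
  have hw : ∀ u v s : ℝ, m = 0 → ∑ A ∈ powersetCard 0 (univ : Finset (Fin m)),
      u ^ edgesIn F A * v ^ edgesIn F Aᶜ * s ^ edgesBetween F A Aᶜ ≠ 0 := by
    rintro u v s rfl
    simp [edgesIn, edgesBetween]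
  have hbern : ∀ u v s : ℝ, _ := fun u v s => affine_iff_bernstein_degree
    (fun k => ∑ A ∈ powersetCard k (univ : Finset (Fin m)),
      u ^ edgesIn F A * v ^ edgesIn F Aᶜ * s ^ edgesBetween F A Aᶜ) (hw u v s)
  have hshift : ∀ u v s : ℝ, _ := fun u v s => affine_iff_shifted_dvd
    (fun k => ∑ A ∈ powersetCard k (univ : Finset (Fin m)),
      u ^ edgesIn F A * v ^ edgesIn F Aᶜ * s ^ edgesBetween F A Aᶜ) (hw u v s)
  refine ⟨⟨?_, ?_⟩, ⟨?_, h23⟩, ?_, ?_⟩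
  · rintro ⟨p, hp0, hp1, h⟩
    push Not at h
    obtain ⟨V, G, hV, h⟩ := h
    exact h23 (exists_affine_of_not_isQuasirandom_iff F hp0 hp1 hV fun hiff => by tauto)
  · rintro ⟨p, hp0, _, W, hW, hne, hP⟩
    obtain ⟨u, v, s, hu, hv, hs, hne, a, b, hab, h⟩ := exists_affine_of_graphon F hp0 hW hne hP
    obtain ⟨K, a', b', q, hsym, hK, hKne, hψ, hq0, hq1, hq⟩ :=
      exists_affine_kernel F hu hv hs hne hab h
    obtain ⟨V, G, hV, hPt, hqr⟩ := exists_seq_of_affine_kernel F hsym hK hKne hψ hq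
    exact ⟨q, hq0, hq1, fun hall => hqr ((hall V G hV).1 hPt)⟩
  · rintro ⟨p, hp0, _, W, hW, hne, hP⟩
    exact exists_affine_of_graphon F hp0 hW hne hP
  · simp only [sum_finset_bernstein, hbern]
  · simp only [sum_finset_bernstein, sum_finset_shifted, ← hbern, ← hshift]
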